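/- arXiv:2212.02290 — 12 statements merged into one kernel-verified Lean document; each statement's English description precedes it below -/
import Mathlib

section
/- Let X be a locally compact Hausdorff space and let f, g be positive elements of the C*-algebra C₀(X, ℂ) of continuous complex-valued functions on X vanishing at infinity. Then f is Cuntz subequivalent to g (in C₀(X, ℂ)) if and only if for every x ∈ X, g(x) = 0 implies f(x) = 0 (equivalently, the open support {x : f(x) ≠ 0} of f is contained in the open support of g). -/
open ComplexOrder
open scoped ZeroAtInfty

/-- Cuntz subequivalence in a (non-unital) C*-algebra: `a ≾ b` iff for every `ε > 0` there is
`r` with `‖r * b * star r - a‖ < ε`. -/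
def CuntzLE {A : Type*} [NonUnitalCStarAlgebra A] (a b : A) : Prop :=
  ∀ ε > 0, ∃ r : A, ‖r * b * star r - a‖ < ε

theorem c0_norm_apply_le {X : Type*} [TopologicalSpace X] (u : C₀(X, ℂ)) (x : X) :
    ‖u x‖ ≤ ‖u‖ := by
  rw [← ZeroAtInftyContinuousMap.norm_toBCF_eq_norm]
  exact u.toBCF.norm_coe_le_norm x

theorem cuntzLE_iff_support_subset {X : Type*} [TopologicalSpace X] [LocallyCompactSpace X]
    [T2Space X] (f g : C₀(X, ℂ)) (hf : ∀ x, 0 ≤ f x) (hg : ∀ x, 0 ≤ g x) :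
    CuntzLE f g ↔ ∀ x : X, g x = 0 → f x = 0 := by
  constructor
  · intro h x hx
    rw [← norm_le_zero_iff]
    refine le_of_forall_pos_le_add fun ε hε => ?_
    obtain ⟨r, hr⟩ := h ε hε
    have h1 := c0_norm_apply_le (r * g * star r - f) x
    simp [hx] at h1
    linarith
  · intro h ε hε
    have hfc : Continuous fun x => ‖f x‖ := (map_continuous f).norm
    have hgc : Continuous fun x => ‖g x‖ := (map_continuous g).norm
    have hf0 : Filter.Tendsto (fun x => ‖f x‖) (Filter.cocompact X) (nhds 0) := by
      simpa using (zero_at_infty f).norm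
    have hFe : ∀ x, f x = ((‖f x‖ : ℝ) : ℂ) := fun x => by
      have := Complex.eq_coe_norm_of_nonneg (hf x)
      exact this
    have hGe : ∀ x, g x = ((‖g x‖ : ℝ) : ℂ) := fun x => by
      have := Complex.eq_coe_norm_of_nonneg (hg x)
      exact this
    have hK : IsCompact {x | ε / 2 ≤ ‖f x‖} := by
      have h1 := hf0.eventually (gt_mem_nhds (half_pos hε))
      obtain ⟨t, ht, hts⟩ := Filter.mem_cocompact.1 h1
      refine ht.of_isClosed_subset (isClosed_le continuous_const hfc) fun x hx => ?_
      by_contra hxt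
      have h2 : ‖f x‖ < ε / 2 := hts hxt
      have h3 : ε / 2 ≤ ‖f x‖ := hx
      linarith
    obtain ⟨δ, hδ, hδK⟩ := hK.exists_forall_le' (a := 0) hgc.continuousOn (by
      intro x hx
      rw [norm_pos_iff]
      intro h0
      have hx' : ε / 2 ≤ ‖f x‖ := hx
      rw [h x h0, norm_zero] at hx'
      linarith)
    have hmpos : ∀ x, 0 < max ‖g x‖ δ := fun x => lt_max_of_lt_right hδ
    let s : X → ℝ := fun x => √(max (‖f x‖ - ε / 2) 0 / max ‖g x‖ δ)
    have hsc : Continuous s := by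
      refine Continuous.sqrt (Continuous.div ?_ ?_ fun x => (hmpos x).ne')
      · exact (hfc.sub continuous_const).max continuous_const
      · exact hgc.max continuous_const
    have hs0 : Filter.Tendsto s (Filter.cocompact X) (nhds 0) := by
      have h1 : Filter.Tendsto (fun x => √(‖f x‖ / δ)) (Filter.cocompact X) (nhds 0) := by
        simpa using (hf0.div_const δ).sqrt
      refine squeeze_zero (fun x => Real.sqrt_nonneg _) (fun x => ?_) h1
      refine Real.sqrt_le_sqrt ?_
      refine div_le_div₀ (norm_nonneg _) (max_le (by linarith) (norm_nonneg _)) hδ (le_max_right _ _)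
    let r : C₀(X, ℂ) :=
      { toFun := fun x => (s x : ℂ)
        continuous_toFun := Complex.continuous_ofReal.comp hsc
        zero_at_infty' := by
          have := (Complex.continuous_ofReal.tendsto 0).comp hs0
          rw [Complex.ofReal_zero] at this
          exact this }
    have hrx : ∀ x, r x = (s x : ℂ) := fun x => rfl
    refine ⟨r, lt_of_le_of_lt ?_ (half_lt_self hε)⟩
    rw [← ZeroAtInftyContinuousMap.norm_toBCF_eq_norm]
    refine (BoundedContinuousFunction.norm_le (half_pos hε).le).2 fun x => ?_
    change ‖(r * g * star r - f) x‖ ≤ ε / 2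
    have hval : s x * ‖g x‖ * s x = max (‖f x‖ - ε / 2) 0 := by
      have hss : s x * s x = max (‖f x‖ - ε / 2) 0 / max ‖g x‖ δ :=
        Real.mul_self_sqrt (div_nonneg (le_max_right _ _) (hmpos x).le)
      rw [mul_right_comm, hss]
      by_cases hx : ε / 2 ≤ ‖f x‖
      · have hd := hδK x hx
        rw [max_eq_left hd, div_mul_cancel₀]
        exact (hδ.trans_le hd).ne'
      · rw [max_eq_right (by linarith : ‖f x‖ - ε / 2 ≤ 0)]
        simp
    have heq : (r * g * star r - f) x = ((s x * ‖g x‖ * s x - ‖f x‖ : ℝ) : ℂ) := by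
      rw [ZeroAtInftyContinuousMap.sub_apply, ZeroAtInftyContinuousMap.mul_apply,
        ZeroAtInftyContinuousMap.mul_apply, ZeroAtInftyContinuousMap.star_apply, hrx]
      push_cast
      rw [← hFe, ← hGe]
      simp
    rw [heq, hval, Complex.norm_real, Real.norm_eq_abs, abs_le]
    have := norm_nonneg (f x)
    constructor
    · linarith [le_max_left (‖f x‖ - ε / 2) 0]
    · have : max (‖f x‖ - ε / 2) 0 ≤ ‖f x‖ := max_le (by linarith) this
      linarith
end

section
/- Let A be a C*-algebra, let ε > 0, and let a, b ∈ A be positive elements with ‖a − b‖ < ε. Then there exists a contraction r ∈ A (i.e., ‖r‖ ≤ 1) such that r * b * (star r) = (a − ε)₊. In particular, (a − ε)₊ ≾ b. -/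
/-- Cuntz equivalence. -/
def CuntzEquiv {A : Type*} [NonUnitalCStarAlgebra A] (a b : A) : Prop :=
  CuntzLE a b ∧ CuntzLE b a

/-- The ε-cut-down `(a - ε)₊` of an element, via non-unital continuous functional calculus. -/
noncomputable def cutDown {A : Type*} [NonUnitalCStarAlgebra A] (a : A) (ε : ℝ) : A :=
  cfcₙ (fun t : ℝ => max (t - ε) 0) a

open Filter Topology in
theorem aux_theta {A : Type*} [NonUnitalCStarAlgebra A] (q : A) (hq : IsSelfAdjoint q)
    (δ : ℝ) (hδ : 0 < δ) :
    ∃ θ : A, star θ = θ ∧ ‖q * θ‖ ≤ 1 ∧ ‖q - q * (θ * q)‖ ≤ δ := by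
  have hpos : ∀ t : ℝ, 0 < t ^ 2 + δ ^ 2 := fun t => by positivity
  have hc : Continuous fun t : ℝ => t / (t ^ 2 + δ ^ 2) :=
    Continuous.div (by fun_prop) (by fun_prop) fun t => (hpos t).ne'
  have e1 : q * cfcₙ (fun t : ℝ => t / (t ^ 2 + δ ^ 2)) q
      = cfcₙ (fun t : ℝ => t * (t / (t ^ 2 + δ ^ 2))) q := by
    rw [cfcₙ_mul (fun t : ℝ => t) (fun t : ℝ => t / (t ^ 2 + δ ^ 2)) q (by fun_prop) (by simp)
      hc.continuousOn (by simp), cfcₙ_id' ℝ q hq]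
  have e2 : q * (cfcₙ (fun t : ℝ => t / (t ^ 2 + δ ^ 2)) q * q)
      = cfcₙ (fun t : ℝ => (t * (t / (t ^ 2 + δ ^ 2))) * t) q := by
    rw [cfcₙ_mul (fun t : ℝ => t * (t / (t ^ 2 + δ ^ 2))) (fun t : ℝ => t) q
      (continuous_id.mul hc).continuousOn (by simp) (by fun_prop) (by simp), cfcₙ_id' ℝ q hq,
      ← e1, mul_assoc]
  have e3 : q - q * (cfcₙ (fun t : ℝ => t / (t ^ 2 + δ ^ 2)) q * q)
      = cfcₙ (fun t : ℝ => t - (t * (t / (t ^ 2 + δ ^ 2))) * t) q := by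
    rw [cfcₙ_sub (fun t : ℝ => t) (fun t : ℝ => (t * (t / (t ^ 2 + δ ^ 2))) * t) q
      (by fun_prop) (by simp) ((continuous_id.mul hc).mul continuous_id).continuousOn (by simp),
      cfcₙ_id' ℝ q hq, ← e2]
  refine ⟨cfcₙ (fun t : ℝ => t / (t ^ 2 + δ ^ 2)) q, (IsSelfAdjoint.cfcₙ).star_eq, ?_, ?_⟩
  · rw [e1]
    refine norm_cfcₙ_le fun t _ => ?_
    have := hpos t
    have h2 : t * (t / (t ^ 2 + δ ^ 2)) = t ^ 2 / (t ^ 2 + δ ^ 2) := by ring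
    rw [h2, Real.norm_of_nonneg (by positivity), div_le_one this]
    nlinarith
  · rw [e3]
    refine norm_cfcₙ_le fun t _ => ?_
    have := hpos t
    have h2 : t - t * (t / (t ^ 2 + δ ^ 2)) * t = t * δ ^ 2 / (t ^ 2 + δ ^ 2) := by
      field_simp; ring
    rw [h2, Real.norm_eq_abs, abs_div, abs_of_pos this, div_le_iff₀ this, abs_mul,
      abs_of_pos (by positivity : 0 < δ ^ 2)]
    have h3 := sq_abs t
    nlinarith [sq_nonneg (|t| - δ), abs_nonneg t, mul_nonneg hδ.le (sq_nonneg (|t| - δ)),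
      mul_nonneg (abs_nonneg t) (sq_nonneg δ)]

theorem aux_le {A : Type*} [NonUnitalCStarAlgebra A] [PartialOrder A] [StarOrderedRing A]
    (p q : A) (hp : star p = p) (hq : star q = q) (h : p * p ≤ q * q) (z : A) :
    ‖p * z‖ ≤ ‖q * z‖ := by
  have h1 := star_left_conjugate_le_conjugate h z
  have h2 : ∀ p : A, star p = p → star z * (p * p) * z = star (p * z) * (p * z) := by
    intro p hp
    simp [hp, mul_assoc]
  rw [h2 p hp, h2 q hq] at h1
  have h3 := CStarAlgebra.norm_le_norm_of_nonneg_of_le (star_mul_self_nonneg _) h1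
  rw [CStarRing.norm_star_mul_self, CStarRing.norm_star_mul_self] at h3
  exact (mul_self_le_mul_self_iff (norm_nonneg _) (norm_nonneg _)).2 h3

theorem aux_le' {A : Type*} [NonUnitalCStarAlgebra A] [PartialOrder A] [StarOrderedRing A]
    (p q : A) (hp : star p = p) (hq : star q = q) (h : p * p ≤ q * q) (z : A) :
    ‖p - p * z‖ ≤ ‖q - q * z‖ := by
  obtain ⟨w, hw⟩ := CStarAlgebra.nonneg_iff_eq_star_mul_self.1 (sub_nonneg.2 h)
  have h1 : star (p - p * z) * (p - p * z) ≤ star (q - q * z) * (q - q * z) := by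
    rw [← sub_nonneg]
    have : star (q - q * z) * (q - q * z) - star (p - p * z) * (p - p * z)
        = star (w - w * z) * (w - w * z) := by
      have e : ∀ x : A, star (x - x * z) * (x - x * z) = star x * x - star x * x * z
          - star z * (star x * x) + star z * (star x * x) * z := by
        intro x
        simp only [star_sub, star_mul, sub_mul, mul_sub, mul_assoc]; abel
      rw [e, e, e, ← hw, hp, hq]
      simp only [sub_mul, mul_sub]; abel
    rw [this]
    exact star_mul_self_nonneg _
  have h3 := CStarAlgebra.norm_le_norm_of_nonneg_of_le (star_mul_self_nonneg _) h1
  rw [CStarRing.norm_star_mul_self, CStarRing.norm_star_mul_self] at h3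
  exact (mul_self_le_mul_self_iff (norm_nonneg _) (norm_nonneg _)).2 h3

open Filter Topology in
theorem aux_main {A : Type*} [NonUnitalCStarAlgebra A] [PartialOrder A] [StarOrderedRing A]
    (p q X : A) (hp : star p = p) (hq : star q = q) (h : p * p ≤ q * q)
    (hX : X * star X = q * q) :
    ∃ (T : ℕ → A) (y : A), (∀ n, ‖T n‖ ≤ 1) ∧ Tendsto (fun n => T n * X) atTop (𝓝 y) ∧
      y * star y = p * p := by
  have hδ : ∀ n : ℕ, 0 < (1 : ℝ) / (n + 1) := fun n => by positivity
  choose θ hθ h1 h2 using fun n : ℕ => aux_theta q hq (1 / ((n : ℝ) + 1)) (hδ n)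
  have hlim : Tendsto (fun n : ℕ => (1 : ℝ) / (n + 1)) atTop (𝓝 0) :=
    tendsto_one_div_add_atTop_nhds_zero_nat
  have hzX : ∀ z : A, ‖z * X‖ = ‖z * q‖ := by
    intro z
    have : (z * X) * star (z * X) = (z * q) * star (z * q) := by
      simp only [star_mul, hq]
      calc z * X * (star X * star z) = z * (X * star X) * star z := by simp only [mul_assoc]
        _ = _ := by rw [hX]; simp only [mul_assoc]
    have h3 := congrArg norm this
    rw [CStarRing.norm_self_mul_star, CStarRing.norm_self_mul_star] at h3
    exact (mul_self_inj (norm_nonneg _) (norm_nonneg _)).1 h3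
  have hTq : Tendsto (fun n => q * (θ n * q)) atTop (𝓝 q) := by
    rw [tendsto_iff_norm_sub_tendsto_zero]
    refine squeeze_zero (fun _ => norm_nonneg _) (fun n => ?_) hlim
    rw [norm_sub_rev]; exact h2 n
  have hTp : Tendsto (fun n => p * (θ n * q)) atTop (𝓝 p) := by
    rw [tendsto_iff_norm_sub_tendsto_zero]
    refine squeeze_zero (fun _ => norm_nonneg _) (fun n => ?_) hlim
    rw [norm_sub_rev]; exact (aux_le' p q hp hq h _).trans (h2 n)
  have hC : CauchySeq (fun n => p * θ n * X) := by
    have hC' := hTq.cauchySeq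
    rw [Metric.cauchySeq_iff] at hC' ⊢
    intro ε hε
    obtain ⟨N, hN⟩ := hC' ε hε
    refine ⟨N, fun m hm n hn => lt_of_le_of_lt ?_ (hN m hm n hn)⟩
    rw [dist_eq_norm, dist_eq_norm, ← sub_mul, hzX, ← mul_sub, mul_assoc, ← mul_sub, ← sub_mul]
    exact aux_le p q hp hq h _
  obtain ⟨y, hy⟩ := cauchySeq_tendsto_of_complete hC
  refine ⟨fun n => p * θ n, y, fun n => (aux_le p q hp hq h _).trans (h1 n), hy, ?_⟩
  have l1 : Tendsto (fun n => (p * θ n * X) * star (p * θ n * X)) atTop (𝓝 (y * star y)) :=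
    hy.mul ((continuous_star.tendsto y).comp hy)
  have l2 : Tendsto (fun n => (p * (θ n * q)) * star (p * (θ n * q))) atTop (𝓝 (p * star p)) :=
    hTp.mul ((continuous_star.tendsto p).comp hTp)
  have : (fun n => (p * θ n * X) * star (p * θ n * X))
      = (fun n => (p * (θ n * q)) * star (p * (θ n * q))) := by
    funext n
    calc (p * θ n * X) * star (p * θ n * X) = p * θ n * (X * star X) * star (p * θ n) := by
          simp only [star_mul, mul_assoc]
      _ = _ := by rw [hX]; simp only [star_mul, mul_assoc, hq]
  rw [this] at l1
  rw [tendsto_nhds_unique l1 l2, hp]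

theorem aux_e {A : Type*} [NonUnitalCStarAlgebra A]
    (a : A) (ha : IsSelfAdjoint a) (ε ε₀ : ℝ) (hε : 0 < ε) (h : ε₀ < ε) (h0 : 0 ≤ ε₀) :
    ∃ e : A, star e = e ∧ ‖e‖ ≤ 1 ∧ e * a * e - ε₀ • (e * e) = cutDown a ε := by
  set f : ℝ → ℝ := fun t => √(max (t - ε) 0 / max (t - ε₀) (ε - ε₀)) with hf
  have hpos : ∀ t : ℝ, 0 < max (t - ε₀) (ε - ε₀) := fun t => lt_max_of_lt_right (by linarith)
  have hc : Continuous f :=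
    (Continuous.div (by fun_prop) (by fun_prop) fun t => (hpos t).ne').sqrt
  have hf0 : f 0 = 0 := by
    simp [hf, max_eq_right (by linarith : -ε ≤ 0)]
  have hff : ∀ t, f t * f t = max (t - ε) 0 / max (t - ε₀) (ε - ε₀) := fun t =>
    Real.mul_self_sqrt (div_nonneg (le_max_right _ _) (hpos t).le)
  refine ⟨cfcₙ f a, (IsSelfAdjoint.cfcₙ).star_eq, ?_, ?_⟩
  · refine norm_cfcₙ_le fun t _ => ?_
    rw [Real.norm_of_nonneg (Real.sqrt_nonneg _)]
    rw [Real.sqrt_le_iff, one_pow, div_le_one (hpos t)]; refine ⟨zero_le_one, ?_⟩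
    exact max_le_max (by linarith) (by linarith)
  · have e1 : cfcₙ f a * a * cfcₙ f a = cfcₙ (fun t => f t * t * f t) a := by
      rw [cfcₙ_mul (fun t => f t * t) f a (by fun_prop) (by simp) (by fun_prop) hf0,
        cfcₙ_mul f (fun t => t) a (by fun_prop) hf0 (by fun_prop) (by simp), cfcₙ_id' ℝ a ha]
    have e2 : ε₀ • (cfcₙ f a * cfcₙ f a) = cfcₙ (fun t => ε₀ * (f t * f t)) a := by
      rw [cfcₙ_const_mul ε₀ (fun t => f t * f t) a (by fun_prop) (by simp [hf0]),
        cfcₙ_mul f f a (by fun_prop) hf0 (by fun_prop) hf0]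
    rw [e1, e2, ← cfcₙ_sub (fun t => f t * t * f t) (fun t => ε₀ * (f t * f t)) a
      (by fun_prop) (by simp) (by fun_prop) (by simp [hf0]), cutDown]
    refine cfcₙ_congr fun t _ => ?_
    have : f t * t * f t - ε₀ * (f t * f t) = (f t * f t) * (t - ε₀) := by ring
    refine this.trans ?_
    rw [hff]
    show _ = max (t - ε) 0
    rcases le_total t ε with ht | ht
    · rw [max_eq_right (by linarith : t - ε ≤ 0)]; simp
    · rw [max_eq_left (by linarith : ε - ε₀ ≤ t - ε₀)]
      exact div_mul_cancel₀ _ (by linarith : (0:ℝ) < t - ε₀).ne'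

theorem aux_g {A : Type*} [NonUnitalCStarAlgebra A] [PartialOrder A] [StarOrderedRing A]
    (b : A) (hb : 0 ≤ b) (η : ℝ) (hη : 0 < η) :
    ∃ g k : A, star g = g ∧ star k = k ∧ ‖b - g * g‖ ≤ η ∧ ‖g * k‖ ≤ 1 ∧
      g * k * b * k * g = g * g := by
  have hbs : IsSelfAdjoint b := IsSelfAdjoint.of_nonneg hb
  have hsp := quasispectrum_nonneg_of_nonneg (𝕜 := ℝ) b hb
  set G : ℝ → ℝ := fun t => √(max (t - η) 0) with hG
  set k : ℝ → ℝ := fun t => min t η / (η * √(max t η)) with hk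
  have hpos : ∀ t : ℝ, 0 < max t η := fun t => lt_max_of_lt_right hη
  have hGc : Continuous G := by fun_prop
  have hkc : Continuous k := Continuous.div (by fun_prop) (by fun_prop) fun t =>
    (mul_pos hη (Real.sqrt_pos.2 (hpos t))).ne'
  have hG0 : G 0 = 0 := by simp [hG, hη.le]
  have hk0 : k 0 = 0 := by simp [hk, hη.le]
  have hGG : ∀ t, G t * G t = max (t - η) 0 := fun t => Real.mul_self_sqrt (le_max_right _ _)
  have hGle : ∀ t, t ≤ η → G t = 0 := fun t ht => by
    simp only [hG]; rw [max_eq_right (by linarith)]; simp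
  have hkge : ∀ t, η ≤ t → k t = 1 / √t := fun t ht => by
    simp only [hk]; rw [max_eq_left ht, min_eq_right ht]; field_simp
  have e1 : cfcₙ G b * cfcₙ k b = cfcₙ (fun t => G t * k t) b :=
    (cfcₙ_mul G k b (by fun_prop) hG0 (by fun_prop) hk0).symm
  have e2 : cfcₙ G b * cfcₙ G b = cfcₙ (fun t => G t * G t) b :=
    (cfcₙ_mul G G b (by fun_prop) hG0 (by fun_prop) hG0).symm
  refine ⟨cfcₙ G b, cfcₙ k b, (IsSelfAdjoint.cfcₙ).star_eq, (IsSelfAdjoint.cfcₙ).star_eq, ?_, ?_, ?_⟩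
  · have : b - cfcₙ G b * cfcₙ G b = cfcₙ (fun t => t - G t * G t) b := by
      rw [cfcₙ_sub (fun t => t) (fun t => G t * G t) b (by fun_prop) (by simp) (by fun_prop)
        (by simp [hG0]), cfcₙ_id' ℝ b hbs, e2]
    rw [this]
    refine norm_cfcₙ_le fun t ht => ?_
    have := hsp t ht
    rw [hGG, Real.norm_eq_abs, abs_le]
    rcases le_total t η with h | h
    · rw [max_eq_right (by linarith)]; constructor <;> linarith
    · rw [max_eq_left (by linarith)]; constructor <;> linarith
  · rw [e1]
    refine norm_cfcₙ_le fun t ht => ?_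
    rcases le_total t η with h | h
    · simp [hGle t h]
    · rw [hkge t h, mul_one_div, Real.norm_of_nonneg (by positivity),
        div_le_one (Real.sqrt_pos.2 (by linarith))]
      exact Real.sqrt_le_sqrt (max_le (by linarith) (by linarith))
  · have : cfcₙ G b * cfcₙ k b * b * cfcₙ k b * cfcₙ G b
        = cfcₙ (fun t => G t * k t * t * k t * G t) b := by
      rw [cfcₙ_mul (fun t => G t * k t * t * k t) G b (by fun_prop) (by simp) (by fun_prop) hG0,
        cfcₙ_mul (fun t => G t * k t * t) k b (by fun_prop) (by simp) (by fun_prop) hk0,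
        cfcₙ_mul (fun t => G t * k t) (fun t => t) b (by fun_prop) (by simp [hG0]) (by fun_prop)
          (by simp), cfcₙ_id' ℝ b hbs, e1]
    rw [this, e2]
    refine cfcₙ_congr fun t _ => ?_
    rcases le_total t η with h | h
    · simp [hGle t h]
    · have h0 : 0 < t := by linarith
      have h1 : 0 < √t := Real.sqrt_pos.2 h0
      have h2 : √t * √t = t := Real.mul_self_sqrt h0.le
      have h3 : k t * t * k t = 1 := by
        rw [hkge t h]; nth_rewrite 2 [← h2]; field_simp
      calc G t * k t * t * k t * G t = G t * (k t * t * k t) * G t := by ring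
        _ = _ := by rw [h3, mul_one]

open Filter Topology in
/-- If `‖a - b‖ < ε` for positive `a, b`, then there is a contraction `r` with
`r * b * star r = (a - ε)₊`; in particular `(a - ε)₊ ≾ b`. -/
theorem cutDown_cuntzLE_of_norm_sub_lt {A : Type*} [NonUnitalCStarAlgebra A] [PartialOrder A]
    [StarOrderedRing A] (ε : ℝ) (hε : 0 < ε) (a b : A) (ha : 0 ≤ a) (hb : 0 ≤ b)
    (h : ‖a - b‖ < ε) :
    (∃ r : A, ‖r‖ ≤ 1 ∧ r * b * star r = cutDown a ε) ∧ CuntzLE (cutDown a ε) b := by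
  suffices hr : ∃ r : A, ‖r‖ ≤ 1 ∧ r * b * star r = cutDown a ε by
    refine ⟨hr, ?_⟩
    obtain ⟨r, -, hr⟩ := hr
    intro δ hδ
    exact ⟨r, by simpa [hr] using hδ⟩
  have has : IsSelfAdjoint a := IsSelfAdjoint.of_nonneg ha
  obtain ⟨g, k, hg, hk, hbg, hgk, hgkb⟩ := aux_g b hb ((ε - ‖a - b‖) / 2) (by linarith)
  have hlt : ‖a - g * g‖ < ε := by
    have : a - g * g = (a - b) + (b - g * g) := by abel
    rw [this]
    exact (norm_add_le _ _).trans_lt (by linarith)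
  obtain ⟨e, he, hen, hea⟩ := aux_e a has ε ‖a - g * g‖ hε hlt (norm_nonneg _)
  have hsa : IsSelfAdjoint (a - g * g) := has.sub (by simp [IsSelfAdjoint, hg])
  have hle : cutDown a ε ≤ e * g * star (e * g) := by
    have h1 := CStarAlgebra.star_left_conjugate_le_norm_smul (a := e) hsa
    rw [he] at h1
    rw [← hea, sub_le_iff_le_add, ← sub_le_iff_le_add']
    refine le_trans (le_of_eq ?_) h1
    simp only [star_mul, he, hg, mul_sub, sub_mul, mul_assoc]
  have hc0 : 0 ≤ cutDown a ε := cfcₙ_nonneg fun t _ => le_max_right _ _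
  have hd0 : 0 ≤ e * g * star (e * g) := mul_star_self_nonneg _
  have hpp := CFC.sqrt_mul_sqrt_self (cutDown a ε) hc0
  have hqq := CFC.sqrt_mul_sqrt_self (e * g * star (e * g)) hd0
  obtain ⟨T, y, hT, hy, hyy⟩ := aux_main (CFC.sqrt (cutDown a ε))
    (CFC.sqrt (e * g * star (e * g))) (e * g)
    (IsSelfAdjoint.of_nonneg (CFC.sqrt_nonneg _)) (IsSelfAdjoint.of_nonneg (CFC.sqrt_nonneg _))
    (by rw [hpp, hqq]; exact hle) hqq.symm
  rw [hpp] at hyy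
  have hr : Tendsto (fun n => T n * (e * g) * k) atTop (𝓝 (y * k)) := hy.mul_const k
  refine ⟨y * k, ?_, ?_⟩
  · refine le_of_tendsto hr.norm (Eventually.of_forall fun n => ?_)
    have : T n * (e * g) * k = T n * (e * (g * k)) := by simp only [mul_assoc]
    rw [this]
    refine (norm_mul_le _ _).trans (mul_le_one₀ (hT n) (norm_nonneg _) ?_)
    exact (norm_mul_le _ _).trans (mul_le_one₀ hen (norm_nonneg _) hgk)
  · rw [← hyy]
    have l1 : Tendsto (fun n => T n * (e * g) * k * b * star (T n * (e * g) * k)) atTop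
        (𝓝 (y * k * b * star (y * k))) :=
      (hr.mul_const b).mul ((continuous_star.tendsto _).comp hr)
    have l2 : Tendsto (fun n => T n * (e * g) * star (T n * (e * g))) atTop
        (𝓝 (y * star y)) := hy.mul ((continuous_star.tendsto _).comp hy)
    refine tendsto_nhds_unique l1 (l2.congr fun n => ?_)
    calc T n * (e * g) * star (T n * (e * g)) = T n * e * (g * g) * star e * star (T n) := by
          simp only [star_mul, hg, mul_assoc]
      _ = _ := by rw [← hgkb]; simp only [star_mul, hg, hk, mul_assoc]
end

section
/- Let A be a C*-algebra, let x ∈ A, and let ε > 0. Then ((star x) * x − ε)₊ is Cuntz equivalent to (x * (star x) − ε)₊. -/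
open scoped NonUnitalContinuousFunctionalCalculus ContinuousMapZero in
lemma intertwine_aux {A : Type*} [NonUnitalCStarAlgebra A] (a b y : A)
    (ha : IsSelfAdjoint a) (hb : IsSelfAdjoint b) (h : y * b = a * y) (f : ℝ → ℝ)
    (hf : Continuous f) (hf0 : f 0 = 0) : y * cfcₙ f b = cfcₙ f a * y := by
  have hsa : quasispectrum ℝ a ⊆ quasispectrum ℝ a ∪ quasispectrum ℝ b := Set.subset_union_left
  have hsb : quasispectrum ℝ b ⊆ quasispectrum ℝ a ∪ quasispectrum ℝ b := Set.subset_union_right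
  generalize hs : quasispectrum ℝ a ∪ quasispectrum ℝ b = s at hsa hsb
  have hcs : CompactSpace s := by
    rw [← hs]
    exact isCompact_iff_compactSpace.mp
      ((NonUnitalContinuousFunctionalCalculus.isCompact_quasispectrum a).union
        (NonUnitalContinuousFunctionalCalculus.isCompact_quasispectrum b))
  have h0 : Fact (0 ∈ s) := ⟨hsa (quasispectrum.zero_mem ℝ a)⟩
  have key : ∀ g : ContinuousMapZero s ℝ,
      y * cfcₙHomSuperset hb hsb g = cfcₙHomSuperset ha hsa g * y := by
    intro g
    have hca := cfcₙHomSuperset_continuous ha hsa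
    have hcb := cfcₙHomSuperset_continuous hb hsb
    induction g using ContinuousMapZero.induction_on_of_compact with
    | zero => simp only [map_zero, mul_zero, zero_mul]
    | id => rw [cfcₙHomSuperset_id ha hsa, cfcₙHomSuperset_id hb hsb, h]
    | star_id =>
      rw [map_star, map_star, cfcₙHomSuperset_id ha hsa, cfcₙHomSuperset_id hb hsb,
        ha.star_eq, hb.star_eq, h]
    | add f g hf hg => rw [map_add, map_add, mul_add, add_mul, hf, hg]
    | mul f g hf hg => rw [map_mul, map_mul, ← mul_assoc, hf, mul_assoc, hg, mul_assoc]
    | smul r f hf => rw [map_smul, map_smul, mul_smul_comm, hf, smul_mul_assoc]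
    | frequently f hf =>
      exact hf.mem_of_closed <| isClosed_eq (continuous_const.mul hcb) (hca.mul continuous_const)
  have := key ⟨⟨fun t => f t, by fun_prop⟩, hf0⟩
  rw [cfcₙ_apply f b, cfcₙ_apply f a]
  exact this

lemma cuntzLE_aux {A : Type*} [NonUnitalCStarAlgebra A] (x : A) (ε : ℝ)
    (hε : 0 < ε) : CuntzLE (cutDown (star x * x) ε) (cutDown (x * star x) ε) := by
  intro δ hδ
  have ha : IsSelfAdjoint (star x * x) := IsSelfAdjoint.star_mul_self x
  have hb : IsSelfAdjoint (x * star x) := IsSelfAdjoint.mul_star_self x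
  set f : ℝ → ℝ := fun t => max (t - ε) 0 with hf
  set k : ℝ → ℝ := fun t => min t ε / (ε * Real.sqrt (max t ε)) with hk
  have hfc : Continuous f := by fun_prop
  have hf0 : f 0 = 0 := by simp [hf, hε.le]
  have hkc : Continuous k := by
    refine Continuous.div (by fun_prop) (by fun_prop) fun t => ?_
    have : 0 < max t ε := lt_max_of_lt_right hε
    positivity
  have hk0 : k 0 = 0 := by simp [hk, hε.le]
  have hpt : ∀ t, k t * (f t * (t * k t)) = f t := by
    intro t
    rcases le_or_gt t ε with h | h
    · simp [hf, h]
    · have ht : 0 < t := hε.trans h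
      have hsq : Real.sqrt t * Real.sqrt t = t := Real.mul_self_sqrt ht.le
      have hsp : 0 < Real.sqrt t := Real.sqrt_pos.mpr ht
      have : k t = 1 / Real.sqrt t := by
        simp only [hk, min_eq_right h.le, max_eq_left h.le]
        field_simp
      rw [this]
      calc _ = f t * (t / (Real.sqrt t * Real.sqrt t)) := by field_simp
        _ = f t := by rw [hsq, div_self ht.ne', mul_one]
  have hi := intertwine_aux (star x * x) (x * star x) (star x) ha hb
    (by simp only [mul_assoc]) f hfc hf0
  have hks : star (cfcₙ k (star x * x)) = cfcₙ k (star x * x) :=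
    (cfcₙ_predicate k (star x * x) : IsSelfAdjoint _).star_eq
  refine ⟨cfcₙ k (star x * x) * star x, ?_⟩
  have e : cfcₙ k (star x * x) * star x * cutDown (x * star x) ε
      * star (cfcₙ k (star x * x) * star x) = cutDown (star x * x) ε := by
    unfold cutDown
    rw [star_mul, star_star, hks, mul_assoc (cfcₙ k _), hi]
    have e1 : cfcₙ (fun t => k t * (f t * (t * k t))) (star x * x)
        = cfcₙ k (star x * x) * (cfcₙ f (star x * x) * ((star x * x) * cfcₙ k (star x * x))) := by
      rw [cfcₙ_mul k (fun t => f t * (t * k t)) _ (by fun_prop) hk0 (by fun_prop) (by simp),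
        cfcₙ_mul f (fun t => t * k t) _ (by fun_prop) hf0 (by fun_prop) (by simp),
        cfcₙ_mul (fun t => t) k _ (by fun_prop) rfl (by fun_prop) hk0, cfcₙ_id' ℝ (star x * x)]
    simp only [hpt] at e1
    refine Eq.trans ?_ e1.symm
    simp only [mul_assoc]
  rw [e, sub_self, norm_zero]
  exact hδ

/-- For any `x` in a C*-algebra and `ε > 0`, `(star x * x - ε)₊` is Cuntz equivalent to
`(x * star x - ε)₊`. -/
theorem cutDown_star_mul_cuntzEquiv {A : Type*} [NonUnitalCStarAlgebra A] (x : A) (ε : ℝ)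
    (hε : 0 < ε) :
    CuntzEquiv (cutDown (star x * x) ε) (cutDown (x * star x) ε) := by
  refine ⟨cuntzLE_aux x ε hε, ?_⟩
  have := cuntzLE_aux (star x) ε hε
  rwa [star_star] at this
end

section
/- (Rørdam's lemma) Let A be a C*-algebra and let a, b ∈ A be positive. Then the following are equivalent: (i) a ≾ b; (ii) for every ε > 0, (a − ε)₊ ≾ b; (iii) for every ε > 0 there exists δ > 0 such that (a − ε)₊ ≾ (b − δ)₊; (iv) for every ε > 0 there exist δ > 0 and x ∈ A such that (a − ε)₊ = (star x) * x and x * (star x) ∈ closure {(b − δ)₊ * y * (b − δ)₊ : y ∈ A}; (v) for every ε > 0 there exist δ > 0 and r ∈ A such that (a − ε)₊ = r * (b − δ)₊ * (star r). -/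
set_option linter.unusedSectionVars false

namespace RordamAux

open Filter Topology

variable {A : Type*} [NonUnitalCStarAlgebra A] [PartialOrder A] [StarOrderedRing A]

lemma spec_nonneg {a : A} (ha : 0 ≤ a) {t : ℝ} (ht : t ∈ quasispectrum ℝ a) : 0 ≤ t :=
  quasispectrum_nonneg_of_nonneg a ha t ht

/-- `k(a) g(a) k(a) = f(a)`. -/
lemma conj_cfc {a : A} (ha : 0 ≤ a) (k g f : ℝ → ℝ) (hk : Continuous k) (hg : Continuous g)
    (hk0 : k 0 = 0) (hg0 : g 0 = 0)
    (h : ∀ t, 0 ≤ t → k t * g t * k t = f t) :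
    cfcₙ k a * cfcₙ g a * cfcₙ k a = cfcₙ f a := by
  have hsa : IsSelfAdjoint a := .of_nonneg ha
  rw [← cfcₙ_mul k g a hk.continuousOn hk0 hg.continuousOn hg0,
    ← cfcₙ_mul (fun t => k t * g t) k a (by fun_prop) (by simp [hk0]) hk.continuousOn hk0]
  exact cfcₙ_congr fun t ht => h t (spec_nonneg ha ht)

lemma star_cfc (k : ℝ → ℝ) (a : A) : star (cfcₙ k a) = cfcₙ k a :=
  (IsSelfAdjoint.cfcₙ (f := k) (a := a)).star_eq

lemma cut_nonneg (a : A) (ε : ℝ) : 0 ≤ cutDown a ε :=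
  cfcₙ_nonneg fun _ _ => le_max_right _ _

lemma norm_sub_cut {a : A} (ha : 0 ≤ a) {ε : ℝ} (hε : 0 < ε) : ‖a - cutDown a ε‖ ≤ ε := by
  have hsa : IsSelfAdjoint a := .of_nonneg ha
  have : a - cutDown a ε = cfcₙ (fun t : ℝ => t - max (t - ε) 0) a := by
    rw [cfcₙ_sub (fun t : ℝ => t) (fun t : ℝ => max (t - ε) 0) a (by fun_prop) rfl
      (by fun_prop) (by simp [hε.le]), cfcₙ_id' ℝ a]
    rfl
  rw [this]
  refine norm_cfcₙ_le fun t ht => ?_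
  have := spec_nonneg ha ht
  rw [Real.norm_eq_abs, abs_le]
  rcases max_cases (t - ε) 0 with h | h <;> constructor <;> linarith

lemma conj_one_sub {h y g : A} (hh : 0 ≤ h) (hhy : h ≤ y) (hg : IsSelfAdjoint g) :
    h - g * h - h * g + g * h * g ≤ y - g * y - y * g + g * y * g := by
  have hy : 0 ≤ y := hh.trans hhy
  have hsh : IsSelfAdjoint h := .of_nonneg hh
  have hsy : IsSelfAdjoint y := .of_nonneg hy
  have key : ∀ z : A, IsSelfAdjoint z → IsSelfAdjoint (z - g * z - z * g + g * z * g) := by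
    intro z hz
    rw [IsSelfAdjoint]
    simp only [star_add, star_sub, star_mul, hz.star_eq, hg.star_eq, mul_assoc]
    abel
  have e : ∀ z : A, ((z - g * z - z * g + g * z * g : A) : Unitization ℂ A) =
      star (1 - (g : Unitization ℂ A)) * z * (1 - (g : Unitization ℂ A)) := by
    intro z
    simp only [Unitization.inr_add, Unitization.inr_sub, Unitization.inr_mul, star_sub, star_one,
      ← Unitization.inr_star, hg.star_eq]
    noncomm_ring
  rw [← Unitization.inr_le_iff _ _ (key h hsh) (key y hsy), e, e]
  exact star_left_conjugate_le_conjugate ((Unitization.inr_le_iff _ _ hsh hsy).2 hhy) _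

/-- `‖q φ(y)‖² ≤ ‖φ(y) y φ(y)‖` if `q² ≤ y`. -/
lemma norm_mul_le {q y p : A} (hq : IsSelfAdjoint q) (hqy : q * q ≤ y) (hp : IsSelfAdjoint p)
    {c : ℝ} (hc : 0 ≤ c) (hb : ‖p * y * p‖ ≤ c ^ 2) : ‖q * p‖ ≤ c := by
  have h0 : 0 ≤ q * q := by simpa [hq.star_eq] using star_mul_self_nonneg q
  have h1 : 0 ≤ p * (q * q) * p := hp.conjugate_nonneg h0
  have h2 : ‖p * (q * q) * p‖ ≤ ‖p * y * p‖ :=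
    CStarAlgebra.norm_le_norm_of_nonneg_of_le h1 (hp.conjugate_le_conjugate hqy)
  have h3 : star (q * p) * (q * p) = p * (q * q) * p := by
    rw [star_mul, hq.star_eq, hp.star_eq]; simp only [mul_assoc]
  have h4 := CStarRing.norm_star_mul_self (x := q * p)
  rw [h3] at h4
  exact abs_le_of_sq_le_sq' (by nlinarith) hc |>.2

lemma norm_sub_mul_le {q y p : A} (hq : IsSelfAdjoint q) (hqy : q * q ≤ y) (hp : IsSelfAdjoint p)
    {c : ℝ} (hc : 0 ≤ c) (hb : ‖y - p * y - y * p + p * y * p‖ ≤ c ^ 2) : ‖q - q * p‖ ≤ c := by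
  have h0 : 0 ≤ q * q := by simpa [hq.star_eq] using star_mul_self_nonneg q
  have h3 : star (q - q * p) * (q - q * p) =
      q * q - p * (q * q) - q * q * p + p * (q * q) * p := by
    rw [star_sub, star_mul, hq.star_eq, hp.star_eq]; noncomm_ring
  have h1 : 0 ≤ q * q - p * (q * q) - q * q * p + p * (q * q) * p :=
    h3 ▸ star_mul_self_nonneg _
  have h2 := CStarAlgebra.norm_le_norm_of_nonneg_of_le h1 (conj_one_sub h0 hqy hp)
  have h4 := CStarRing.norm_star_mul_self (x := q - q * p)
  rw [h3] at h4
  exact abs_le_of_sq_le_sq' (by nlinarith) hc |>.2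

/-- the function `√t / (|t| + e²)`. -/
noncomputable def F (e t : ℝ) : ℝ := √t / (|t| + e ^ 2)

lemma F_cont {e : ℝ} (he : 0 < e) : Continuous (F e) := by
  unfold F
  refine Continuous.div (by fun_prop) (by fun_prop) fun t => ?_
  positivity

lemma F_zero (e : ℝ) : F e 0 = 0 := by simp [F]

lemma F_bound {e t : ℝ} (he : 0 < e) (ht : 0 ≤ t) : |√t - F e t * t| ≤ e := by
  obtain ⟨s, hs, rfl⟩ : ∃ s, 0 ≤ s ∧ t = s ^ 2 := ⟨√t, Real.sqrt_nonneg t, (Real.sq_sqrt ht).symm⟩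
  have hp : 0 < s ^ 2 + e ^ 2 := by positivity
  have : s - s / (s ^ 2 + e ^ 2) * s ^ 2 = s * e ^ 2 / (s ^ 2 + e ^ 2) := by
    field_simp; ring
  rw [F, Real.sqrt_sq hs, abs_of_nonneg (sq_nonneg s), this, abs_of_nonneg (by positivity),
    div_le_iff₀ hp]
  nlinarith [sq_nonneg (s - e), mul_nonneg he.le (sq_nonneg (s - e)), mul_nonneg he.le hs,
    pow_pos he 3]

lemma F_bound' {e t : ℝ} (he : 0 < e) (ht : 0 ≤ t) :
    |t - F e t * √t * t - t * (F e t * √t) + F e t * √t * t * (F e t * √t)| ≤ e ^ 2 := by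
  have h := F_bound he ht
  have : t - F e t * √t * t - t * (F e t * √t) + F e t * √t * t * (F e t * √t) =
      (√t - F e t * t) ^ 2 := by
    have := Real.mul_self_sqrt ht
    linear_combination (-1 + (F e t) ^ 2 * t) * this
  rw [this, abs_pow]
  gcongr

/-- If `h ≤ x* x` then `h = d d*` where `d` is a limit of elements of `A x*`. -/
lemma factor {h x : A} (hh : 0 ≤ h) (hx : h ≤ star x * x) :
    ∃ d : A, d * star d = h ∧ ∀ G : A, star x * G = star x → d * G = d := by
  set y := star x * x with hy
  have hy0 : 0 ≤ y := star_mul_self_nonneg x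
  have hysa : IsSelfAdjoint y := .of_nonneg hy0
  set q : A := cfcₙ (fun t : ℝ => √t) h with hq
  have hqsa : IsSelfAdjoint q := IsSelfAdjoint.cfcₙ
  have hqq : q * q = h := by
    have hsa : IsSelfAdjoint h := .of_nonneg hh
    rw [hq, ← cfcₙ_mul (fun t : ℝ => √t) (fun t : ℝ => √t) h (by fun_prop) (by simp)
      (by fun_prop) (by simp)]
    conv_rhs => rw [← cfcₙ_id' ℝ h]
    exact cfcₙ_congr fun t ht => Real.mul_self_sqrt (spec_nonneg hh ht)
  have hqy : q * q ≤ y := hqq ▸ hx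
  let e : ℕ → ℝ := fun n => 1 / ((n : ℝ) + 1)
  have he : ∀ n, 0 < e n := fun n => by positivity
  have he0 : Tendsto e atTop (𝓝 0) := tendsto_one_div_add_atTop_nhds_zero_nat
  have hmono : ∀ {m n}, m ≤ n → e n ≤ e m := fun {m n} hmn => by
    simp only [e]; gcongr
  have hidy : cfcₙ (fun t : ℝ => t) y = y := cfcₙ_id' ℝ y
  -- the sequence
  let D : ℕ → A := fun n => q * cfcₙ (F (e n)) y * star x
  have hD : ∀ m n, ‖D m - D n‖ ≤ e m + e n := by
    intro m n
    have hFm := F_cont (he m)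
    have hFn := F_cont (he n)
    let φ : ℝ → ℝ := fun t => F (e m) t - F (e n) t
    have hφ : Continuous φ := hFm.sub hFn
    have hφ0 : φ 0 = 0 := by simp [φ, F_zero]
    have h1 : D m - D n = q * cfcₙ φ y * star x := by
      simp only [D, φ]
      rw [cfcₙ_sub (F (e m)) (F (e n)) y hFm.continuousOn (F_zero _) hFn.continuousOn (F_zero _)]
      noncomm_ring
    let ψ : ℝ → ℝ := fun t => φ t * √t
    have hψ : Continuous ψ := by fun_prop
    have hψ0 : ψ 0 = 0 := by simp [ψ]
    have h2 : (D m - D n) * star (D m - D n) = (q * cfcₙ ψ y) * star (q * cfcₙ ψ y) := by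
      have h3 : cfcₙ φ y * y * cfcₙ φ y = cfcₙ (fun t => ψ t * ψ t) y := by
        conv_lhs => enter [1, 2]; rw [← hidy]
        exact conj_cfc hy0 φ (fun t => t) _ hφ continuous_id hφ0 rfl fun t ht => by
          simp only [ψ]; linear_combination (- φ t * φ t) * Real.mul_self_sqrt ht
      rw [cfcₙ_mul ψ ψ y hψ.continuousOn hψ0 hψ.continuousOn hψ0] at h3
      rw [h1]
      simp only [star_mul, star_star, star_cfc, hqsa.star_eq]
      calc q * cfcₙ φ y * star x * (x * (cfcₙ φ y * q))
          = q * (cfcₙ φ y * y * cfcₙ φ y) * q := by rw [hy]; simp only [mul_assoc]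
        _ = _ := by rw [h3]; simp only [mul_assoc]
    have h5 : ‖q * cfcₙ ψ y‖ ≤ e m + e n := by
      refine norm_mul_le hqsa hqy IsSelfAdjoint.cfcₙ (add_nonneg (he m).le (he n).le) ?_
      conv_lhs => enter [1, 1, 2]; rw [← hidy]
      rw [conj_cfc hy0 ψ (fun t => t) (fun t => ψ t * t * ψ t) hψ continuous_id hψ0 rfl
        fun t ht => rfl]
      refine norm_cfcₙ_le fun t ht => ?_
      have ht := spec_nonneg hy0 ht
      have : ψ t * t * ψ t = ((√t - F (e n) t * t) - (√t - F (e m) t * t)) ^ 2 := by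
        simp only [ψ, φ]
        linear_combination ((F (e m) t - F (e n) t) ^ 2 * t) * Real.mul_self_sqrt ht
      rw [this, norm_pow, Real.norm_eq_abs]
      have a1 := F_bound (he m) ht
      have a2 := F_bound (he n) ht
      gcongr
      refine (abs_sub _ _).trans ?_
      linarith
    have h6 := CStarRing.norm_self_mul_star (x := D m - D n)
    rw [h2, CStarRing.norm_self_mul_star] at h6
    have : ‖D m - D n‖ = ‖q * cfcₙ ψ y‖ := by
      rw [← abs_of_nonneg (norm_nonneg (D m - D n)), ← abs_of_nonneg (norm_nonneg (q * cfcₙ ψ y)),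
        ← sq_eq_sq_iff_abs_eq_abs]
      nlinarith
    rwa [this]
  have hC : CauchySeq D := by
    refine cauchySeq_of_le_tendsto_0 (fun N => 2 * e N) (fun n m N hn hm => ?_)
      (by simpa using he0.const_mul 2)
    rw [dist_eq_norm]
    have := hD n m
    have := hmono hn
    have := hmono hm
    linarith
  obtain ⟨d, hd⟩ := cauchySeq_tendsto_of_complete hC
  refine ⟨d, ?_, fun G hG => ?_⟩
  · have l1 : Tendsto (fun n => D n * star (D n)) atTop (𝓝 (d * star d)) := hd.mul hd.star
    let p : ℕ → A := fun n => cfcₙ (fun t => F (e n) t * √t) y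
    have l2 : Tendsto (fun n => q * p n) atTop (𝓝 q) := by
      rw [tendsto_iff_norm_sub_tendsto_zero]
      refine squeeze_zero (fun _ => norm_nonneg _) (fun n => ?_) he0
      rw [norm_sub_rev]
      have hF := F_cont (he n)
      refine norm_sub_mul_le hqsa hqy IsSelfAdjoint.cfcₙ (he n).le ?_
      let P : ℝ → ℝ := fun t => F (e n) t * √t
      have hP : Continuous P := by fun_prop
      have hP0 : P 0 = 0 := by simp [P]
      have : y - p n * y - y * p n + p n * y * p n =
          cfcₙ (fun t => t - P t * t - t * P t + P t * t * P t) y := by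
        rw [cfcₙ_add (fun t => t - P t * t - t * P t) (fun t => P t * t * P t) y (by fun_prop)
            (by simp) (by fun_prop) (by simp),
          cfcₙ_sub (fun t => t - P t * t) (fun t => t * P t) y (by fun_prop)
            (by simp) (by fun_prop) (by simp),
          cfcₙ_sub (fun t => t) (fun t => P t * t) y (by fun_prop)
            (by simp) (by fun_prop) (by simp),
          cfcₙ_mul (fun t => P t * t) P y (by fun_prop)
            (by simp) (by fun_prop) hP0,
          cfcₙ_mul P (fun t => t) y (by fun_prop) hP0 (by fun_prop) rfl,
          cfcₙ_mul (fun t => t) P y (by fun_prop) rfl (by fun_prop) hP0, hidy]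
      rw [this]
      exact norm_cfcₙ_le fun t ht => F_bound' (he n) (spec_nonneg hy0 ht)
    have l3 : Tendsto (fun n => (q * p n) * star (q * p n)) atTop (𝓝 h) := by
      have := l2.mul l2.star
      rwa [hqsa.star_eq, hqq] at this
    refine tendsto_nhds_unique l1 (l3.congr fun n => ?_)
    have hF := F_cont (he n)
    have h3 : cfcₙ (F (e n)) y * y * cfcₙ (F (e n)) y = p n * p n := by
      simp only [p]
      rw [← cfcₙ_mul (fun t => F (e n) t * √t) (fun t => F (e n) t * √t) y (by fun_prop) (by simp)
        (by fun_prop) (by simp)]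
      conv_lhs => enter [1, 2]; rw [← hidy]
      exact conj_cfc hy0 _ (fun t => t) _ hF continuous_id (F_zero _) rfl fun t ht => by
        linear_combination (- F (e n) t * F (e n) t) * Real.mul_self_sqrt ht
    simp only [D, star_mul, star_star, star_cfc, hqsa.star_eq]
    calc q * p n * (star (p n) * q) = q * (p n * p n) * q := by
          simp only [p, star_cfc, mul_assoc]
      _ = _ := by rw [← h3, hy]; simp only [mul_assoc]
  · refine tendsto_nhds_unique (hd.mul_const G) (hd.congr fun n => ?_)
    simp only [D, mul_assoc, hG]

lemma cut_le (b : A) (hb : 0 ≤ b) {δ : ℝ} (hδ : 0 < δ) :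
    ∃ k : A, cutDown b δ = k * b * star k := by
  have hsa : IsSelfAdjoint b := .of_nonneg hb
  let k : ℝ → ℝ := fun t => √(max (t - δ) 0 / max t δ)
  have hpos : ∀ t, 0 < max t δ := fun t => lt_max_of_lt_right hδ
  have hk : Continuous k :=
    (Continuous.div (by fun_prop) (by fun_prop) fun t => (hpos t).ne').sqrt
  refine ⟨cfcₙ k b, ?_⟩
  rw [star_cfc]
  conv_rhs => enter [1, 2]; rw [← cfcₙ_id' ℝ b]
  refine (conj_cfc hb k (fun t => t) _ hk continuous_id (by simp [k, hδ.le]) rfl fun t ht => ?_).symm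
  have h := Real.mul_self_sqrt (div_nonneg (le_max_right (t - δ) 0) (hpos t).le)
  have : k t * t * k t = (max (t - δ) 0 / max t δ) * t := by
    simp only [k]; linear_combination t * h
  rw [this]
  rcases le_total t δ with h' | h'
  · simp [h']
  · rw [max_eq_left h', div_mul_cancel₀]
    linarith

lemma one_imp_five {a b : A} (ha : 0 ≤ a) (hb : 0 ≤ b) (hab : CuntzLE a b) {ε : ℝ} (hε : 0 < ε) :
    ∃ δ > 0, ∃ r : A, cutDown a ε = r * cutDown b δ * star r := by
  have hsa : IsSelfAdjoint a := .of_nonneg ha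
  have hsb : IsSelfAdjoint b := .of_nonneg hb
  obtain ⟨r, hr⟩ := hab (ε / 2) (by positivity)
  set δ : ℝ := ε / (8 * (‖r‖ ^ 2 + 1)) with hδdef
  have hδ : 0 < δ := by positivity
  set c := cutDown b (2 * δ) with hc
  have hc0 : 0 ≤ c := cut_nonneg _ _
  have hcsa : IsSelfAdjoint c := .of_nonneg hc0
  set ε₁ : ℝ := 3 * ε / 4 with hε₁
  have hn : ‖a - r * c * star r‖ ≤ ε₁ := by
    have h1 : a - r * c * star r = -(r * b * star r - a) + r * (b - c) * star r := by noncomm_ring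
    have h2 : ‖r * (b - c) * star r‖ ≤ ε / 4 := by
      calc ‖r * (b - c) * star r‖ ≤ ‖r‖ * ‖b - c‖ * ‖star r‖ := by
            refine (_root_.norm_mul_le _ _).trans ?_
            gcongr
            exact _root_.norm_mul_le _ _
        _ ≤ ‖r‖ * (2 * δ) * ‖r‖ := by
            rw [norm_star]; gcongr; exact norm_sub_cut hb (by positivity)
        _ = 2 * δ * ‖r‖ ^ 2 := by ring
        _ ≤ 2 * δ * (‖r‖ ^ 2 + 1) := by gcongr; linarith
        _ = ε / 4 := by rw [hδdef]; field_simp; norm_num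
    rw [h1]
    refine (norm_add_le _ _).trans ?_
    rw [norm_neg]
    linarith
  let f : ℝ → ℝ := fun t => √(max (t - ε) 0 / max (t - ε₁) (ε - ε₁))
  have hpos : ∀ t, 0 < max (t - ε₁) (ε - ε₁) := fun t => lt_max_of_lt_right (by linarith)
  have hf : Continuous f :=
    (Continuous.div (by fun_prop) (by fun_prop) fun t => (hpos t).ne').sqrt
  have hf0 : f 0 = 0 := by simp [f, hε.le]
  set e := cfcₙ f a with he
  have hse : star e = e := star_cfc _ _
  have hcut : cutDown a ε = e * a * e - ε₁ • (e * e) := by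
    have : cutDown a ε = cfcₙ (fun t => f t * t * f t - ε₁ • (f t * f t)) a := by
      refine cfcₙ_congr fun t ht => ?_
      have h := Real.mul_self_sqrt (div_nonneg (le_max_right (t - ε) 0) (hpos t).le)
      have : f t * t * f t - ε₁ • (f t * f t) =
          (max (t - ε) 0 / max (t - ε₁) (ε - ε₁)) * (t - ε₁) := by
        simp only [f, smul_eq_mul]; linear_combination (t - ε₁) * h
      rw [this]
      rcases le_total t ε with h' | h'
      · simp [h']
      · rw [max_eq_left (by linarith : ε - ε₁ ≤ t - ε₁), div_mul_cancel₀]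
        linarith
    rw [this, cfcₙ_sub (fun t => f t * t * f t) (fun t => ε₁ • (f t * f t)) a (by fun_prop)
        (by simp) (by fun_prop) (by simp [hf0]),
      cfcₙ_smul ε₁ (fun t => f t * f t) a (by fun_prop) (by simp [hf0]),
      cfcₙ_mul (fun t => f t * t) f a (by fun_prop) (by simp) (by fun_prop) hf0,
      cfcₙ_mul f (fun t => t) a (by fun_prop) hf0 (by fun_prop) rfl,
      cfcₙ_mul f f a (by fun_prop) hf0 (by fun_prop) hf0, cfcₙ_id' ℝ a]
  -- square root of `c`
  let s : ℝ → ℝ := fun t => √(max (t - 2 * δ) 0)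
  have hs : Continuous s := by fun_prop
  have hs0 : s 0 = 0 := by simp [s, hδ.le]
  have hss : cfcₙ s b * cfcₙ s b = c := by
    rw [← cfcₙ_mul s s b (by fun_prop) hs0 (by fun_prop) hs0]
    exact cfcₙ_congr fun t _ => Real.mul_self_sqrt (le_max_right _ _)
  set x : A := cfcₙ s b * star r * e with hx
  have hxx : star x * x = e * (r * c * star r) * e := by
    rw [hx, ← hss]
    simp only [star_mul, star_star, star_cfc, hse, mul_assoc]
  have hle : cutDown a ε ≤ star x * x := by
    have hsa' : IsSelfAdjoint (a - r * c * star r) := by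
      rw [IsSelfAdjoint]
      simp only [star_sub, star_mul, star_star, hsa.star_eq, hcsa.star_eq, mul_assoc]
    have h1 := CStarAlgebra.star_left_conjugate_le_norm_smul (a := e) hsa'
    rw [hse] at h1
    have hee : 0 ≤ e * e := by simpa [hse] using star_mul_self_nonneg e
    have h2 : ‖a - r * c * star r‖ • (e * e) ≤ ε₁ • (e * e) :=
      smul_le_smul_of_nonneg_right hn hee
    have h3 := h1.trans h2
    rw [hxx, hcut, sub_le_iff_le_add, ← sub_le_iff_le_add']
    convert h3 using 1
    noncomm_ring
  obtain ⟨d, hd, hdG⟩ := factor (cut_nonneg a ε) hle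
  -- the function `k`
  let k : ℝ → ℝ := fun t => √((min (max t 0) (2 * δ) / (2 * δ)) / max (t - δ) δ)
  have hpos' : ∀ t, 0 < max (t - δ) δ := fun t => lt_max_of_lt_right hδ
  have hk : Continuous k :=
    (Continuous.div (by fun_prop) (by fun_prop) fun t => (hpos' t).ne').sqrt
  have hk0 : k 0 = 0 := by simp [k, hδ.le]
  have hcd0 : max ((0 : ℝ) - δ) 0 = 0 := by simp [hδ.le]
  set G := cfcₙ k b * cutDown b δ * cfcₙ k b with hG
  have hsG : cfcₙ s b * G = cfcₙ s b := by
    rw [hG, cutDown, conj_cfc hb k (fun t => max (t - δ) 0) (fun t => k t * max (t - δ) 0 * k t)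
      hk (by fun_prop) hk0 hcd0 fun _ _ => rfl,
      ← cfcₙ_mul s (fun t => k t * max (t - δ) 0 * k t) b (by fun_prop) hs0 (by fun_prop)
        (by simp [hk0])]
    refine cfcₙ_congr fun t ht => ?_
    have ht := spec_nonneg hb ht
    rcases le_total t (2 * δ) with h' | h'
    · simp [s, h']
    · have e1 : k t = √(1 / (t - δ)) := by
        simp only [k]
        rw [max_eq_left ht, min_eq_right h', div_self (by positivity), max_eq_left (by linarith)]
      have h0 : 0 < t - δ := by linarith
      have e2 : k t * max (t - δ) 0 * k t = 1 := by
        rw [max_eq_left h0.le, e1, mul_right_comm, Real.mul_self_sqrt (by positivity)]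
        field_simp
      simp only [e2, mul_one]
  have hGsa : star G = G := by
    rw [hG]
    simp only [star_mul, star_cfc, cutDown, mul_assoc]
  have hxG : star x * G = star x := by
    rw [hx]
    simp only [star_mul, star_star, star_cfc, hse, mul_assoc, hsG]
  refine ⟨δ, hδ, d * cfcₙ k b, ?_⟩
  have h1 : d * star d = d * G * star d := by rw [hdG G hxG]
  rw [← hd, h1, hG, star_mul, star_cfc]
  simp only [mul_assoc]

lemma cuntz_trans {a b c : A} (hab : CuntzLE a b) (hbc : CuntzLE b c) : CuntzLE a c := by
  intro ε hε
  obtain ⟨r, hr⟩ := hab (ε / 2) (by positivity)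
  obtain ⟨s, hs⟩ := hbc (ε / (2 * (‖r‖ ^ 2 + 1))) (by positivity)
  refine ⟨r * s, ?_⟩
  have h1 : r * s * c * star (r * s) - a =
      r * (s * c * star s - b) * star r + (r * b * star r - a) := by
    rw [star_mul]; noncomm_ring
  have h2 : ‖r * (s * c * star s - b) * star r‖ ≤ ε / 2 := by
    calc ‖r * (s * c * star s - b) * star r‖ ≤ ‖r‖ * ‖s * c * star s - b‖ * ‖star r‖ := by
          refine (_root_.norm_mul_le _ _).trans ?_
          gcongr
          exact _root_.norm_mul_le _ _
      _ ≤ ‖r‖ * (ε / (2 * (‖r‖ ^ 2 + 1))) * ‖r‖ := by rw [norm_star]; gcongr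
      _ = ε / (2 * (‖r‖ ^ 2 + 1)) * ‖r‖ ^ 2 := by ring
      _ ≤ ε / (2 * (‖r‖ ^ 2 + 1)) * (‖r‖ ^ 2 + 1) := by gcongr; linarith
      _ = ε / 2 := by field_simp
  rw [h1]
  refine (norm_add_le _ _).trans_lt ?_
  linarith

lemma cuntz_of_eq {a b r : A} (h : a = r * b * star r) : CuntzLE a b := fun ε hε =>
  ⟨r, by rw [← h, sub_self, norm_zero]; exact hε⟩

lemma cuntz_cut {b : A} (hb : 0 ≤ b) {δ : ℝ} (hδ : 0 < δ) : CuntzLE (cutDown b δ) b := by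
  obtain ⟨k, hk⟩ := cut_le b hb hδ
  exact cuntz_of_eq hk

lemma two_imp_one {a b : A} (ha : 0 ≤ a) (h : ∀ ε > 0, CuntzLE (cutDown a ε) b) :
    CuntzLE a b := by
  intro ε hε
  obtain ⟨r, hr⟩ := h (ε / 2) (by positivity) (ε / 2) (by positivity)
  refine ⟨r, ?_⟩
  have h1 := norm_sub_cut ha (show 0 < ε / 2 by positivity)
  have h2 : r * b * star r - a =
      (r * b * star r - cutDown a (ε / 2)) - (a - cutDown a (ε / 2)) := by abel
  rw [h2]
  refine (norm_sub_le _ _).trans_lt ?_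
  linarith

/-- `(a - 2ε)₊ ≾ (a - ε)₊³`. -/
lemma cut_cube {a : A} (ha : 0 ≤ a) {ε : ℝ} (hε : 0 < ε) :
    CuntzLE (cutDown a (2 * ε)) (cutDown a ε * (cutDown a ε * cutDown a ε)) := by
  have hsa : IsSelfAdjoint a := .of_nonneg ha
  let m : ℝ → ℝ := fun t => max (t - ε) 0
  have hm : Continuous m := by fun_prop
  have hm0 : m 0 = 0 := by simp [m, hε.le]
  let k : ℝ → ℝ := fun t => √(max (t - 2 * ε) 0 / max (t - ε) ε ^ 3)
  have hpos : ∀ t, 0 < max (t - ε) ε := fun t => lt_max_of_lt_right hε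
  have hk : Continuous k :=
    (Continuous.div (by fun_prop) (by fun_prop) fun t => (pow_pos (hpos t) 3).ne').sqrt
  have hk0 : k 0 = 0 := by simp [k, hε.le]
  refine cuntz_of_eq (r := cfcₙ k a) ?_
  have h1 : cutDown a ε * (cutDown a ε * cutDown a ε) = cfcₙ (fun t => m t * (m t * m t)) a := by
    rw [cfcₙ_mul m (fun t => m t * m t) a (by fun_prop) hm0 (by fun_prop) (by simp [hm0]),
      cfcₙ_mul m m a (by fun_prop) hm0 (by fun_prop) hm0]
    rfl
  rw [star_cfc, h1]
  refine (conj_cfc ha k _ _ hk (by fun_prop) hk0 (by simp [hm0]) fun t ht => ?_).symm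
  have h := Real.mul_self_sqrt (div_nonneg (le_max_right (t - 2 * ε) 0) (pow_pos (hpos t) 3).le)
  have : k t * (m t * (m t * m t)) * k t =
      max (t - 2 * ε) 0 / max (t - ε) ε ^ 3 * m t ^ 3 := by
    simp only [k]; linear_combination (m t ^ 3) * h
  rw [this]
  rcases le_total t (2 * ε) with h' | h'
  · simp [h']
  · have h3 : 0 < t - ε := by linarith
    simp only [m]
    rw [max_eq_left (by linarith : ε ≤ t - ε), max_eq_left h3.le, div_mul_cancel₀]
    positivity

lemma herm {x c : A} (hc : 0 ≤ c)
    (hx : x * star x ∈ closure {y : A | ∃ z : A, y = c * z * c}) :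
    CuntzLE (star x * x * (star x * x * (star x * x))) c := by
  have hsc : IsSelfAdjoint c := .of_nonneg hc
  obtain ⟨w, hw, hwt⟩ := mem_closure_iff_seq_limit.1 hx
  intro ε hε
  have l : Tendsto (fun n => star x * (w n * star (w n)) * x) atTop
      (𝓝 (star x * (x * star x * star (x * star x)) * x)) :=
    ((hwt.mul hwt.star).const_mul _).mul_const _
  obtain ⟨n, hn⟩ := ((tendsto_iff_norm_sub_tendsto_zero.1 l).eventually (gt_mem_nhds hε)).exists
  obtain ⟨z, hz⟩ := hw n
  let q : A := cfcₙ (fun t : ℝ => √t) c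
  have hqs : star q = q := star_cfc _ _
  have hqq : q * q = c := by
    simp only [q]
    rw [← cfcₙ_mul (fun t : ℝ => √t) (fun t : ℝ => √t) c (by fun_prop) (by simp)
      (by fun_prop) (by simp)]
    conv_rhs => rw [← cfcₙ_id' ℝ c]
    exact cfcₙ_congr fun t ht => Real.mul_self_sqrt (spec_nonneg hc ht)
  refine ⟨star x * c * z * q, ?_⟩
  have e1 : star x * c * z * q * c * star (star x * c * z * q) =
      star x * (w n * star (w n)) * x := by
    have e3 : q * (c * q) = c * c := by rw [← hqq]; simp only [mul_assoc]
    rw [hz]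
    simp only [star_mul, star_star, hqs, hsc.star_eq]
    calc _ = star x * c * z * (q * (c * q)) * star z * c * x := by simp only [mul_assoc]
      _ = _ := by rw [e3]; simp only [mul_assoc]
  have e2 : star x * x * (star x * x * (star x * x)) =
      star x * (x * star x * star (x * star x)) * x := by
    simp only [star_mul, star_star, mul_assoc]
  rw [e1, e2]
  exact hn

lemma five_imp_four {b h r : A} (hb : 0 ≤ b) {δ : ℝ} (hδ : 0 < δ)
    (hr : h = r * cutDown b (2 * δ) * star r) :
    ∃ x : A, h = star x * x ∧
       x * star x ∈ closure {y : A | ∃ z : A, y = cutDown b δ * z * cutDown b δ} := by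
  have hsb : IsSelfAdjoint b := .of_nonneg hb
  let s : ℝ → ℝ := fun t => √(max (t - 2 * δ) 0)
  have hs : Continuous s := by fun_prop
  have hs0 : s 0 = 0 := by simp [s, hδ.le]
  have hss : cfcₙ s b * cfcₙ s b = cutDown b (2 * δ) := by
    rw [← cfcₙ_mul s s b (by fun_prop) hs0 (by fun_prop) hs0]
    exact cfcₙ_congr fun t _ => Real.mul_self_sqrt (le_max_right _ _)
  let m : ℝ → ℝ := fun t => max (t - δ) 0
  have hm : Continuous m := by fun_prop
  have hm0 : m 0 = 0 := by simp [m, hδ.le]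
  let k : ℝ → ℝ := fun t => s t / max (t - δ) δ
  have hpos : ∀ t, 0 < max (t - δ) δ := fun t => lt_max_of_lt_right hδ
  have hk : Continuous k := Continuous.div (by fun_prop) (by fun_prop) fun t => (hpos t).ne'
  have hk0 : k 0 = 0 := by simp [k, hs0]
  have hmk : ∀ t, m t * k t = s t := by
    intro t
    rcases le_total t (2 * δ) with h' | h'
    · simp [k, s, h']
    · have h3 : 0 < t - δ := by linarith
      simp only [m, k]
      rw [max_eq_left (by linarith : δ ≤ t - δ), max_eq_left h3.le]
      field_simp
  have e1 : cfcₙ s b = cutDown b δ * cfcₙ k b := by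
    rw [show cutDown b δ = cfcₙ m b from rfl, ← cfcₙ_mul m k b (by fun_prop) hm0 (by fun_prop) hk0]
    exact cfcₙ_congr fun t _ => (hmk t).symm
  have e2 : cfcₙ s b = cfcₙ k b * cutDown b δ := by
    rw [show cutDown b δ = cfcₙ m b from rfl, ← cfcₙ_mul k m b (by fun_prop) hk0 (by fun_prop) hm0]
    exact cfcₙ_congr fun t _ => by rw [mul_comm, hmk t]
  refine ⟨cfcₙ s b * star r, ?_, subset_closure ⟨cfcₙ k b * (star r * r) * cfcₙ k b, ?_⟩⟩
  · rw [hr, ← hss]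
    simp only [star_mul, star_star, star_cfc, mul_assoc]
  · calc cfcₙ s b * star r * star (cfcₙ s b * star r)
        = cfcₙ s b * (star r * r) * cfcₙ s b := by
          simp only [star_mul, star_star, star_cfc, mul_assoc]
      _ = (cutDown b δ * cfcₙ k b) * (star r * r) * (cfcₙ k b * cutDown b δ) := by
          rw [← e1, ← e2]
      _ = _ := by simp only [mul_assoc]

end RordamAux

/-- **Rørdam's lemma**: five equivalent characterizations of Cuntz subequivalence. -/
theorem rordam_lemma {A : Type*} [NonUnitalCStarAlgebra A] [PartialOrder A] [StarOrderedRing A]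
    (a b : A) (ha : 0 ≤ a) (hb : 0 ≤ b) :
    [CuntzLE a b,
     ∀ ε > 0, CuntzLE (cutDown a ε) b,
     ∀ ε > 0, ∃ δ > 0, CuntzLE (cutDown a ε) (cutDown b δ),
     ∀ ε > 0, ∃ δ > 0, ∃ x : A, cutDown a ε = star x * x ∧
       x * star x ∈ closure {y : A | ∃ z : A, y = cutDown b δ * z * cutDown b δ},
     ∀ ε > 0, ∃ δ > 0, ∃ r : A, cutDown a ε = r * cutDown b δ * star r].TFAE := by
  tfae_have 1 → 5 := fun h ε hε => RordamAux.one_imp_five ha hb h hε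
  tfae_have 5 → 3 := fun h ε hε => by
    obtain ⟨δ, hδ, r, hr⟩ := h ε hε
    exact ⟨δ, hδ, RordamAux.cuntz_of_eq hr⟩
  tfae_have 3 → 2 := fun h ε hε => by
    obtain ⟨δ, hδ, hr⟩ := h ε hε
    exact RordamAux.cuntz_trans hr (RordamAux.cuntz_cut hb hδ)
  tfae_have 2 → 1 := fun h => RordamAux.two_imp_one ha h
  tfae_have 5 → 4 := fun h ε hε => by
    obtain ⟨δ, hδ, r, hr⟩ := h ε hε
    refine ⟨δ / 2, half_pos hδ, ?_⟩
    exact RordamAux.five_imp_four hb (half_pos hδ)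
      (by rw [mul_div_cancel₀ δ (two_ne_zero' ℝ)]; exact hr)
  tfae_have 4 → 2 := fun h ε hε => by
    obtain ⟨δ, hδ, x, hx, hxm⟩ := h (ε / 2) (half_pos hε)
    have h1 := RordamAux.herm (RordamAux.cut_nonneg b δ) hxm
    have h2 := RordamAux.cut_cube ha (half_pos hε)
    rw [mul_div_cancel₀ ε (two_ne_zero' ℝ), hx] at h2
    exact RordamAux.cuntz_trans h2 (RordamAux.cuntz_trans h1 (RordamAux.cuntz_cut hb hδ))
  tfae_finish
end

section
/- Let A be a C*-algebra and let p, q ∈ A be projections (self-adjoint idempotents). Then p ≾ q if and only if p is Murray–von Neumann subequivalent to q, i.e., there exists v ∈ A with (star v) * v = p and v * (star v) ≤ q. -/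
theorem unital_aux {B : Type*} [CStarAlgebra B] (a P : B) (ha : IsSelfAdjoint a)
    (hP : IsSelfAdjoint P) (hPP : P * P = P) (hPa : P * a = a) (haP : a * P = a)
    (hn : ‖a - P‖ < 1) : ∃ c : B, IsSelfAdjoint c ∧ c * a * c = P := by
  rcases subsingleton_or_nontrivial B with hB | hB
  · exact ⟨0, IsSelfAdjoint.zero B, Subsingleton.elim _ _⟩
  set b : B := a + (1 - P) with hb
  have hbsa : IsSelfAdjoint b := ha.add ((IsSelfAdjoint.one B).sub hP)
  have hpos : ∀ t ∈ spectrum ℝ b, 0 < t := by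
    intro t ht
    have h1 : t - 1 ∈ spectrum ℝ (b - 1) := by
      have := (spectrum.sub_singleton_eq (R := ℝ) b 1)
      rw [map_one] at this
      rw [← this]
      exact Set.sub_mem_sub ht rfl
    have h2 := spectrum.norm_le_norm_of_mem h1
    have h3 : b - 1 = a - P := by rw [hb]; abel
    rw [h3, Real.norm_eq_abs] at h2
    have := (abs_lt.1 (h2.trans_lt hn)).1
    linarith
  have hcont : ContinuousOn (fun t : ℝ => (√t)⁻¹) (spectrum ℝ b) :=
    Real.continuous_sqrt.continuousOn.inv₀ fun t ht => (Real.sqrt_pos.2 (hpos t ht)).ne'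
  set c : B := cfc (fun t : ℝ => (√t)⁻¹) b with hc
  have hcsa : IsSelfAdjoint c := cfc_predicate _ _
  have hcbc : c * b * c = 1 := by
    have hid : b = cfc (fun t : ℝ => t) b := (cfc_id' ℝ b).symm
    calc c * b * c = c * cfc (fun t : ℝ => t) b * c := by rw [← hid]
      _ = 1 := by
        rw [hc, ← cfc_mul _ (fun t : ℝ => t) b hcont continuousOn_id,
          ← cfc_mul (fun t : ℝ => (√t)⁻¹ * t) _ b (hcont.mul continuousOn_id) hcont, ← cfc_one ℝ b]
        refine cfc_congr fun t ht => ?_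
        have h := Real.sqrt_pos.2 (hpos t ht)
        have h' := Real.mul_self_sqrt (hpos t ht).le
        simp only [Pi.one_apply]
        field_simp
        nlinarith
  have hcomm : Commute b P := by
    simp only [Commute, SemiconjBy, hb, add_mul, mul_add, sub_mul, mul_sub, hPa, haP, hPP,
      one_mul, mul_one]
  have hcP : Commute c P := hcomm.cfc_real _
  have hbP : b * P = a := by
    simp only [hb, add_mul, sub_mul, haP, hPP, one_mul, sub_self, add_zero]
  refine ⟨c, hcsa, ?_⟩
  rw [← hbP, ← mul_assoc, mul_assoc (c * b), ← hcP.eq, ← mul_assoc, hcbc, one_mul]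

theorem norm_proj_le {A : Type*} [NonUnitalCStarAlgebra A] (p : A) (hp : star p = p)
    (hp' : p * p = p) : ‖p‖ ≤ 1 := by
  have h := CStarRing.norm_star_mul_self (x := p)
  rw [hp, hp'] at h
  nlinarith [norm_nonneg p]

theorem pi_aux {A : Type*} [NonUnitalCStarAlgebra A] (v p : A) (hp' : p * p = p)
    (hp : star p = p) (hv : star v * v = p) : v * p = v := by
  have : star (v * p - v) * (v * p - v) = 0 := by
    simp only [star_sub, star_mul, sub_mul, mul_sub, hp, ← mul_assoc]
    simp only [mul_assoc _ (star v) v, hv, hp', sub_self]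
  exact sub_eq_zero.1 (CStarRing.star_mul_self_eq_zero_iff _ |>.1 this)

/-- For projections `p, q`, Cuntz subequivalence coincides with Murray–von Neumann
subequivalence. -/
theorem cuntzLE_iff_mvN_of_projections {A : Type*} [NonUnitalCStarAlgebra A] [PartialOrder A]
    [StarOrderedRing A] (p q : A) (hp : star p = p) (hp' : p * p = p) (hq : star q = q)
    (hq' : q * q = q) :
    CuntzLE p q ↔ ∃ v : A, star v * v = p ∧ v * star v ≤ q := by
  have hv_proj : ∀ v : A, star v * v = p → IsStarProjection (v * star v) := by
    intro v hv
    refine ⟨?_, IsSelfAdjoint.mul_star_self v⟩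
    have h := pi_aux v p hp' hp hv
    change v * star v * (v * star v) = v * star v
    rw [← mul_assoc, mul_assoc v, hv, h]
  have hqp : IsStarProjection q := ⟨hq', hq⟩
  constructor
  · intro h
    obtain ⟨r, hr⟩ := h 1 one_pos
    set x : A := q * star r * p with hx
    set a : A := p * (r * q * star r) * p with ha
    have hxx : star x * x = a := by
      simp only [hx, ha, star_mul, star_star, hp, hq, ← mul_assoc]
      rw [mul_assoc (p * r) q q, hq']
    have hpa : p * a = a := by simp only [ha, ← mul_assoc, hp']
    have hap : a * p = a := by simp only [ha, mul_assoc, hp']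
    have hn : ‖a - p‖ < 1 := by
      have h1 : a - p = p * (r * q * star r - p) * p := by
        rw [mul_sub, sub_mul, hp', hp', ← ha]
      have h2 := norm_proj_le p hp hp'
      rw [h1]
      calc _ ≤ ‖p‖ * ‖r * q * star r - p‖ * ‖p‖ := by
            refine (norm_mul_le _ _).trans ?_
            gcongr
            exact norm_mul_le _ _
        _ ≤ 1 * ‖r * q * star r - p‖ * 1 := by gcongr
        _ < 1 := by simpa using hr
    have hasa : IsSelfAdjoint a := hxx ▸ IsSelfAdjoint.star_mul_self x
    obtain ⟨c, hc, hcac⟩ := unital_aux (B := Unitization ℂ A) (a : Unitization ℂ A) (p : Unitization ℂ A)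
      (by rw [IsSelfAdjoint, ← Unitization.inr_star, hasa.star_eq])
      (by rw [IsSelfAdjoint, ← Unitization.inr_star, hp])
      (by rw [← Unitization.inr_mul, hp'])
      (by rw [← Unitization.inr_mul, hpa])
      (by rw [← Unitization.inr_mul, hap])
      (by rw [← Unitization.inr_sub, Unitization.norm_inr]; exact hn)
    obtain ⟨v, hv⟩ : ∃ v : A, (v : Unitization ℂ A) = (x : Unitization ℂ A) * c :=
      ⟨((x : Unitization ℂ A) * c).snd, by ext <;> simp⟩
    have hvv : star v * v = p := by
      apply Unitization.inr_injective (R := ℂ)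
      rw [Unitization.inr_mul, Unitization.inr_star, hv, star_mul, hc.star_eq, ← hcac, ← hxx,
        Unitization.inr_mul ℂ (star x) x, Unitization.inr_star]
      simp only [mul_assoc]
    have hqv : q * v = v := by
      apply Unitization.inr_injective (R := ℂ)
      rw [Unitization.inr_mul, hv, ← mul_assoc, ← Unitization.inr_mul]
      simp only [hx, ← mul_assoc, hq']
    refine ⟨v, hvv, ?_⟩
    rw [(hv_proj v hvv).le_iff_mul_eq_right hqp]
    first
      | rw [← mul_assoc, hqv]
      | (have := congrArg star hqv
         rw [star_mul, hq] at this
         rw [mul_assoc, this])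
  · rintro ⟨v, hv, hle⟩ ε hε
    have h := pi_aux v p hp' hp hv
    have h1 : q * (v * star v) = v * star v := by
      first
        | exact ((hv_proj v hv).le_iff_mul_eq_right hqp).1 hle
        | exact ((hv_proj v hv).le_iff_mul_eq_left hqp).1 hle
    have h2 : q * v = v := by
      calc q * v = q * (v * star v) * v := by rw [mul_assoc, mul_assoc, hv, h]
        _ = v := by rw [h1, mul_assoc, hv, h]
    refine ⟨star v, ?_⟩
    rw [star_star, mul_assoc, h2, hv, sub_self, norm_zero]
    exact hε
end

section
/- Let A be a C*-algebra of stable rank one, i.e., the invertible elements of the unitization Unitization ℂ A are dense in Unitization ℂ A. Let a, b ∈ A be positive. Then a ≾ b if and only if there exists x ∈ A with (star x) * x = a and x * (star x) ∈ closure {b * y * b : y ∈ A}. -/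
namespace CuntzAux

section ideal

variable {U : Type*} [CStarAlgebra U]

/-- closed right ideal generated by `b` -/
noncomputable def C (b : U) : Submodule ℂ U := (LinearMap.range (LinearMap.mulLeft ℂ b)).topologicalClosure

theorem coe_C (b : U) : (C b : Set U) = closure (Set.range fun u => b * u) := by
  rw [C, Submodule.topologicalClosure_coe]; rfl

theorem mem_C {b x : U} : x ∈ C b ↔ x ∈ closure (Set.range fun u => b * u) := by
  rw [← coe_C]; rfl

theorem base_mem (b u : U) : b * u ∈ C b := mem_C.2 (subset_closure ⟨u, rfl⟩)

theorem isClosed_C (b : U) : IsClosed (C b : Set U) := by rw [coe_C]; exact isClosed_closure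

theorem C_mul {b c : U} (hc : c ∈ C b) (u : U) : c * u ∈ C b := by
  rw [mem_C] at hc ⊢
  refine map_mem_closure (f := fun y => y * u) (by fun_prop) hc ?_
  rintro _ ⟨v, rfl⟩; exact ⟨v * u, (mul_assoc _ _ _).symm⟩

theorem mul_C {b s c : U} (hs : s * b ∈ C b) (hc : c ∈ C b) : s * c ∈ C b := by
  rw [mem_C] at hc
  have := map_mem_closure (f := fun y => s * y) (t := (C b : Set U)) (by fun_prop) hc ?_
  · rwa [(isClosed_C b).closure_eq] at this
  rintro _ ⟨v, rfl⟩
  have := C_mul hs v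
  simpa [mul_assoc] using this

/-- star subalgebra of (two-sided) multipliers of the ideal -/
noncomputable def S (b : U) : StarSubalgebra ℂ U where
  carrier := {s | s * b ∈ C b ∧ star s * b ∈ C b}
  mul_mem' := by
    rintro x y ⟨h1, h2⟩ ⟨h3, h4⟩
    refine ⟨?_, ?_⟩
    · rw [mul_assoc]; exact mul_C h1 h3
    · rw [star_mul, mul_assoc]; exact mul_C h4 h2
  add_mem' := by
    rintro x y ⟨h1, h2⟩ ⟨h3, h4⟩
    refine ⟨?_, ?_⟩
    · rw [add_mul]; exact add_mem h1 h3
    · rw [star_add, add_mul]; exact add_mem h2 h4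
  algebraMap_mem' := by
    intro r
    have hb : b ∈ C b := by simpa using base_mem b 1
    refine ⟨?_, ?_⟩
    · rw [← Algebra.smul_def]; exact Submodule.smul_mem _ _ hb
    · rw [← algebraMap_star_comm, ← Algebra.smul_def]; exact Submodule.smul_mem _ _ hb
  star_mem' := by
    rintro x ⟨h1, h2⟩
    exact ⟨h2, by rwa [star_star]⟩

theorem isClosed_S (b : U) : IsClosed (S b : Set U) := by
  have : (S b : Set U) = (fun s => s * b) ⁻¹' (C b : Set U) ∩ (fun s => star s * b) ⁻¹' (C b : Set U) := rfl
  rw [this]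
  exact ((isClosed_C b).preimage (by fun_prop)).inter ((isClosed_C b).preimage (by fun_prop))

end ideal

variable {U : Type*} [CStarAlgebra U] [PartialOrder U] [StarOrderedRing U]

theorem norm_le_of_bounds {D : U} (hD : IsSelfAdjoint D) {c : ℝ} (hc : 0 ≤ c)
    (h1 : D ≤ algebraMap ℝ U c) (h2 : -D ≤ algebraMap ℝ U c) : ‖D‖ ≤ c := by
  have e : D = cfc (id : ℝ → ℝ) D := (cfc_id ℝ D).symm
  rw [e]
  apply norm_cfc_le hc
  intro x hx
  have h1' := (le_algebraMap_iff_spectrum_le (R := ℝ)).1 h1 x hx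
  have h3 : algebraMap ℝ U (-c) ≤ D := by
    rw [map_neg]; exact neg_le.1 h2
  have h2' := (algebraMap_le_iff_le_spectrum (R := ℝ)).1 h3 x hx
  simp only [id, Real.norm_eq_abs]
  exact abs_le.2 ⟨h2', h1'⟩

theorem le_add_of_sq {S T : U} (hS : 0 ≤ S) (hT : 0 ≤ T) {t : ℝ} (ht : 0 ≤ t)
    (h : ‖S * S - T * T‖ ≤ t ^ 2) : S - T ≤ algebraMap ℝ U t := by
  have hSs : IsSelfAdjoint S := .of_nonneg hS
  have hTs : IsSelfAdjoint T := .of_nonneg hT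
  have hsa : IsSelfAdjoint (S * S - T * T) := by
    simp [IsSelfAdjoint, hSs.star_eq, hTs.star_eq]
  have h1 : S * S - T * T ≤ algebraMap ℝ U (t ^ 2) :=
    hsa.le_algebraMap_norm_self.trans (algebraMap_mono U h)
  have ht' : (0:U) ≤ algebraMap ℝ U t := algebraMap_nonneg U ht
  have h2 : S * S ≤ (T + algebraMap ℝ U t) * (T + algebraMap ℝ U t) := by
    have hc : algebraMap ℝ U t * T = T * algebraMap ℝ U t := Algebra.commutes t T
    have : (T + algebraMap ℝ U t) * (T + algebraMap ℝ U t)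
        = T * T + algebraMap ℝ U (t^2) + (2 * t) • T := by
      rw [mul_add, add_mul, add_mul, hc, map_pow, pow_two, mul_smul, two_smul,
        Algebra.smul_def, hc]; abel
    rw [this]
    have h0 : 0 ≤ (2 * t) • T := smul_nonneg (by positivity) hT
    calc S * S = T * T + (S * S - T * T) := by abel
      _ ≤ T * T + algebraMap ℝ U (t^2) := by gcongr
      _ ≤ _ := le_add_of_nonneg_right h0
  have h3 := CFC.sqrt_le_sqrt _ _ h2
  rw [CFC.sqrt_mul_self S hS, CFC.sqrt_mul_self _ (add_nonneg hT ht')] at h3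
  exact sub_le_iff_le_add'.2 h3

theorem norm_sub_le_of_sq {S T : U} (hS : 0 ≤ S) (hT : 0 ≤ T) {t : ℝ} (ht : 0 ≤ t)
    (h : ‖S * S - T * T‖ ≤ t ^ 2) : ‖S - T‖ ≤ t := by
  apply norm_le_of_bounds ((IsSelfAdjoint.of_nonneg hS).sub (.of_nonneg hT)) ht
  · exact le_add_of_sq hS hT ht h
  · rw [neg_sub]; exact le_add_of_sq hT hS ht (by rwa [norm_sub_rev])

theorem isUnit_swap {R : Type*} [Ring R] {p q : R} (h : IsUnit (1 + p * q)) :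
    IsUnit (1 + q * p) := by
  obtain ⟨⟨u, v, huv, hvu⟩, rfl : u = 1 + p * q⟩ := h
  refine ⟨⟨1 + q * p, 1 - q * v * p, ?_, ?_⟩, rfl⟩
  · have : (1 + q * p) * (1 - q * v * p) = 1 + q * p - q * ((1 + p * q) * v) * p := by noncomm_ring
    rw [this, huv]; noncomm_ring
  · have : (1 - q * v * p) * (1 + q * p) = 1 + q * p - q * (v * (1 + p * q)) * p := by noncomm_ring
    rw [this, hvu]; noncomm_ring

/-- approximate unit -/
theorem exists_k {b : U} (hb : 0 ≤ b) {δ : ℝ} (hδ : 0 < δ) :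
    ∃ k : U, IsSelfAdjoint k ∧ b * k = k * b ∧ ‖1 - b * k‖ ≤ 1 ∧ ‖(1 - b * k) * b‖ ≤ δ := by
  have hbs : IsSelfAdjoint b := .of_nonneg hb
  have hsp : ∀ x ∈ spectrum ℝ b, 0 ≤ x := fun x hx => spectrum_nonneg_of_nonneg hb hx
  have hc : ContinuousOn (fun t : ℝ => (t + δ)⁻¹) (spectrum ℝ b) := by
    apply ContinuousOn.inv₀ (by fun_prop)
    intro x hx; have := hsp x hx; positivity
  have hid : b = cfc (fun t : ℝ => t) b := (cfc_id' ℝ b).symm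
  have h1 : (1 : U) = cfc (fun _ : ℝ => (1:ℝ)) b := (cfc_const_one ℝ b).symm
  set k := cfc (fun t : ℝ => (t + δ)⁻¹) b with hk
  have hbk : b * k = cfc (fun t : ℝ => t * (t + δ)⁻¹) b := by
    rw [cfc_mul _ _ b (by fun_prop) hc, ← hid]
  have hcb : ContinuousOn (fun t : ℝ => t * (t + δ)⁻¹) (spectrum ℝ b) := by fun_prop
  have h1bk : 1 - b * k = cfc (fun t : ℝ => 1 - t * (t + δ)⁻¹) b := by
    rw [cfc_sub _ _ b (by fun_prop) hcb, ← h1, hbk]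
  have hc1 : ContinuousOn (fun t : ℝ => 1 - t * (t + δ)⁻¹) (spectrum ℝ b) := by fun_prop
  have key : ∀ x : ℝ, 0 ≤ x → 1 - x * (x + δ)⁻¹ = δ / (x + δ) := by
    intro x hx
    have : x + δ ≠ 0 := by positivity
    field_simp; ring
  refine ⟨k, cfc_predicate _ b, ?_, ?_, ?_⟩
  · rw [hbk]
    nth_rewrite 2 [hid]
    rw [hk, ← cfc_mul _ _ b hc (by fun_prop)]
    simp only [mul_comm]
  · rw [h1bk]
    apply norm_cfc_le zero_le_one
    intro x hx
    have := hsp x hx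
    rw [key x this, Real.norm_of_nonneg (by positivity), div_le_one (by positivity)]
    linarith
  · rw [h1bk]
    nth_rewrite 2 [hid]
    rw [← cfc_mul _ _ b hc1 (by fun_prop)]
    apply norm_cfc_le hδ.le
    intro x hx
    have := hsp x hx
    rw [key x this, Real.norm_of_nonneg (by positivity), div_mul_eq_mul_div, div_le_iff₀ (by positivity)]
    nlinarith

/-- polar decomposition of an invertible -/
theorem exists_polar (T : U) (hT : IsUnit T) : ∃ g m : U, 0 ≤ m ∧ m * m = star T * T ∧
    T * g * m = T ∧ star (T * g) * (T * g) = 1 ∧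
    ∀ S : StarSubalgebra ℂ U, IsClosed (S : Set U) → T ∈ S → g ∈ S := by
  have h0 : 0 ≤ star T * T := star_mul_self_nonneg T
  have hu : IsUnit (star T * T) := hT.star.mul hT
  set P := star T * T with hP
  have hPs : IsSelfAdjoint P := .of_nonneg h0
  have hsp : ∀ x ∈ spectrum ℝ P, 0 < x := by
    intro x hx
    refine lt_of_le_of_ne (spectrum_nonneg_of_nonneg h0 hx) ?_
    rintro rfl
    exact spectrum.zero_notMem ℝ hu hx
  have hc : ContinuousOn (fun t : ℝ => (√t)⁻¹) (spectrum ℝ P) := by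
    apply ContinuousOn.inv₀ (by fun_prop)
    intro x hx; have := hsp x hx; positivity
  have hc2 : ContinuousOn (fun t : ℝ => √t) (spectrum ℝ P) := by fun_prop
  set g := cfc (fun t : ℝ => (√t)⁻¹) P with hg
  set m := cfc (fun t : ℝ => √t) P with hm
  have hgs : star g = g := (cfc_predicate (fun t : ℝ => (√t)⁻¹) P : IsSelfAdjoint _).star_eq
  have hmm : m * m = P := by
    rw [hm, ← cfc_mul _ _ P hc2 hc2]
    conv_rhs => rw [← cfc_id' ℝ P]
    exact cfc_congr fun x hx => Real.mul_self_sqrt (hsp x hx).le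
  have hgm : g * m = 1 := by
    rw [hm, hg, ← cfc_mul _ _ P hc hc2, ← cfc_const_one ℝ P]
    refine cfc_congr fun x hx => ?_
    have := hsp x hx
    have : √x ≠ 0 := by positivity
    exact inv_mul_cancel₀ this
  have hmg : m * g = 1 := by
    rw [hm, hg, ← cfc_mul _ _ P hc2 hc, ← cfc_const_one ℝ P]
    refine cfc_congr fun x hx => ?_
    have := hsp x hx
    have : √x ≠ 0 := by positivity
    exact mul_inv_cancel₀ this
  refine ⟨g, m, cfc_nonneg fun x _ => Real.sqrt_nonneg x, hmm, by rw [mul_assoc, hgm, mul_one], ?_, ?_⟩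
  · rw [star_mul, hgs, mul_assoc, ← mul_assoc (star T), ← hP, ← hmm, mul_assoc m, hmg, mul_one, hgm]
  · intro S hS hTS
    have : IsClosed (S : Set U) := hS
    exact cfc_mem (𝕜 := ℝ) (𝕜' := ℂ) (s := S) _ (mul_mem (star_mem hTS) hTS)

theorem perturb (hU : Dense {u : U | IsUnit u}) {b : U} (hb : IsSelfAdjoint b) (c : U) :
    b * c * b ∈ closure {T : U | IsUnit T ∧ T ∈ S b} := by
  rw [Metric.mem_closure_iff]
  intro η hη
  obtain hU0 | hU0 := subsingleton_or_nontrivial U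
  · refine ⟨b * c * b, ⟨isUnit_of_subsingleton _, ?_⟩, by simpa using hη⟩
    rw [Subsingleton.elim (b * c * b) 1]; exact one_mem _
  set μ : ℂ := ((η / 2 : ℝ) : ℂ) with hμ
  have hμ0 : μ ≠ 0 := by rw [hμ]; exact_mod_cast (by positivity : η / 2 ≠ 0)
  have hμn : ‖μ‖ = η / 2 := by rw [hμ, Complex.norm_real, Real.norm_of_nonneg (by positivity)]
  have hv : IsUnit (algebraMap ℂ U μ) := (IsUnit.mk0 μ hμ0).map _
  obtain ⟨V, hV⟩ := hv
  set G : U → U := fun v => μ • (1 + b * Ring.inverse v * c * b) with hG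
  have hGc : ContinuousAt G (V : U) := by
    have := NormedRing.inverse_continuousAt V
    simp only [hG]
    fun_prop
  have hGV : G V = algebraMap ℂ U μ + b * c * b := by
    have hi : Ring.inverse (V : U) = algebraMap ℂ U μ⁻¹ := by
      rw [Ring.inverse_unit]
      apply Units.inv_eq_of_mul_eq_one_right
      rw [hV, ← map_mul, mul_inv_cancel₀ hμ0, map_one]
    simp only [hG]
    rw [hi, mul_assoc b, ← Algebra.smul_def, smul_add, mul_smul_comm, smul_mul_assoc, smul_smul,
      mul_inv_cancel₀ hμ0, one_smul, Algebra.algebraMap_eq_smul_one]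
  have e1 : ∀ᶠ v in nhds (V : U), ‖G v - G V‖ < η / 2 := by
    have := hGc.eventually (Metric.ball_mem_nhds _ (half_pos hη))
    simpa [dist_eq_norm] using this
  have e2 : ∀ᶠ v in nhds (V : U), IsUnit v := Units.nhds V
  have ht : Filter.Tendsto (fun y : U => y - c * b * b) (nhds (V + c * b * b)) (nhds (V : U)) := by
    have : Continuous (fun y : U => y - c * b * b) := by fun_prop
    simpa using this.tendsto (V + c * b * b)
  have e3 := ht.eventually (e1.and e2)
  obtain ⟨y, ⟨h1, h2⟩, hy⟩ := mem_closure_iff_nhds.1 (hU (V + c * b * b)) _ e3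
  set v := y - c * b * b with hvd
  have hyu : IsUnit y := hy
  obtain ⟨W, hW⟩ := h2
  have hunit : IsUnit (1 + (Ring.inverse v * c * b) * b) := by
    have : 1 + (Ring.inverse v * c * b) * b = ↑W⁻¹ * y := by
      rw [← hW, Ring.inverse_unit]
      have : y = W + c * b * b := by rw [hW, hvd]; abel
      rw [this, mul_add, Units.inv_mul]; simp only [mul_assoc]
    rw [this]; exact (Units.isUnit _).mul hyu
  have hunit2 := isUnit_swap hunit
  refine ⟨G v, ⟨?_, ?_⟩, ?_⟩
  · have : G v = algebraMap ℂ U μ * (1 + b * (Ring.inverse v * c * b)) := by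
      simp only [hG]; rw [Algebra.smul_def]; simp only [mul_assoc]
    rw [this, ← hV]
    exact V.isUnit.mul hunit2
  · have hmem : ∀ u : U, b * u * b ∈ S b := by
      intro u
      refine ⟨?_, ?_⟩
      · rw [mul_assoc, mul_assoc]; exact base_mem b _
      · rw [star_mul, star_mul, hb.star_eq, mul_assoc]; exact base_mem b _
    simp only [hG]
    rw [mul_assoc b]
    exact (S b).smul_mem (add_mem (one_mem _) (hmem _)) μ
  · rw [dist_eq_norm, norm_sub_rev]
    have : G v - b * c * b = (G v - G V) + algebraMap ℂ U μ := by rw [hGV]; abel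
    rw [this]
    calc _ ≤ ‖G v - G V‖ + ‖algebraMap ℂ U μ‖ := norm_add_le _ _
      _ < η / 2 + η / 2 := by rw [norm_algebraMap', hμn]; linarith
      _ = η := by ring

theorem isometry_mul {w : U} (hw : star w * w = 1) (d : U) : ‖w * d‖ = ‖d‖ := by
  have : ‖w * d‖ * ‖w * d‖ = ‖d‖ * ‖d‖ := by
    rw [← CStarRing.norm_star_mul_self, ← CStarRing.norm_star_mul_self, star_mul, mul_assoc,
      ← mul_assoc (star w), hw, one_mul]
  nlinarith [norm_nonneg (w * d), norm_nonneg d]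

theorem step (hU : Dense {u : U | IsUnit u}) {b : U} (hb : IsSelfAdjoint b) (s t : U) {ε M : ℝ}
    (hε : 0 < ε) (hε1 : ε ≤ 1) (hM : 1 ≤ M) {x z : U} (hx : x = b * s) (hz : z = b * t)
    (hxM : ‖x‖ ^ 2 ≤ M) (hzM : ‖z‖ ^ 2 ≤ M) (h : ‖star x * x - star z * z‖ ≤ ε) :
    ∃ w ∈ S b, star w * w = 1 ∧ ‖x - w * z‖ ^ 4 ≤ 32 * M * ε := by
  have hq : x * star z = b * (s * star t) * b := by
    rw [hx, hz, star_mul, hb.star_eq]; simp only [mul_assoc]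
  set q := x * star z with hqd
  have hcl := perturb hU hb (s * star t)
  rw [← hq] at hcl
  have e1 : ∀ᶠ T in nhds q, ‖T - q‖ < ε := by
    filter_upwards [Metric.ball_mem_nhds q hε] with T hT; simpa [dist_eq_norm] using hT
  have e2 : ∀ᶠ T in nhds q, ‖star T * T - star q * q‖ < ε := by
    have hc : ContinuousAt (fun T : U => star T * T) q := by fun_prop
    simpa [dist_eq_norm] using hc.eventually (Metric.ball_mem_nhds _ hε)
  obtain ⟨T, ⟨h1, h2⟩, hTu, hTS⟩ := mem_closure_iff_nhds.1 hcl _ (e1.and e2)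
  obtain ⟨g, m, hm0, hmm, hTgm, hw, hgS⟩ := exists_polar T hTu
  have hgS' := hgS (S b) (isClosed_S b) hTS
  set w := T * g with hwd
  refine ⟨w, mul_mem hTS hgS', hw, ?_⟩
  have hzz : 0 ≤ z * star z := mul_star_self_nonneg z
  have hρ : ‖m - z * star z‖ ≤ √((1 + M) * ε) := by
    apply norm_sub_le_of_sq hm0 hzz (Real.sqrt_nonneg _)
    rw [Real.sq_sqrt (by positivity), hmm]
    have : star T * T - z * star z * (z * star z) =
        (star T * T - star q * q) + z * (star x * x - star z * z) * star z := by
      rw [hqd, star_mul, star_star]; noncomm_ring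
    rw [this]
    have h3 : ‖z * (star x * x - star z * z) * star z‖ ≤ M * ε := by
      calc _ ≤ ‖z‖ * ‖star x * x - star z * z‖ * ‖star z‖ := norm_mul₃_le
        _ = ‖z‖ ^ 2 * ‖star x * x - star z * z‖ := by rw [norm_star]; ring
        _ ≤ M * ε := by gcongr
    linarith [norm_add_le (star T * T - star q * q) (z * (star x * x - star z * z) * star z)]
  set D := x - w * z with hD
  have hDz : ‖D * star z‖ ≤ ε + √((1 + M) * ε) := by
    have : D * star z = (q - T) + w * (m - z * star z) := by
      rw [mul_sub, hTgm, hD, hqd]; noncomm_ring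
    rw [this]
    have h4 := norm_add_le (q - T) (w * (m - z * star z))
    rw [isometry_mul hw, norm_sub_rev q T] at h4
    linarith
  have hDz2 : ‖D * star z‖ ^ 2 ≤ (4 + 2 * M) * ε := by
    have h5 : √((1 + M) * ε) ^ 2 = (1 + M) * ε := Real.sq_sqrt (by positivity)
    have h6 : ‖D * star z‖ ^ 2 ≤ (ε + √((1 + M) * ε)) ^ 2 := by gcongr
    nlinarith [sq_nonneg (ε - √((1 + M) * ε))]
  have hDn : ‖D‖ ^ 2 ≤ 4 * M := by
    have h7 : ‖D‖ ≤ ‖x‖ + ‖z‖ := by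
      have := norm_sub_le x (w * z); rwa [isometry_mul hw] at this
    have h8 : ‖D‖ ^ 2 ≤ (‖x‖ + ‖z‖) ^ 2 := by gcongr
    nlinarith [sq_nonneg (‖x‖ - ‖z‖)]
  have hxz : star x * x ≤ star z * z + algebraMap ℝ U ε := by
    have hsa : IsSelfAdjoint (star x * x - star z * z) :=
      (IsSelfAdjoint.star_mul_self x).sub (IsSelfAdjoint.star_mul_self z)
    exact sub_le_iff_le_add'.1 (hsa.le_algebraMap_norm_self.trans (algebraMap_mono U h))
  have hDD : star D * D ≤ (4 : ℝ) • (star z * z) + algebraMap ℝ U (2 * ε) := by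
    have e : star D * D + star (x + w * z) * (x + w * z)
        = (2 : ℝ) • (star x * x) + (2 : ℝ) • (star z * z) := by
      have : star (w * z) * (w * z) = star z * z := by
        rw [star_mul, mul_assoc, ← mul_assoc (star w), hw, one_mul]
      rw [two_smul, two_smul]
      rw [← this]
      rw [hD, star_sub, star_add]; noncomm_ring
    calc star D * D ≤ star D * D + star (x + w * z) * (x + w * z) :=
          le_add_of_nonneg_right (star_mul_self_nonneg _)
      _ = (2 : ℝ) • (star x * x) + (2 : ℝ) • (star z * z) := e
      _ ≤ (2 : ℝ) • (star z * z + algebraMap ℝ U ε) + (2 : ℝ) • (star z * z) := by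
          gcongr
      _ = _ := by
          rw [Algebra.algebraMap_eq_smul_one, Algebra.algebraMap_eq_smul_one]; module
  have h9 := star_right_conjugate_le_conjugate hDD D
  have h10 : 0 ≤ D * (star D * D) * star D :=
    star_right_conjugate_nonneg (star_mul_self_nonneg D) D
  have h11 := CStarAlgebra.norm_le_norm_of_nonneg_of_le h10 h9
  have h12 : ‖D * (star D * D) * star D‖ = ‖D‖ ^ 4 := by
    have : D * (star D * D) * star D = (D * star D) * star (D * star D) := by
      rw [star_mul, star_star]; simp only [mul_assoc]
    rw [this, CStarRing.norm_self_mul_star, CStarRing.norm_self_mul_star]; ring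
  have h13 : ‖D * ((4 : ℝ) • (star z * z) + algebraMap ℝ U (2 * ε)) * star D‖
      ≤ 4 * ‖D * star z‖ ^ 2 + 2 * ε * ‖D‖ ^ 2 := by
    have : D * ((4 : ℝ) • (star z * z) + algebraMap ℝ U (2 * ε)) * star D
        = (4 : ℝ) • ((D * star z) * star (D * star z)) + (2 * ε) • (D * star D) := by
      rw [Algebra.algebraMap_eq_smul_one, star_mul, star_star]
      simp only [mul_add, add_mul, mul_smul_comm, smul_mul_assoc, mul_one, mul_assoc]
    rw [this]
    refine (norm_add_le _ _).trans ?_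
    rw [norm_smul, norm_smul, CStarRing.norm_self_mul_star, CStarRing.norm_self_mul_star,
      Real.norm_of_nonneg (by norm_num), Real.norm_of_nonneg (by positivity)]
    apply le_of_eq; ring
  rw [h12] at h11
  nlinarith

theorem absorb {b : U} (hb : 0 ≤ b) {y : U} (hy : y ∈ C b) {ε : ℝ} (hε : 0 < ε) :
    ∃ k : U, IsSelfAdjoint k ∧ b * k = k * b ∧ ‖1 - b * k‖ ≤ 1 ∧ ‖(1 - b * k) * y‖ < ε := by
  rw [mem_C, Metric.mem_closure_iff] at hy
  obtain ⟨_, ⟨u, rfl⟩, hu⟩ := hy (ε / 2) (half_pos hε)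
  rw [dist_eq_norm] at hu
  obtain ⟨k, h1, h2, h3, h4⟩ := exists_k hb (δ := ε / 2 / (‖u‖ + 1)) (by positivity)
  refine ⟨k, h1, h2, h3, ?_⟩
  have : (1 - b * k) * y = (1 - b * k) * (y - b * u) + (1 - b * k) * b * u := by noncomm_ring
  rw [this]
  have h5 : ‖(1 - b * k) * (y - b * u)‖ < ε / 2 := by
    refine (norm_mul_le _ _).trans_lt ?_
    nlinarith [norm_nonneg (y - b * u)]
  have h6 : ‖(1 - b * k) * b * u‖ ≤ ε / 2 := by
    calc _ ≤ ε / 2 / (‖u‖ + 1) * (‖u‖ + 1) := by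
            refine (norm_mul_le _ _).trans ?_
            gcongr; linarith
      _ = ε / 2 := by field_simp
  linarith [norm_add_le ((1 - b * k) * (y - b * u)) ((1 - b * k) * b * u)]

theorem absorb2 {b : U} (hb : 0 ≤ b) {x : U} (hx : x * star x ∈ C b) {ε : ℝ} (hε : 0 < ε) :
    ∃ k : U, IsSelfAdjoint k ∧ b * k = k * b ∧ ‖x - b * k * x‖ < ε := by
  obtain ⟨k, h1, h2, h3, h4⟩ := absorb hb hx (ε := ε ^ 2) (by positivity)
  refine ⟨k, h1, h2, ?_⟩
  have e : x - b * k * x = (1 - b * k) * x := by noncomm_ring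
  rw [e]
  have : ‖(1 - b * k) * x‖ * ‖(1 - b * k) * x‖ < ε ^ 2 := by
    rw [← CStarRing.norm_self_mul_star, star_mul]
    have : (1 - b * k) * x * (star x * star (1 - b * k))
      = ((1 - b * k) * (x * star x)) * star (1 - b * k) := by simp only [mul_assoc]
    rw [this]
    refine (norm_mul_le _ _).trans_lt ?_
    rw [norm_star]
    nlinarith [norm_nonneg ((1 - b * k) * (x * star x)), norm_nonneg (1 - b * k)]
  nlinarith [norm_nonneg ((1 - b * k) * x)]

theorem sqrt_mem {b : U} (hb : 0 ≤ b) : CFC.sqrt b ∈ C b := by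
  have hs : star (CFC.sqrt b) = CFC.sqrt b := (IsSelfAdjoint.of_nonneg (CFC.sqrt_nonneg b)).star_eq
  have h : CFC.sqrt b * star (CFC.sqrt b) ∈ C b := by
    rw [hs, CFC.sqrt_mul_sqrt_self b hb]; simpa using base_mem b 1
  rw [mem_C, Metric.mem_closure_iff]
  intro ε hε
  obtain ⟨k, -, -, h3⟩ := absorb2 hb h hε
  exact ⟨_, ⟨k * CFC.sqrt b, rfl⟩, by simpa [dist_eq_norm, mul_assoc] using h3⟩

/-- approximate `y` in the closure by something in the range with `star y * y` close. -/
theorem approx {b y a : U} (hy : y ∈ C b) {δ τ : ℝ} (hτ : 0 < τ) (h : ‖star y * y - a‖ < δ) :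
    ∃ u : U, ‖b * u - y‖ < τ ∧ ‖star (b * u) * (b * u) - a‖ < δ := by
  rw [mem_C] at hy
  have e1 : ∀ᶠ v in nhds y, ‖v - y‖ < τ := by
    filter_upwards [Metric.ball_mem_nhds y hτ] with T hT; simpa [dist_eq_norm] using hT
  have e2 : ∀ᶠ v in nhds y, ‖star v * v - a‖ < δ := by
    have hc : ContinuousAt (fun v : U => ‖star v * v - a‖) y := by fun_prop
    exact hc.eventually (gt_mem_nhds h)
  obtain ⟨_, ⟨h1, h2⟩, ⟨u, rfl⟩⟩ := mem_closure_iff_nhds.1 hy _ (e1.and e2)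
  exact ⟨u, h1, h2⟩

theorem start {a b : U} (hb : 0 ≤ b) (h : ∀ ε > 0, ∃ r : U, ‖r * b * star r - a‖ < ε) {δ : ℝ}
    (hδ : 0 < δ) : ∃ t : U, ‖star (b * t) * (b * t) - a‖ < δ := by
  obtain ⟨r, hr⟩ := h δ hδ
  have hs : star (CFC.sqrt b) = CFC.sqrt b := (IsSelfAdjoint.of_nonneg (CFC.sqrt_nonneg b)).star_eq
  have hy := C_mul (sqrt_mem hb) (star r)
  obtain ⟨t, -, ht⟩ := approx (a := a) hy one_pos (δ := δ) (by
    rw [star_mul, star_star, hs, mul_assoc, ← mul_assoc (CFC.sqrt b),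
      CFC.sqrt_mul_sqrt_self b hb, ← mul_assoc]
    exact hr)
  exact ⟨t, ht⟩

theorem improve (hU : Dense {u : U | IsUnit u}) {a b : U} (hb : 0 ≤ b)
    (h : ∀ ε > 0, ∃ r : U, ‖r * b * star r - a‖ < ε) {τ : ℝ} (hτ : 0 < τ) :
    ∃ ε > 0, ∀ s : U, ‖star (b * s) * (b * s) - a‖ < ε → ∀ δ > 0,
      ∃ u : U, ‖b * u - b * s‖ < τ ∧ ‖star (b * u) * (b * u) - a‖ < δ := by
  set M := ‖a‖ + 1 with hM
  have hM1 : 1 ≤ M := by rw [hM]; linarith [norm_nonneg a]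
  set ε := min 1 ((τ / 2) ^ 4 / (64 * M)) with hε
  have hε0 : 0 < ε := lt_min one_pos (by positivity)
  have hε1 : ε ≤ 1 := min_le_left _ _
  have hε2 : 32 * M * ε < (τ / 2) ^ 4 := by
    have : ε ≤ (τ / 2) ^ 4 / (64 * M) := min_le_right _ _
    rw [le_div_iff₀ (by positivity)] at this
    have : 0 < (τ / 2) ^ 4 := by positivity
    nlinarith
  have bd : ∀ x : U, ‖star x * x - a‖ < ε / 2 → ‖x‖ ^ 2 ≤ M := by
    intro x hx
    rw [pow_two, ← CStarRing.norm_star_mul_self]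
    have := norm_add_le (star x * x - a) a
    rw [sub_add_cancel] at this
    linarith
  refine ⟨ε / 2, half_pos hε0, fun s hs δ hδ => ?_⟩
  obtain ⟨t, ht⟩ := start hb h (δ := min (ε / 2) δ) (lt_min (half_pos hε0) hδ)
  have ht1 := ht.trans_le (min_le_left _ _)
  have ht2 := ht.trans_le (min_le_right _ _)
  obtain ⟨w, hwS, hw, hwb⟩ := step hU (IsSelfAdjoint.of_nonneg hb) s t hε0 hε1 hM1 rfl rfl
    (bd _ hs) (bd _ ht1) (by
      have := norm_sub_le (star (b * s) * (b * s) - a) (star (b * t) * (b * t) - a)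
      rw [sub_sub_sub_cancel_right] at this
      linarith)
  have hmem : w * (b * t) ∈ C b := by rw [← mul_assoc]; exact C_mul hwS.1 t
  obtain ⟨u, hu1, hu2⟩ := approx (a := a) hmem (half_pos hτ) (δ := δ) (by
    rwa [star_mul, mul_assoc, ← mul_assoc (star w), hw, one_mul])
  refine ⟨u, ?_, hu2⟩
  have h1 : ‖b * s - w * (b * t)‖ < τ / 2 :=
    lt_of_pow_lt_pow_left₀ 4 (by positivity) (hwb.trans_lt hε2)
  have := norm_sub_le (b * u - w * (b * t)) (b * s - w * (b * t))
  rw [sub_sub_sub_cancel_right] at this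
  linarith

theorem main_unital (hU : Dense {u : U | IsUnit u}) {a b : U} (hb : 0 ≤ b)
    (h : ∀ ε > 0, ∃ r : U, ‖r * b * star r - a‖ < ε) :
    ∃ x ∈ C b, star x * x = a := by
  have hτ : ∀ n : ℕ, (0:ℝ) < (1 / 2) ^ n := fun n => by positivity
  choose e he himp using fun n : ℕ => improve hU hb h (hτ n)
  let P : ℕ → U → Prop := fun n s =>
    ‖star (b * s) * (b * s) - a‖ < e n ∧ ‖star (b * s) * (b * s) - a‖ < (1 / 2) ^ n
  have h0 : ∃ s, P 0 s := by
    obtain ⟨t, ht⟩ := start hb h (δ := min (e 0) ((1 / 2) ^ 0)) (lt_min (he 0) (hτ 0))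
    exact ⟨t, ht.trans_le (min_le_left _ _), ht.trans_le (min_le_right _ _)⟩
  have hs : ∀ n s, P n s → ∃ u, P (n + 1) u ∧ ‖b * u - b * s‖ < (1 / 2) ^ n := by
    intro n s hP
    obtain ⟨u, hu1, hu2⟩ := himp n s hP.1 (min (e (n+1)) ((1 / 2) ^ (n+1)))
      (lt_min (he _) (hτ _))
    exact ⟨u, ⟨hu2.trans_le (min_le_left _ _), hu2.trans_le (min_le_right _ _)⟩, hu1⟩
  obtain ⟨s0, hs0⟩ := h0
  choose nx hnx1 hnx2 using hs
  let sq : (n : ℕ) → {s : U // P n s} := fun n =>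
    Nat.rec ⟨s0, hs0⟩ (fun n p => ⟨nx n p.1 p.2, hnx1 n p.1 p.2⟩) n
  let x : ℕ → U := fun n => b * (sq n).1
  have hd : ∀ n, dist (x n) (x (n + 1)) ≤ 1 * (1 / 2) ^ n := by
    intro n
    rw [one_mul, dist_comm, dist_eq_norm]
    exact (hnx2 n (sq n).1 (sq n).2).le
  have hcau : CauchySeq x := cauchySeq_of_le_geometric _ _ (by norm_num) hd
  obtain ⟨y, hy⟩ := cauchySeq_tendsto_of_complete hcau
  refine ⟨y, ?_, ?_⟩
  · exact (isClosed_C b).mem_of_tendsto hy (Filter.Eventually.of_forall fun n => base_mem b _)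
  · have hc : Continuous (fun v : U => star v * v) := by fun_prop
    have t1 := (hc.tendsto y).comp hy
    have t2 : Filter.Tendsto (fun n => star (x n) * x n) Filter.atTop (nhds a) := by
      rw [tendsto_iff_norm_sub_tendsto_zero]
      refine squeeze_zero (fun _ => norm_nonneg _) (fun n => (sq n).2.2.le) ?_
      exact tendsto_pow_atTop_nhds_zero_of_lt_one (by norm_num) (by norm_num)
    exact tendsto_nhds_unique t1 t2

end CuntzAux

theorem cuntzLE_iff_of_stableRankOne {A : Type*} [NonUnitalCStarAlgebra A] [PartialOrder A]
    [StarOrderedRing A] (hA : Dense {u : Unitization ℂ A | IsUnit u}) (a b : A)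
    (ha : 0 ≤ a) (hb : 0 ≤ b) :
    CuntzLE a b ↔
      ∃ x : A, star x * x = a ∧ x * star x ∈ closure {y : A | ∃ z : A, y = b * z * b} := by
  have hbU : (0 : Unitization ℂ A) ≤ (b : Unitization ℂ A) := Unitization.inr_nonneg_iff.2 hb
  have lift : ∀ u : Unitization ℂ A, u.fst = 0 → ∃ v : A, (v : Unitization ℂ A) = u := by
    intro u hu
    exact ⟨u.snd, Unitization.ext (by simp [hu]) (by simp)⟩
  have hn : ∀ v : A, ‖(v : Unitization ℂ A)‖ = ‖v‖ := fun v => Unitization.norm_inr v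
  constructor
  · intro h
    obtain ⟨x, hx, hxa⟩ := CuntzAux.main_unital hA (a := (a : Unitization ℂ A)) hbU (by
      intro ε hε
      obtain ⟨r, hr⟩ := h ε hε
      refine ⟨r, ?_⟩
      rw [← hn] at hr
      simpa using hr)
    have hf : x.fst = 0 := by
      have := congrArg (fun u : Unitization ℂ A => u.fst) hxa
      simpa using this
    obtain ⟨v, rfl⟩ := lift x hf
    refine ⟨v, ?_, ?_⟩
    · apply Unitization.inr_injective (R := ℂ); simpa using hxa
    · rw [Metric.mem_closure_iff]
      intro ε hε
      have hp := CuntzAux.C_mul hx (star (v : Unitization ℂ A))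
      obtain ⟨k, h1, h2, h3, h4⟩ := CuntzAux.absorb hbU hp (ε := ε / 3) (by positivity)
      set p := (v : Unitization ℂ A) * star (v : Unitization ℂ A) with hpd
      have hbs : star (b : Unitization ℂ A) = b := (IsSelfAdjoint.of_nonneg hbU).star_eq
      have hps : star p = p := by rw [hpd]; simp
      obtain ⟨z, hz⟩ := lift (k * p * k) (by simp [hpd])
      refine ⟨b * z * b, ⟨z, rfl⟩, ?_⟩
      rw [dist_eq_norm, ← hn]
      have e : ((v * star v - b * z * b : A) : Unitization ℂ A)
          = (1 - b * k) * p + star ((1 - b * k) * p * star (b * k : Unitization ℂ A)) := by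
        simp only [Unitization.inr_sub, Unitization.inr_mul, Unitization.inr_star, hz, star_mul,
          star_sub, star_one, hps, hbs, h1.star_eq]
        rw [← hpd, ← h2]
        have : (b : Unitization ℂ A) * (k * p * k) * b = b * k * p * (b * k) := by
          rw [mul_assoc, mul_assoc (k * p), ← h2]; simp only [mul_assoc]
        rw [this]
        noncomm_ring
      rw [e]
      have hk : ‖(b : Unitization ℂ A) * k‖ ≤ 2 := by
        have e2 : (b : Unitization ℂ A) * k = 1 - (1 - b * k) := by abel
        rw [e2]
        refine (norm_sub_le _ _).trans ?_
        have : ‖(1 : Unitization ℂ A)‖ ≤ 1 := by rw [norm_one]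
        linarith
      refine (norm_add_le _ _).trans_lt ?_
      rw [norm_star]
      have h5 := norm_mul_le ((1 - b * k) * p) (star (b * k : Unitization ℂ A))
      rw [norm_star] at h5
      nlinarith [norm_nonneg ((1 - b * k) * p)]
  · rintro ⟨x, hxa, hx⟩ ε hε
    have hC : (x : Unitization ℂ A) * star (x : Unitization ℂ A) ∈ CuntzAux.C (b : Unitization ℂ A) := by
      rw [CuntzAux.mem_C]
      have := map_mem_closure (f := fun y : A => (y : Unitization ℂ A))
        (t := Set.range fun u => (b : Unitization ℂ A) * u)
        (Unitization.isometry_inr (𝕜 := ℂ) (A := A)).continuous hx ?_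
      · simpa using this
      rintro _ ⟨z, rfl⟩
      exact ⟨z * b, by simp [mul_assoc]⟩
    have hcl : (x : Unitization ℂ A) ∈ closure {y : Unitization ℂ A | ∃ r : A,
        star y * y = r * b * star r} := by
      rw [Metric.mem_closure_iff]
      intro η hη
      obtain ⟨k, h1, h2, h3⟩ := CuntzAux.absorb2 hbU hC hη
      have hbs : star (b : Unitization ℂ A) = b := (IsSelfAdjoint.of_nonneg hbU).star_eq
      have hss : star (CFC.sqrt (b : Unitization ℂ A)) = CFC.sqrt (b : Unitization ℂ A) :=
        (IsSelfAdjoint.of_nonneg (CFC.sqrt_nonneg _)).star_eq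
      obtain ⟨r, hr⟩ := lift (star (x : Unitization ℂ A) * k * CFC.sqrt (b : Unitization ℂ A))
        (by simp)
      refine ⟨_, ⟨r, ?_⟩, by rwa [dist_eq_norm]⟩
      have hsq := CFC.sqrt_mul_sqrt_self (b : Unitization ℂ A) hbU
      rw [Unitization.inr_star, hr]
      simp only [star_mul, star_star, hss, h1.star_eq, hbs]
      generalize CFC.sqrt (b : Unitization ℂ A) = q at *
      rw [← hsq]; simp only [mul_assoc]
    have := map_mem_closure (f := fun y : Unitization ℂ A => star y * y)
        (t := {y : Unitization ℂ A | ∃ r : A, y = r * b * star r}) (by fun_prop) hcl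
        (by rintro y ⟨r, hr⟩; exact ⟨r, by simpa using hr⟩)
    rw [Metric.mem_closure_iff] at this
    obtain ⟨_, ⟨r, rfl⟩, hr⟩ := this ε hε
    refine ⟨r, ?_⟩
    rw [dist_comm, dist_eq_norm] at hr
    rw [← hn, ← hxa]
    simpa using hr
end

section
/- Let A be a C*-algebra with weak stable rank one, meaning that the image of A in its unitization Unitization ℂ A is contained in the closure of the set of invertible elements of Unitization ℂ A. Let a, b ∈ A be positive. Then a ≾ b if and only if for every ε > 0 there exists a unitary u of Unitization ℂ A (i.e., (star u) * u = 1 = u * (star u)) such that u * (a − ε)₊ * (star u) lies in the closure (inside Unitization ℂ A) of the image of {b * y * b : y ∈ A}. (The implication from the unitary condition to a ≾ b holds in every C*-algebra.) -/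
section Helpers
variable {M : Type*} [CStarAlgebra M]

lemma aux_cfc_mul (h : M) {f g : ℝ → ℝ} (hf : Continuous f) (hg : Continuous g) :
    cfc f h * cfc g h = cfc (fun t => f t * g t) h :=
  (cfc_mul f g h hf.continuousOn hg.continuousOn).symm

lemma aux_cfc_mul3 (h : M) {f g k : ℝ → ℝ} (hf : Continuous f) (hg : Continuous g)
    (hk : Continuous k) :
    cfc f h * cfc g h * cfc k h = cfc (fun t => f t * g t * k t) h := by
  have hfg : Continuous (fun t => f t * g t) := hf.mul hg
  rw [aux_cfc_mul h hf hg, aux_cfc_mul h hfg hk]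

lemma aux_unit_swap (p r : M) (h : IsUnit (1 + p * r)) : IsUnit (1 + r * p) := by
  obtain ⟨w, hw⟩ := h
  have h1 : (1 + p * r) * (↑w⁻¹ : M) = 1 := by rw [← hw]; simp
  have h2 : (↑w⁻¹ : M) * (1 + p * r) = 1 := by rw [← hw]; simp
  generalize (↑w⁻¹ : M) = v at h1 h2
  refine ⟨⟨1 + r * p, 1 - r * v * p, ?_, ?_⟩, rfl⟩
  · calc (1 + r * p) * (1 - r * v * p) = 1 + r * p - r * ((1 + p * r) * v) * p := by noncomm_ring
      _ = 1 := by rw [h1]; noncomm_ring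
  · calc (1 - r * v * p) * (1 + r * p) = 1 + r * p - r * (v * (1 + p * r)) * p := by noncomm_ring
      _ = 1 := by rw [h2]; noncomm_ring

lemma aux_unit_add (p : M) (h : ‖p‖ < 1) : IsUnit (1 + p) := by
  have := (Units.oneSub (-p) (by simpa using h)).isUnit
  simpa using this

/-- polar decomposition of invertibles -/
lemma aux_polar [PartialOrder M] [StarOrderedRing M] (y : M) (hy : IsUnit y) :
    ∃ P : M, (∀ Q : M, Commute (star y * y) Q → Commute P Q) ∧
      star (y * P) * (y * P) = 1 ∧ (y * P) * star (y * P) = 1 := by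
  set T := star y * y with hT
  have hT0 : 0 ≤ T := star_mul_self_nonneg y
  have hTu : IsUnit T := hy.star.mul hy
  have hsp : ∀ t ∈ spectrum ℝ T, 0 < t := by
    intro t ht
    have h0 := spectrum_nonneg_of_nonneg hT0 ht
    refine lt_of_le_of_ne h0 ?_
    rintro rfl
    exact (spectrum.zero_notMem_iff ℝ).2 hTu ht
  have hc : ContinuousOn (fun t : ℝ => (√t)⁻¹) (spectrum ℝ T) := by
    apply ContinuousOn.inv₀ (by fun_prop)
    intro t ht
    exact (Real.sqrt_pos.2 (hsp t ht)).ne'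
  set P := cfc (fun t : ℝ => (√t)⁻¹) T with hP
  have hPsa : star P = P := (IsSelfAdjoint.cfc : IsSelfAdjoint (cfc (fun t : ℝ => (√t)⁻¹) T))
  have hPTP : P * T * P = 1 := by
    have hid : T = cfc (fun t : ℝ => t) T := (cfc_id' ℝ T).symm
    rw [hP]
    nth_rw 2 [hid]
    rw [← cfc_mul _ _ T hc (by fun_prop),
      ← cfc_mul (fun t : ℝ => (√t)⁻¹ * t) _ T (hc.mul (by fun_prop)) hc,
      ← cfc_one ℝ T (IsSelfAdjoint.of_nonneg hT0)]
    apply cfc_congr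
    intro t ht
    have := Real.sqrt_pos.2 (hsp t ht)
    have h2 := Real.mul_self_sqrt (hsp t ht).le
    simp only [Pi.one_apply]
    field_simp
    nlinarith
  have hPu : IsUnit P := isUnit_cfc _ _ hc (by cfc_tac) (fun t ht =>
    inv_ne_zero (Real.sqrt_pos.2 (hsp t ht)).ne')
  have h1 : star (y * P) * (y * P) = 1 := by
    rw [star_mul, hPsa, ← hPTP, hT]; noncomm_ring
  refine ⟨P, fun Q hQ => hQ.cfc_real _, h1, ?_⟩
  obtain ⟨w, hw⟩ := hy.mul hPu
  rw [← hw] at h1 ⊢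
  rw [show star (w : M) = ((w⁻¹ : Mˣ) : M) by rw [← mul_one (star (w : M)), ← Units.mul_inv w, ← mul_assoc, h1, one_mul]]
  simp

/-- Pedersen / Rordam -/
lemma aux_pedersen [PartialOrder M] [StarOrderedRing M] (x : M)
    (hx : x ∈ closure {u : M | IsUnit u}) (δ : ℝ) (hδ : 0 < δ) :
    ∃ u k : M, star u * u = 1 ∧ u * star u = 1 ∧
      u * cfc (fun t : ℝ => √(max (t - δ) 0)) (star x * x) = x * k := by
  set h := star x * x with hh
  have h0 : 0 ≤ h := star_mul_self_nonneg x
  set q : ℝ → ℝ := fun t => √(max (t - δ) 0) with hq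
  set m : ℝ → ℝ := fun t => (max t δ)⁻¹ with hm
  have hqc : Continuous q := by fun_prop
  have hmc : Continuous m := by
    apply Continuous.inv₀ (by fun_prop)
    intro t; positivity
  set Q := cfc q h with hQ
  set m' := cfc m h with hm'
  have hQs : star Q = Q := (IsSelfAdjoint.cfc : IsSelfAdjoint (cfc q h))
  have hms : star m' = m' := (IsSelfAdjoint.cfc : IsSelfAdjoint (cfc m h))
  have hQh : Q * h = h * Q := ((Commute.refl h).cfc_real q).eq
  have hmh : m' * h = h * m' := ((Commute.refl h).cfc_real m).eq
  have hQm : Q * m' = m' * Q := cfc_commute_cfc q m h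
  have hQmh : Q * m' * h = Q := by
    have hid : h = cfc (fun t : ℝ => t) h := (cfc_id' ℝ h).symm
    have hid2 : Q * m' * h = cfc q h * cfc m h * cfc (fun t : ℝ => t) h := by rw [← hid]
    rw [hid2, hQ, aux_cfc_mul3 h hqc hmc continuous_id']
    congr 1
    ext t
    simp only [hq, hm]
    rcases le_total t δ with ht | ht
    · rw [max_eq_right (by linarith : t - δ ≤ 0)]; simp
    · rw [max_eq_left ht]
      have : 0 < t := by linarith
      field_simp
  set xp := m' * star x with hxp
  set e := m' * h with he
  -- choose z
  obtain ⟨z, hz, hzx⟩ := Metric.mem_closure_iff.1 hx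
    (min (1 / (‖xp‖ + 1)) (1 / (‖xp + (1 - e) * xp‖ + 1))) (by positivity)
  have hzx1 : ‖z - x‖ < 1 / (‖xp‖ + 1) := by
    rw [← dist_eq_norm, dist_comm]; exact lt_of_lt_of_le hzx (min_le_left _ _)
  have hzx2 : ‖z - x‖ < 1 / (‖xp + (1 - e) * xp‖ + 1) := by
    rw [← dist_eq_norm, dist_comm]; exact lt_of_lt_of_le hzx (min_le_right _ _)
  have small : ∀ w : M, ‖z - x‖ < 1 / (‖w‖ + 1) → ‖(z - x) * w‖ < 1 := by
    intro w hw
    have h1 : 0 ≤ ‖w‖ := norm_nonneg w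
    rw [lt_div_iff₀ (by positivity)] at hw
    have := norm_mul_le (z - x) w
    nlinarith [norm_nonneg (z - x)]
  obtain ⟨S, hS⟩ := aux_unit_add _ (small _ hzx1)
  obtain ⟨S2, hS2⟩ := aux_unit_add _ (small _ hzx2)
  have hSi1 : (↑S⁻¹ : M) * (1 + (z - x) * xp) = 1 := by rw [← hS]; simp
  set Si : M := ↑S⁻¹ with hSi
  have hT : IsUnit (1 + xp * (Si * (z - x) * (1 - e))) := by
    apply aux_unit_swap
    have : 1 + Si * (z - x) * (1 - e) * xp = ↑(S⁻¹ * S2) := by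
      rw [Units.val_mul, hS2, ← hSi]
      calc _ = Si * (1 + (z - x) * xp) + Si * (z - x) * (1 - e) * xp := by rw [hSi1]
        _ = _ := by noncomm_ring
    rw [this]; exact Units.isUnit _
  obtain ⟨T, hT⟩ := hT
  set y1 := Si * z with hy1
  have hxpx : xp * x = e := by rw [hxp, he, hh, mul_assoc]
  have hy1x : y1 - x = Si * (z - x) * (1 - e) := by
    calc y1 - x = Si * z - (Si * (1 + (z - x) * xp)) * x := by rw [hSi1, one_mul]
      _ = Si * (z - x) * (1 - xp * x) := by noncomm_ring
      _ = _ := by rw [hxpx]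
  rw [← hy1x] at hT
  have heQ : e * Q = Q := by
    rw [he, mul_assoc, ← hQh, ← mul_assoc, ← hQm, hQmh]
  have hy1Q : y1 * Q = x * Q := by
    have : (y1 - x) * Q = 0 := by
      rw [hy1x, mul_assoc, sub_mul, heQ]; simp
    rwa [sub_mul, sub_eq_zero] at this
  have hTQ : (↑T⁻¹ : M) * Q = Q := by
    rw [Units.inv_mul_eq_iff_eq_mul, hT, add_mul, mul_assoc, sub_mul, hy1Q]
    simp
  set y := y1 * (↑T⁻¹ : M) with hy
  have hyu : IsUnit y := by
    refine IsUnit.mul (IsUnit.mul (Units.isUnit _) hz) (Units.isUnit _)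
  have hyQ : y * Q = x * Q := by rw [hy, mul_assoc, hTQ, hy1Q]
  set f := x * (Q * m') * star x with hf
  have hfs : star f = f := by
    simp only [hf, star_mul, star_star, hQs, hms, ← hQm]; noncomm_ring
  have hfx : f * x = x * Q := by
    rw [hf, mul_assoc, mul_assoc, ← hh, hQmh]
  have hfxp : f * x * xp = f := by
    rw [hfx, hxp, hf]; noncomm_ring
  have hfy : f * y = f * x := by
    rw [hy, ← mul_assoc, Units.mul_inv_eq_iff_eq_mul, hT]
    calc f * y1 = f * x + f * (y1 - x) := by noncomm_ring
      _ = f * x + f * x * xp * (y1 - x) := by rw [hfxp]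
      _ = _ := by noncomm_ring
  have hyyQ : star y * y * Q = h * Q := by
    calc star y * y * Q = star y * (y * Q) := by rw [mul_assoc]
      _ = star y * (f * x) := by rw [hyQ, hfx]
      _ = star (f * y) * x := by rw [star_mul f y, hfs, mul_assoc (star y)]
      _ = star x * (f * x) := by rw [hfy, star_mul f x, hfs, mul_assoc (star x)]
      _ = h * Q := by rw [hfx, ← mul_assoc]
  have hcomm : Commute (star y * y) Q := by
    have h2 := congrArg star hyyQ
    simp only [star_mul, star_star, hQs] at h2
    have h3 : star h = h := (IsSelfAdjoint.star_mul_self x)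
    rw [h3] at h2
    show _ = _
    rw [hyyQ, h2, hQh]
  obtain ⟨P, hP, hP1, hP2⟩ := aux_polar y hyu
  refine ⟨y * P, Q * P, hP1, hP2, ?_⟩
  rw [mul_assoc, (hP Q hcomm).eq, ← mul_assoc, hyQ, mul_assoc]

end Helpers

section Helpers2
variable {M : Type*} [CStarAlgebra M]

lemma aux_norm_le [PartialOrder M] [StarOrderedRing M] {p r : M}
    (h : star p * p ≤ star r * r) (V : M) : ‖p * V‖ ≤ ‖r * V‖ := by
  have h1 := star_left_conjugate_le_conjugate h V
  have h2 : star (p * V) * (p * V) ≤ star (r * V) * (r * V) := by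
    simpa [mul_assoc] using h1
  have h3 := CStarAlgebra.norm_le_norm_of_nonneg_of_le (star_mul_self_nonneg (p * V)) h2
  rw [CStarRing.norm_star_mul_self, CStarRing.norm_star_mul_self] at h3
  exact (mul_self_le_mul_self_iff (norm_nonneg _) (norm_nonneg _)).2 h3

/-- Douglas-type factorisation: from `C² ≤ x*x` build `x0` in `closure (x M)`, `x0* x0 = C²`. -/
lemma aux_douglas [PartialOrder M] [StarOrderedRing M] (x C : M) (hC : star C = C)
    (hle : C * C ≤ star x * x) :
    ∃ x0 ∈ closure {w : M | ∃ v, w = x * v}, star x0 * x0 = C * C := by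
  set h := star x * x with hh
  have h0 : 0 ≤ h := star_mul_self_nonneg x
  have hid : cfc (fun t : ℝ => t) h = h := cfc_id' ℝ h
  set H := cfc (fun t : ℝ => √t) h with hH
  have hHs : star H = H := (IsSelfAdjoint.cfc : IsSelfAdjoint (cfc (fun t : ℝ => √t) h))
  have hsp : ∀ t ∈ spectrum ℝ h, 0 ≤ t := fun t ht => spectrum_nonneg_of_nonneg h0 ht
  have hHH : H * H = h := by
    rw [hH, aux_cfc_mul h (by fun_prop) (by fun_prop)]
    conv_rhs => rw [← hid]
    exact cfc_congr fun t ht => Real.mul_self_sqrt (hsp t ht)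
  have hxH : ∀ V, ‖x * V‖ ≤ ‖H * V‖ := aux_norm_le (by rw [hHs, hHH])
  have hCH : ∀ V, ‖C * V‖ ≤ ‖H * V‖ := aux_norm_le (by rw [hHs, hHH, hC]; exact hle)
  have key : ∀ K, star K = K → ‖H * K * C‖ ≤ ‖H * K * H‖ := by
    intro K hK
    calc ‖H * K * C‖ = ‖star (H * K * C)‖ := (norm_star _).symm
      _ = ‖C * (K * H)‖ := by rw [star_mul, star_mul, hC, hK, hHs]
      _ ≤ ‖H * (K * H)‖ := hCH _
      _ = _ := by rw [mul_assoc]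
  let D : ℕ → M := fun n => cfc (fun t : ℝ => (max (√t) (1 / ((n : ℝ) + 1)))⁻¹) h
  have hDc : ∀ n : ℕ, Continuous (fun t : ℝ => (max (√t) (1 / ((n : ℝ) + 1)))⁻¹) := by
    intro n
    apply Continuous.inv₀ (by fun_prop)
    intro t; positivity
  have hDs : ∀ n, star (D n) = D n := fun n =>
    (IsSelfAdjoint.cfc : IsSelfAdjoint (cfc (fun t : ℝ => (max (√t) (1 / ((n : ℝ) + 1)))⁻¹) h))
  have hHDH : ∀ n, ‖H * D n * H - H‖ ≤ 1 / ((n : ℝ) + 1) := by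
    intro n
    have hp : 0 < 1 / ((n : ℝ) + 1) := by positivity
    have e1 := hDc n
    simp only [D, hH]
    generalize 1 / ((n : ℝ) + 1) = d at hp e1 ⊢
    have e2 : Continuous (fun t : ℝ => √t * (max (√t) d)⁻¹ * √t) :=
      (Real.continuous_sqrt.mul e1).mul Real.continuous_sqrt
    rw [aux_cfc_mul3 h (by fun_prop) e1 (by fun_prop),
      ← cfc_sub _ _ h e2.continuousOn (by fun_prop)]
    apply norm_cfc_le hp.le
    intro t ht
    have hs := Real.sqrt_nonneg t
    generalize √t = s at hs ⊢
    rcases le_total s d with hsd | hsd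
    · rw [max_eq_right hsd, Real.norm_eq_abs, abs_le]
      have : s * d⁻¹ ≤ 1 := by rw [← div_eq_mul_inv]; exact (div_le_one hp).2 hsd
      have h2 : 0 ≤ s * d⁻¹ := by positivity
      constructor <;> nlinarith
    · rw [max_eq_left hsd]
      have : s ≠ 0 := by linarith
      rw [mul_inv_cancel₀ this]; simp [hp.le]
  let W : ℕ → M := fun n => x * (D n * C)
  have hcau : CauchySeq W := by
    refine cauchySeq_of_le_tendsto_0 (fun N : ℕ => 2 * (1 / ((N : ℝ) + 1))) ?_ ?_
    · intro n k N hn hk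
      rw [dist_eq_norm]
      calc ‖W n - W k‖ = ‖x * ((D n - D k) * C)‖ := by simp only [W]; congr 1; noncomm_ring
        _ ≤ ‖H * ((D n - D k) * C)‖ := hxH _
        _ = ‖H * (D n - D k) * C‖ := by rw [mul_assoc]
        _ ≤ ‖H * (D n - D k) * H‖ := key _ (by rw [star_sub, hDs, hDs])
        _ = ‖(H * D n * H - H) - (H * D k * H - H)‖ := by congr 1; noncomm_ring
        _ ≤ ‖H * D n * H - H‖ + ‖H * D k * H - H‖ := norm_sub_le _ _
        _ ≤ 1 / ((n : ℝ) + 1) + 1 / ((k : ℝ) + 1) := add_le_add (hHDH n) (hHDH k)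
        _ ≤ 1 / ((N : ℝ) + 1) + 1 / ((N : ℝ) + 1) := by gcongr
        _ = _ := by ring
    · simpa using (tendsto_one_div_add_atTop_nhds_zero_nat (𝕜 := ℝ)).const_mul 2
  obtain ⟨x0, hx0⟩ := cauchySeq_tendsto_of_complete hcau
  refine ⟨x0, mem_closure_of_tendsto hx0 (Filter.Eventually.of_forall fun n => ⟨_, rfl⟩), ?_⟩
  have hlim1 : Filter.Tendsto (fun n => star (W n) * W n) Filter.atTop (nhds (star x0 * x0)) :=
    hx0.star.mul hx0
  refine tendsto_nhds_unique hlim1 ?_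
  rw [tendsto_iff_norm_sub_tendsto_zero]
  refine squeeze_zero (fun _ => norm_nonneg _) (g := fun n : ℕ => 1 / ((n : ℝ) + 1)) ?_
    tendsto_one_div_add_atTop_nhds_zero_nat
  intro n
  set G := D n * h * D n - 1 with hG
  have hGs : star G = G := by
    have : star h = h := IsSelfAdjoint.star_mul_self x
    simp only [hG, star_sub, star_mul, hDs, this, star_one, mul_assoc]
  have e1 : star (W n) * W n - C * C = C * (G * C) := by
    simp only [W, hG, star_mul, hDs, hC, hh]
    noncomm_ring
  rw [e1]
  refine ((hCH _).trans (mul_assoc H G C ▸ key G hGs)).trans ?_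
  have hG' : H * G * H = cfc (fun t : ℝ => √t * ((max (√t) (1 / ((n : ℝ) + 1)))⁻¹ * t *
      (max (√t) (1 / ((n : ℝ) + 1)))⁻¹ - 1) * √t) h := by
    have c1 := hDc n
    have c2 : Continuous (fun t : ℝ => (max (√t) (1 / ((n : ℝ) + 1)))⁻¹ * t *
      (max (√t) (1 / ((n : ℝ) + 1)))⁻¹) := (c1.mul continuous_id').mul c1
    have hGc : G = cfc (fun t : ℝ => ((max (√t) (1 / ((n : ℝ) + 1)))⁻¹ * t *
      (max (√t) (1 / ((n : ℝ) + 1)))⁻¹ - 1)) h := by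
      rw [cfc_sub _ _ h c2.continuousOn (by fun_prop), ← aux_cfc_mul3 h c1 continuous_id' c1, hid, cfc_const_one ℝ h]
    have c3 : Continuous (fun t : ℝ => (max (√t) (1 / ((n : ℝ) + 1)))⁻¹ * t *
      (max (√t) (1 / ((n : ℝ) + 1)))⁻¹ - 1) := c2.sub continuous_const
    rw [hGc, hH, aux_cfc_mul3 h (by fun_prop) c3 (by fun_prop)]
  rw [hG']
  have hp : 0 < 1 / ((n : ℝ) + 1) := by positivity
  have hp1 : 1 / ((n : ℝ) + 1) ≤ 1 := by
    rw [div_le_one (by positivity)]; linarith [Nat.cast_nonneg (α := ℝ) n]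
  generalize 1 / ((n : ℝ) + 1) = d at hp hp1 ⊢
  apply norm_cfc_le hp.le
  intro t ht
  have hs := Real.sqrt_nonneg t
  have hst := Real.mul_self_sqrt (hsp t ht)
  rw [← hst, Real.sqrt_mul_self hs]
  generalize √t = s at hs ⊢
  rcases le_total s d with hsd | hsd
  · rw [max_eq_right hsd, Real.norm_eq_abs, abs_le]
    have h1 : s * d⁻¹ ≤ 1 := by rw [← div_eq_mul_inv]; exact (div_le_one hp).2 hsd
    have h2 : 0 ≤ s * d⁻¹ := by positivity
    have h3 : s * (d⁻¹ * (s * s) * d⁻¹ - 1) * s = - ((s * s) * (1 - (s * d⁻¹) * (s * d⁻¹))) := by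
      ring
    have h4 : 0 ≤ 1 - (s * d⁻¹) * (s * d⁻¹) := by nlinarith
    have h5 : s * s ≤ d := by nlinarith
    have h6 : 0 ≤ (s * s) * (1 - (s * d⁻¹) * (s * d⁻¹)) := by positivity
    have h7 : (s * s) * (1 - (s * d⁻¹) * (s * d⁻¹)) ≤ d * 1 := by
      apply mul_le_mul h5 _ h4 hp.le
      nlinarith
    rw [h3]
    constructor <;> linarith
  · rw [max_eq_left hsd]
    have : s ≠ 0 := by linarith
    rw [show s⁻¹ * (s * s) * s⁻¹ = 1 by field_simp]; simp [hp.le]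

lemma aux_KR [PartialOrder M] [StarOrderedRing M] (x a : M) (ha : 0 ≤ a) (η : ℝ) (hη : 0 < η)
    (hxa : ‖star x * x - a‖ ≤ η) :
    ∃ x0 ∈ closure {w : M | ∃ v, w = x * v},
      star x0 * x0 = cfc (fun t : ℝ => max (t - 2 * η) 0) a := by
  have hid : cfc (fun t : ℝ => t) a = a := cfc_id' ℝ a
  have hs : a - algebraMap ℝ M η ≤ star x * x := by
    have hsa : IsSelfAdjoint (star x * x - a) :=
      (IsSelfAdjoint.star_mul_self x).sub (IsSelfAdjoint.of_nonneg ha)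
    have h1 := hsa.neg_algebraMap_norm_le_self
    have h2 : algebraMap ℝ M ‖star x * x - a‖ ≤ algebraMap ℝ M η := by
      exact algebraMap_mono M hxa
    have h3 := (neg_le_neg h2).trans h1
    rw [sub_le_iff_le_add, ← sub_le_iff_le_add'] 
    rw [neg_le_iff_add_nonneg] at h3
    rw [← sub_nonneg]
    convert h3 using 1
    abel
  set C := cfc (fun t : ℝ => √(max (t - 2 * η) 0)) a with hC
  have hCs : star C = C :=
    (IsSelfAdjoint.cfc : IsSelfAdjoint (cfc (fun t : ℝ => √(max (t - 2 * η) 0)) a))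
  have hCC : C * C = cfc (fun t : ℝ => max (t - 2 * η) 0) a := by
    rw [hC, aux_cfc_mul a (by fun_prop) (by fun_prop)]
    congr 1; ext t
    exact Real.mul_self_sqrt (le_max_right _ _)
  let f : ℝ → ℝ := fun t => √(max (t - 2 * η) 0 * (max (t - η) η)⁻¹)
  have hf : Continuous f := by
    apply Continuous.sqrt
    apply Continuous.mul (by fun_prop)
    apply Continuous.inv₀ (by fun_prop)
    intro t
    have : 0 < max (t - η) η := lt_max_of_lt_right hη
    exact this.ne'
  set E := cfc f a with hE
  have hEs : star E = E := (IsSelfAdjoint.cfc : IsSelfAdjoint (cfc f a))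
  have hEaE : E * (a - algebraMap ℝ M η) * E = C * C := by
    have : a - algebraMap ℝ M η = cfc (fun t : ℝ => t - η) a := by
      rw [cfc_sub _ _ a, hid, cfc_const η a]
    rw [hCC, this, hE, aux_cfc_mul3 a hf (by fun_prop) hf]
    congr 1; ext t
    have h0 : 0 ≤ max (t - 2 * η) 0 * (max (t - η) η)⁻¹ := by positivity
    have h1 : f t * f t = max (t - 2 * η) 0 * (max (t - η) η)⁻¹ := Real.mul_self_sqrt h0
    rw [mul_right_comm, h1]
    rcases le_total t (2 * η) with ht | ht
    · rw [max_eq_right (by linarith)]; simp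
    · rw [max_eq_left (by linarith : η ≤ t - η)]
      have : t - η ≠ 0 := by linarith
      field_simp
  have hle : C * C ≤ star (x * E) * (x * E) := by
    have := star_left_conjugate_le_conjugate hs E
    rw [hEs, hEaE] at this
    simpa [mul_assoc, hEs] using this
  obtain ⟨x0, hx0, h⟩ := aux_douglas (x * E) C hCs hle
  refine ⟨x0, closure_mono ?_ hx0, h.trans hCC⟩
  rintro w ⟨v, rfl⟩
  exact ⟨E * v, by rw [mul_assoc]⟩

/-- the easy direction, approximation form -/
lemma aux_back [PartialOrder M] [StarOrderedRing M] (b q u Y : M) (hb : 0 ≤ b)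
    (hq : star q = q) (hu : star u * u = 1) (γ : ℝ) (hγ : 0 < γ)
    (hY : ‖u * (q * q) * star u - b * Y * b‖ < γ) :
    ∃ g : M, ‖(q * (star u * g)) * b * star (q * (star u * g)) - q * q‖ < γ := by
  set c := u * (q * q) * star u with hc
  obtain ⟨δ, hδ, hδY⟩ : ∃ δ > 0, ‖c - b * Y * b‖ + δ * ‖Y * b‖ < γ := by
    refine ⟨(γ - ‖c - b * Y * b‖) / (‖Y * b‖ + 1), div_pos (by linarith) (by positivity), ?_⟩
    have h1 : 0 < ‖Y * b‖ + 1 := by positivity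
    have : (γ - ‖c - b * Y * b‖) / (‖Y * b‖ + 1) * ‖Y * b‖ < γ - ‖c - b * Y * b‖ := by
      rw [div_mul_eq_mul_div, div_lt_iff₀ h1]
      nlinarith
    linarith
  have hid : cfc (fun t : ℝ => t) b = b := cfc_id' ℝ b
  let m : ℝ → ℝ := fun t => (max t δ)⁻¹
  have hm : Continuous m := by
    apply Continuous.inv₀ (by fun_prop)
    intro t; positivity
  have hm0 : ∀ t, 0 ≤ m t := fun t => by simp only [m]; positivity
  have htm : ∀ t, t * m t ≤ 1 := by
    intro t
    simp only [m]
    rw [← div_eq_mul_inv]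
    exact (div_le_one (by positivity)).2 (le_max_left _ _)
  set g := cfc (fun t : ℝ => √(m t)) b with hg
  set d := cfc (fun t : ℝ => √(1 - t * m t)) b with hd
  have hgs : star g = g := (IsSelfAdjoint.cfc : IsSelfAdjoint (cfc (fun t : ℝ => √(m t)) b))
  have hds : star d = d :=
    (IsSelfAdjoint.cfc : IsSelfAdjoint (cfc (fun t : ℝ => √(1 - t * m t)) b))
  have hdc : Continuous (fun t : ℝ => √(1 - t * m t)) := by fun_prop
  have hsp : ∀ t ∈ spectrum ℝ b, 0 ≤ t := fun t ht => spectrum_nonneg_of_nonneg hb ht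
  have hgbg : g * b * g = 1 - d * d := by
    have e1 : g * b * g = cfc (fun t : ℝ => t * m t) b := by
      have e2 : g * b * g = cfc (fun t : ℝ => √(m t)) b * cfc (fun t : ℝ => t) b *
          cfc (fun t : ℝ => √(m t)) b := by rw [hid]
      rw [e2, aux_cfc_mul b (by fun_prop) (by fun_prop), aux_cfc_mul b (by fun_prop) (by fun_prop)]
      congr 1; ext t
      rw [mul_right_comm, Real.mul_self_sqrt (hm0 t), mul_comm]
    have e3 : Continuous (fun t : ℝ => √(1 - t * m t) * √(1 - t * m t)) := hdc.mul hdc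
    rw [e1, hd, aux_cfc_mul b hdc hdc, ← cfc_const_one ℝ b,
      ← cfc_sub (fun _ => (1 : ℝ)) _ b (by fun_prop) e3.continuousOn]
    congr 1; ext t
    rw [Real.mul_self_sqrt (by linarith [htm t])]; ring
  have hd1 : ‖d‖ ≤ 1 := by
    apply norm_cfc_le zero_le_one
    intro t ht
    rw [Real.norm_eq_abs, abs_of_nonneg (Real.sqrt_nonneg _)]
    apply Real.sqrt_le_one.2
    linarith [mul_nonneg (hsp t ht) (hm0 t)]
  have hdb : ‖d * b‖ ≤ δ := by
    have : d * b = cfc (fun t : ℝ => √(1 - t * m t) * t) b := by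
      rw [← aux_cfc_mul b hdc continuous_id', hid]
    rw [this]
    apply norm_cfc_le hδ.le
    intro t ht
    have h0 := hsp t ht
    rcases le_total t δ with h | h
    · have h1 : √(1 - t * m t) ≤ 1 := by
        apply Real.sqrt_le_one.2; linarith [mul_nonneg (hsp t ht) (hm0 t)]
      rw [Real.norm_eq_abs, abs_of_nonneg (by positivity)]
      nlinarith
    · have : t * m t = 1 := by
        simp only [m]; rw [max_eq_left h]; exact mul_inv_cancel₀ (by linarith)
      rw [this]; simp [hδ.le]
  refine ⟨g, ?_⟩
  have e : (q * (star u * g)) * b * star (q * (star u * g)) - q * q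
      = - (star (d * (u * q)) * (d * (u * q))) := by
    calc _ = q * star u * (g * b * g) * u * q - q * q := by
          simp only [star_mul, star_star, hgs, hq]; noncomm_ring
      _ = q * (star u * u) * q - q * q - q * star u * (d * d) * u * q := by
          rw [hgbg]; noncomm_ring
      _ = _ := by
          rw [hu]; simp only [star_mul, hds, hq]; noncomm_ring
  rw [e, norm_neg, CStarRing.norm_star_mul_self, ← CStarRing.norm_self_mul_star]
  have e2 : d * (u * q) * star (d * (u * q)) = d * c * d := by
    simp only [star_mul, hds, hq, hc]; noncomm_ring
  rw [e2]
  calc ‖d * c * d‖ ≤ ‖d * c‖ * ‖d‖ := norm_mul_le _ _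
    _ ≤ ‖d * c‖ * 1 := by gcongr
    _ = ‖d * (c - b * Y * b) + (d * b) * (Y * b)‖ := by rw [mul_one]; congr 1; noncomm_ring
    _ ≤ ‖d‖ * ‖c - b * Y * b‖ + ‖d * b‖ * ‖Y * b‖ :=
        (norm_add_le _ _).trans (add_le_add (norm_mul_le _ _) (norm_mul_le _ _))
    _ ≤ 1 * ‖c - b * Y * b‖ + δ * ‖Y * b‖ := by gcongr
    _ < γ := by rw [one_mul]; exact hδY

end Helpers2

lemma aux_approx {M : Type*} [CStarAlgebra M] [PartialOrder M] [StarOrderedRing M]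
    (b r : M) (hb : 0 ≤ b) (γ : ℝ) (hγ : 0 < γ) :
    ∃ g : M, ‖star (b * (g * star r)) * (b * (g * star r)) - r * b * star r‖ < γ := by
  obtain ⟨δ, hδ, hδr⟩ : ∃ δ > 0, ‖r‖ * δ * ‖r‖ < γ := by
    refine ⟨γ / (‖r‖ * ‖r‖ + 1), by positivity, ?_⟩
    rw [mul_right_comm, mul_div_assoc', div_lt_iff₀ (by positivity)]
    nlinarith [norm_nonneg r]
  have hid : cfc (fun t : ℝ => t) b = b := cfc_id' ℝ b
  let m : ℝ → ℝ := fun t => (max t δ)⁻¹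
  have hm : Continuous m := by
    apply Continuous.inv₀ (by fun_prop)
    intro t; positivity
  have hm0 : ∀ t, 0 ≤ m t := fun t => by simp only [m]; positivity
  set g := cfc (fun t : ℝ => √(m t)) b with hg
  have hgs : star g = g := (IsSelfAdjoint.cfc : IsSelfAdjoint (cfc (fun t : ℝ => √(m t)) b))
  have hbs : star b = b := IsSelfAdjoint.of_nonneg hb
  have hgg : g * g = cfc m b := by
    rw [hg, aux_cfc_mul b (by fun_prop) (by fun_prop)]
    congr 1; ext t
    exact Real.mul_self_sqrt (hm0 t)
  have hgb : g * b = b * g := by rw [hg]; exact ((Commute.refl b).cfc_real _).eq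
  have hn : ‖b * (g * g) * b - b‖ ≤ δ := by
    have hc : Continuous (fun t : ℝ => t * m t * t) := by fun_prop
    have : b * (g * g) * b - b = cfc (fun t : ℝ => t * m t * t - t) b := by
      rw [cfc_sub _ _ b hc.continuousOn (by fun_prop), ← aux_cfc_mul3 b continuous_id' hm
        continuous_id', hid, hgg]
    rw [this]
    apply norm_cfc_le hδ.le
    intro t ht
    have h0 : 0 ≤ t := spectrum_nonneg_of_nonneg hb ht
    have h1 := hm0 t
    rcases le_total t δ with h | h
    · have h2 : t * m t ≤ 1 := by
        simp only [m]
        rw [← div_eq_mul_inv]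
        exact (div_le_one (by positivity)).2 (le_max_left _ _)
      have h3 : 0 ≤ t * m t := by positivity
      rw [Real.norm_eq_abs, abs_le]
      constructor <;> nlinarith
    · have : t * m t = 1 := by
        simp only [m]; rw [max_eq_left h]; exact mul_inv_cancel₀ (by linarith)
      rw [this]; simp [hδ.le]
  refine ⟨g, ?_⟩
  have e : star (b * (g * star r)) * (b * (g * star r)) - r * b * star r
      = r * (b * (g * g) * b - b) * star r := by
    calc _ = r * ((g * b) * (b * g)) * star r - r * b * star r := by
          simp only [star_mul, star_star, hgs, hbs]; noncomm_ring
      _ = r * ((b * g) * (g * b)) * star r - r * b * star r := by rw [hgb]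
      _ = _ := by noncomm_ring
  rw [e]
  calc _ ≤ ‖r‖ * ‖b * (g * g) * b - b‖ * ‖star r‖ :=
        (norm_mul_le _ _).trans (by gcongr; exact norm_mul_le _ _)
    _ ≤ ‖r‖ * δ * ‖r‖ := by rw [norm_star]; gcongr
    _ < γ := hδr

lemma aux_ideal {A : Type*} [NonUnitalCStarAlgebra A] (p : A) (w : Unitization ℂ A) :
    ∃ p' : A, (p : Unitization ℂ A) * w = (p' : Unitization ℂ A) := by
  refine ⟨((p : Unitization ℂ A) * w).snd, ?_⟩
  ext <;> simp

lemma aux_ideal' {A : Type*} [NonUnitalCStarAlgebra A] (p : A) (w : Unitization ℂ A) :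
    ∃ p' : A, w * (p : Unitization ℂ A) = (p' : Unitization ℂ A) := by
  refine ⟨(w * (p : Unitization ℂ A)).snd, ?_⟩
  ext <;> simp

lemma aux_cutDown {A : Type*} [NonUnitalCStarAlgebra A] (a : A) (ε : ℝ) (hε : 0 < ε) :
    (cutDown a ε : Unitization ℂ A) = cfc (fun t : ℝ => max (t - ε) 0) (a : Unitization ℂ A) :=
  cfcₙ_eq_cfc (f := fun t : ℝ => max (t - ε) 0) (by fun_prop) (by simp [hε.le])

theorem cuntzLE_iff_unitary_of_weakStableRankOne {A : Type*} [NonUnitalCStarAlgebra A]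
    [PartialOrder A] [StarOrderedRing A]
    (hA : ∀ x : A, (x : Unitization ℂ A) ∈ closure {u : Unitization ℂ A | IsUnit u})
    (a b : A) (ha : 0 ≤ a) (hb : 0 ≤ b) :
    CuntzLE a b ↔
      ∀ ε > 0, ∃ u : Unitization ℂ A, star u * u = 1 ∧ u * star u = 1 ∧
        u * (cutDown a ε : Unitization ℂ A) * star u ∈
          closure {w : Unitization ℂ A | ∃ y : A, w = ((b * y * b : A) : Unitization ℂ A)} := by
  have ha' : (0 : Unitization ℂ A) ≤ (a : Unitization ℂ A) := Unitization.inr_nonneg_iff.2 ha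
  have hb' : (0 : Unitization ℂ A) ≤ (b : Unitization ℂ A) := Unitization.inr_nonneg_iff.2 hb
  have hbs : star b = b := IsSelfAdjoint.of_nonneg hb
  constructor
  · intro h ε hε
    obtain ⟨r, hr⟩ := h (ε / 8) (by positivity)
    obtain ⟨g, hg⟩ := aux_approx (b : Unitization ℂ A) (r : Unitization ℂ A) hb' (ε / 8)
      (by positivity)
    obtain ⟨p, hp⟩ := aux_ideal' (star r) g
    rw [← Unitization.inr_star, hp, ← Unitization.inr_mul] at hg
    have hxa : ‖star ((b * p : A) : Unitization ℂ A) * ((b * p : A) : Unitization ℂ A)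
        - (a : Unitization ℂ A)‖ ≤ ε / 4 := by
      have h1 : ‖(r : Unitization ℂ A) * (b : Unitization ℂ A) * ((star r : A) : Unitization ℂ A)
          - (a : Unitization ℂ A)‖ < ε / 8 := by
        rw [← Unitization.inr_mul, ← Unitization.inr_mul, ← Unitization.inr_sub,
          Unitization.norm_inr]
        exact hr
      have := norm_add_le_of_le hg.le h1.le
      rw [sub_add_sub_cancel] at this
      linarith
    obtain ⟨x0, hx0, hx0a⟩ := aux_KR _ _ ha' (ε / 4) (by positivity) hxa
    have hx0b : x0 ∈ closure {w : Unitization ℂ A | ∃ y : A, w = ((b * y : A) : Unitization ℂ A)} := by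
      refine closure_mono ?_ hx0
      rintro w ⟨v, rfl⟩
      obtain ⟨p', hp'⟩ := aux_ideal p v
      exact ⟨p', by rw [Unitization.inr_mul, mul_assoc, hp', Unitization.inr_mul]⟩
    have hx0u : x0 ∈ closure {u : Unitization ℂ A | IsUnit u} := by
      refine closure_minimal ?_ isClosed_closure hx0b
      rintro w ⟨y, rfl⟩
      exact hA _
    obtain ⟨u, k, hu1, hu2, huk⟩ := aux_pedersen x0 hx0u (ε / 2) (by positivity)
    refine ⟨u, hu1, hu2, ?_⟩
    set Q := cfc (fun t : ℝ => √(max (t - ε / 2) 0)) (star x0 * x0) with hQ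
    have hQs : star Q = Q := (IsSelfAdjoint.cfc :
      IsSelfAdjoint (cfc (fun t : ℝ => √(max (t - ε / 2) 0)) (star x0 * x0)))
    have hQQ : (cutDown a ε : Unitization ℂ A) = Q * Q := by
      rw [aux_cutDown a ε hε, hQ, aux_cfc_mul _ (by fun_prop) (by fun_prop), hx0a,
        ← cfc_comp (fun t : ℝ => √(max (t - ε / 2) 0) * √(max (t - ε / 2) 0))
          (fun t : ℝ => max (t - 2 * (ε / 4)) 0) (a : Unitization ℂ A)
          (IsSelfAdjoint.of_nonneg ha') (by fun_prop) (by fun_prop)]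
      congr 1; ext t
      simp only [Function.comp]
      rw [Real.mul_self_sqrt (le_max_right _ _)]
      rcases le_total t (ε / 2) with ht | ht
      · rw [max_eq_right (by linarith : t - ε ≤ 0),
          max_eq_right (by linarith : t - 2 * (ε / 4) ≤ 0),
          max_eq_right (by linarith : 0 - ε / 2 ≤ 0)]
      · rw [max_eq_left (by linarith : 0 ≤ t - 2 * (ε / 4))]
        congr 1; ring
    have e : u * (cutDown a ε : Unitization ℂ A) * star u = x0 * (k * star k) * star x0 := by
      calc _ = (u * Q) * star (u * Q) := by rw [hQQ, star_mul, hQs]; noncomm_ring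
        _ = _ := by rw [huk, star_mul]; noncomm_ring
    rw [e]
    refine map_mem_closure (f := fun x => x * (k * star k) * star x) (by fun_prop) hx0b ?_
    rintro w ⟨y, rfl⟩
    obtain ⟨p1, hp1⟩ := aux_ideal y (k * star k)
    refine ⟨p1 * star y, ?_⟩
    simp only [← Unitization.inr_star, star_mul, hbs]
    rw [Unitization.inr_mul, mul_assoc (b : Unitization ℂ A), hp1]
    simp only [Unitization.inr_mul, mul_assoc]
  · intro h γ hγ
    obtain ⟨u, hu1, hu2, hu⟩ := h (γ / 2) (by positivity)
    have hq0 : (fun t : ℝ => √(max (t - γ / 2) 0)) 0 = 0 := by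
      have : max (0 - γ / 2) 0 = 0 := max_eq_right (by linarith)
      simp only [this, Real.sqrt_zero]
    set q := cfcₙ (fun t : ℝ => √(max (t - γ / 2) 0)) a with hq
    have hqc : (q : Unitization ℂ A) = cfc (fun t : ℝ => √(max (t - γ / 2) 0))
        (a : Unitization ℂ A) := Unitization.real_cfcₙ_eq_cfc_inr a _ hq0
    have hqs : star (q : Unitization ℂ A) = q := by
      rw [hqc]
      exact (IsSelfAdjoint.cfc : IsSelfAdjoint (cfc (fun t : ℝ => √(max (t - γ / 2) 0))
        (a : Unitization ℂ A)))
    have hqq : (cutDown a (γ / 2) : Unitization ℂ A) = q * q := by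
      rw [aux_cutDown a _ (by positivity), hqc, aux_cfc_mul _ (by fun_prop) (by fun_prop)]
      congr 1; ext t
      exact (Real.mul_self_sqrt (le_max_right _ _)).symm
    have hqa : ‖(q : Unitization ℂ A) * q - a‖ ≤ γ / 2 := by
      have hid : cfc (fun t : ℝ => t) (a : Unitization ℂ A) = a :=
        cfc_id' ℝ _ (IsSelfAdjoint.of_nonneg ha')
      have : (q : Unitization ℂ A) * q - a =
          cfc (fun t : ℝ => max (t - γ / 2) 0 - t) (a : Unitization ℂ A) := by
        rw [cfc_sub _ _ _ (by fun_prop) (by fun_prop), hid, ← hqq,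
          aux_cutDown a _ (by positivity)]
      rw [this]
      apply norm_cfc_le (by positivity)
      intro t ht
      have h0 : 0 ≤ t := spectrum_nonneg_of_nonneg ha' ht
      rw [Real.norm_eq_abs, abs_le]
      rcases le_total t (γ / 2) with ht | ht
      · rw [max_eq_right (by linarith)]
        constructor <;> linarith
      · rw [max_eq_left (by linarith)]
        constructor <;> linarith
    rw [hqq] at hu
    obtain ⟨w, ⟨y, rfl⟩, hw⟩ := Metric.mem_closure_iff.1 hu (γ / 2) (by positivity)
    rw [dist_eq_norm, Unitization.inr_mul, Unitization.inr_mul] at hw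
    obtain ⟨g, hg⟩ := aux_back (b : Unitization ℂ A) q u y hb' hqs hu1 (γ / 2) (by positivity) hw
    obtain ⟨r, hr⟩ := aux_ideal q (star u * g)
    refine ⟨r, ?_⟩
    rw [hr] at hg
    have h2 := norm_add_le ((r : Unitization ℂ A) * b * star (r : Unitization ℂ A) - q * q)
      ((q : Unitization ℂ A) * q - a)
    rw [sub_add_sub_cancel, ← Unitization.inr_star, ← Unitization.inr_mul, ← Unitization.inr_mul,
      ← Unitization.inr_sub, Unitization.norm_inr] at h2
    rw [← Unitization.inr_star, ← Unitization.inr_mul, ← Unitization.inr_mul] at hg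
    linarith
end

section
/- Let A be a C*-algebra and let (aₙ) be a nondecreasing sequence of positive elements of A (aₙ ≤ aₙ₊₁ for all n) converging in norm to a ∈ A. Then [a] is the supremum of the classes [aₙ] in the Cuntz preorder: aₙ ≾ a for every n, and for every positive b ∈ A, if aₙ ≾ b for all n, then a ≾ b. -/
theorem key_norm {A : Type*} [NonUnitalCStarAlgebra A] [PartialOrder A]
    [StarOrderedRing A] (y : A) (hy : 0 ≤ y) (δ : ℝ) (hδ : 0 < δ) :
    ∃ q e : A, IsSelfAdjoint q ∧ IsSelfAdjoint e ∧ q * y * q = e * e ∧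
      ‖y - y * e - (e * y - e * y * e)‖ ≤ δ := by
  have hsa : IsSelfAdjoint y := .of_nonneg hy
  have hne : ∀ t : ℝ, |t| + δ ≠ 0 := fun t => by positivity
  have hf : Continuous (fun t : ℝ => √t / (|t| + δ)) := by fun_prop (disch := exact hne _)
  have hh : Continuous (fun t : ℝ => t / (|t| + δ)) := by fun_prop (disch := exact hne _)
  have hid : cfcₙ (fun t : ℝ => t) y = y := cfcₙ_id' ℝ y
  have hpos : ∀ t ∈ quasispectrum ℝ y, 0 ≤ t := fun t ht => quasispectrum_nonneg_of_nonneg y hy t ht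
  refine ⟨cfcₙ (fun t : ℝ => √t / (|t| + δ)) y, cfcₙ (fun t : ℝ => t / (|t| + δ)) y,
    cfcₙ_predicate _ _, cfcₙ_predicate _ _, ?_, ?_⟩
  · conv_lhs => enter [1, 2]; rw [← hid]
    rw [← cfcₙ_mul _ _ y (by first | fun_prop | fun_prop (disch := intros; exact hne _)) (by simp) (by first | fun_prop | fun_prop (disch := intros; exact hne _)) (by simp),
      ← cfcₙ_mul _ _ y (by first | fun_prop | fun_prop (disch := intros; exact hne _)) (by simp) (by first | fun_prop | fun_prop (disch := intros; exact hne _)) (by simp),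
      ← cfcₙ_mul _ _ y (by first | fun_prop | fun_prop (disch := intros; exact hne _)) (by simp) (by first | fun_prop | fun_prop (disch := intros; exact hne _)) (by simp)]
    refine cfcₙ_congr fun t ht => ?_
    have h1 := Real.mul_self_sqrt (hpos t ht)
    have := hne t
    field_simp
    rw [Real.sq_sqrt (hpos t ht)]
    try ring
  · have : y - y * cfcₙ (fun t : ℝ => t / (|t| + δ)) y - (cfcₙ (fun t : ℝ => t / (|t| + δ)) y * y
        - cfcₙ (fun t : ℝ => t / (|t| + δ)) y * y * cfcₙ (fun t : ℝ => t / (|t| + δ)) y)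
        = cfcₙ (fun t : ℝ => t - t * (t / (|t| + δ)) - ((t / (|t| + δ)) * t
          - (t / (|t| + δ)) * t * (t / (|t| + δ)))) y := by
      rw [cfcₙ_sub _ _ y (by first | fun_prop | fun_prop (disch := intros; exact hne _)) (by simp) (by first | fun_prop | fun_prop (disch := intros; exact hne _)) (by simp),
        cfcₙ_sub _ _ y (by first | fun_prop | fun_prop (disch := intros; exact hne _)) (by simp) (by first | fun_prop | fun_prop (disch := intros; exact hne _)) (by simp),
        cfcₙ_sub _ _ y (by first | fun_prop | fun_prop (disch := intros; exact hne _)) (by simp) (by first | fun_prop | fun_prop (disch := intros; exact hne _)) (by simp),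
        cfcₙ_mul _ _ y (by first | fun_prop | fun_prop (disch := intros; exact hne _)) (by simp) (by first | fun_prop | fun_prop (disch := intros; exact hne _)) (by simp),
        cfcₙ_mul _ _ y (by first | fun_prop | fun_prop (disch := intros; exact hne _)) (by simp) (by first | fun_prop | fun_prop (disch := intros; exact hne _)) (by simp),
        cfcₙ_mul _ _ y (by first | fun_prop | fun_prop (disch := intros; exact hne _)) (by simp) (by first | fun_prop | fun_prop (disch := intros; exact hne _)) (by simp),
        cfcₙ_mul _ _ y (by first | fun_prop | fun_prop (disch := intros; exact hne _)) (by simp) (by first | fun_prop | fun_prop (disch := intros; exact hne _)) (by simp), hid]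
    rw [this]
    refine norm_cfcₙ_le fun t ht => ?_
    have h0 := hpos t ht
    rw [abs_of_nonneg h0]
    have e1 : t - t * (t / (t + δ)) - ((t / (t + δ)) * t
          - (t / (t + δ)) * t * (t / (t + δ))) = t * δ ^ 2 / (t + δ) ^ 2 := by
      field_simp
      ring
    rw [e1, Real.norm_of_nonneg (by positivity), div_le_iff₀ (by positivity)]
    nlinarith [mul_nonneg h0 hδ.le, mul_nonneg (mul_nonneg h0 hδ.le) hδ.le,
      mul_nonneg (mul_nonneg h0 h0) hδ.le, pow_pos hδ 3]

theorem cuntzLE_of_le {A : Type*} [NonUnitalCStarAlgebra A] [PartialOrder A]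
    [StarOrderedRing A] (x y : A) (hx : 0 ≤ x) (hxy : x ≤ y) : CuntzLE x y := by
  intro ε hε
  set s := CFC.sqrt x with hs
  have hss : s * s = x := CFC.sqrt_mul_sqrt_self x hx
  have hsa : star s = s := (IsSelfAdjoint.of_nonneg (CFC.sqrt_nonneg x)).star_eq
  set z := CFC.sqrt (y - x) with hz
  have hzz : z * z = y - x := CFC.sqrt_mul_sqrt_self (y - x) (sub_nonneg.2 hxy)
  have hza : star z = z := (IsSelfAdjoint.of_nonneg (CFC.sqrt_nonneg (y - x))).star_eq
  obtain ⟨η, hη, hηε⟩ : ∃ η : ℝ, 0 < η ∧ 2 * ‖s‖ * η + η ^ 2 < ε := by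
    have hn := norm_nonneg s
    refine ⟨min 1 (ε / (2 * ‖s‖ + 2)), by positivity, ?_⟩
    have h1 := min_le_left 1 (ε / (2 * ‖s‖ + 2))
    have h2 := min_le_right 1 (ε / (2 * ‖s‖ + 2))
    have h3 : 0 < min 1 (ε / (2 * ‖s‖ + 2)) := by positivity
    rw [le_div_iff₀ (by positivity)] at h2
    nlinarith
  obtain ⟨q, e, hq, he, hqe, hn⟩ := key_norm y (hx.trans hxy) (η ^ 2) (by positivity)
  set w := s - s * e with hw
  have hws : star w = s - e * s := by simp [hw, hsa, he.star_eq]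
  have hww : star w * w = x - x * e - (e * x - e * x * e) := by
    rw [hws, hw, ← hss]; noncomm_ring
  have hle : star w * w ≤ y - y * e - (e * y - e * y * e) := by
    have h := star_mul_self_nonneg (z - z * e)
    rw [← sub_nonneg, hww]
    convert h using 1
    have : star (z - z * e) = z - e * z := by simp [hza, he.star_eq]
    rw [this]
    have : (z - e * z) * (z - z * e) = z * z - z * z * e - (e * (z * z) - e * (z * z) * e) := by
      noncomm_ring
    rw [this, hzz]
    noncomm_ring
  have hwn : ‖w‖ ≤ η := by
    have := (CStarAlgebra.norm_le_norm_of_nonneg_of_le (star_mul_self_nonneg w) hle).trans hn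
    rw [CStarRing.norm_star_mul_self] at this
    exact abs_le_of_sq_le_sq' (by nlinarith) hη.le |>.2
  refine ⟨s * q, lt_of_le_of_lt ?_ hηε⟩
  have : s * q * y * star (s * q) - x = w * star w - (w * s + s * star w) := by
    rw [star_mul, hsa, hq.star_eq, hws, hw]
    have : s * q * y * (q * s) = s * (q * y * q) * s := by noncomm_ring
    rw [this, hqe, ← hss]
    noncomm_ring
  rw [this]
  have n1 : ‖w * star w‖ ≤ η ^ 2 := by
    rw [CStarRing.norm_self_mul_star]; nlinarith [norm_nonneg w]
  have n2 : ‖w * s‖ ≤ η * ‖s‖ := (norm_mul_le _ _).trans (by gcongr)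
  have n3 : ‖s * star w‖ ≤ ‖s‖ * η := (norm_mul_le _ _).trans (by rw [norm_star]; gcongr)
  have := norm_sub_le (w * star w) (w * s + s * star w)
  have := norm_add_le (w * s) (s * star w)
  linarith

/-- For a nondecreasing sequence of positive elements converging in norm to `a`, the class of
`a` is the supremum of the classes of the `aₙ` for the Cuntz preorder. -/
theorem cuntz_sup_of_increasing_tendsto {A : Type*} [NonUnitalCStarAlgebra A] [PartialOrder A]
    [StarOrderedRing A] (aseq : ℕ → A) (hpos : ∀ n, 0 ≤ aseq n)
    (hmono : ∀ n, aseq n ≤ aseq (n + 1)) (a : A)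
    (hlim : Filter.Tendsto aseq Filter.atTop (nhds a)) :
    (∀ n, CuntzLE (aseq n) a) ∧
    (∀ b : A, 0 ≤ b → (∀ n, CuntzLE (aseq n) b) → CuntzLE a b) := by
  refine ⟨fun n => cuntzLE_of_le _ _ (hpos n)
    ((monotone_nat_of_le_succ hmono).ge_of_tendsto hlim n), fun b _ h ε hε => ?_⟩
  obtain ⟨n, hn⟩ := ((Metric.tendsto_nhds.1 hlim) (ε / 2) (by positivity)).exists
  obtain ⟨r, hr⟩ := h n (ε / 2) (by positivity)
  rw [dist_eq_norm] at hn
  refine ⟨r, ?_⟩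
  have := norm_add_le (r * b * star r - aseq n) (aseq n - a)
  rw [sub_add_sub_cancel] at this
  linarith
end

section
/- Let X be a compact Hausdorff space and let f, g be positive elements of C(X, ℂ). Then there exists ε > 0 with f ≾ (g − ε)₊ if and only if the closure of the open support {x : f(x) ≠ 0} of f is contained in the open support {x : g(x) ≠ 0} of g. (The condition 'f ≾ (g − ε)₊ for some ε > 0' expresses compact containment [f] ≪ [g] in the Cuntz semigroup of C(X).) -/
open ComplexOrder

/-- The ε-cut-down `(g - ε)₊` of an element of `C(X, ℂ)`: the function
`x ↦ max (re (g x) - ε) 0` (for positive `g` this is `cfcₙ (fun t => max (t - ε) 0) g`). -/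
noncomputable def cutDownC {X : Type*} [TopologicalSpace X] (g : C(X, ℂ)) (ε : ℝ) : C(X, ℂ) :=
  ⟨fun x => ((max ((g x).re - ε) 0 : ℝ) : ℂ),
    Complex.continuous_ofReal.comp <|
      (((Complex.continuous_re.comp g.continuous).sub continuous_const).max continuous_const)⟩

/-- **Compact containment in `Cu(C(X))`.** For positive `f, g ∈ C(X, ℂ)` with `X` compact
Hausdorff: `f ≾ (g - ε)₊` for some `ε > 0` iff the closure of the open support of `f` is
contained in the open support of `g`. -/
theorem compactContainment_iff_closure_support_subset {X : Type*} [TopologicalSpace X]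
    [CompactSpace X] [T2Space X] (f g : C(X, ℂ)) (hf : ∀ x, 0 ≤ f x) (hg : ∀ x, 0 ≤ g x) :
    (∃ ε > 0, CuntzLE f (cutDownC g ε)) ↔
      closure {x : X | f x ≠ 0} ⊆ {x : X | g x ≠ 0} := by
  have hfr : ∀ x, f x = ((f x).re : ℂ) ∧ 0 ≤ (f x).re := fun x => by
    obtain ⟨h1, h2⟩ := Complex.le_def.1 (hf x)
    exact ⟨Complex.ext (by simp) (by simpa using h2.symm), by simpa using h1⟩
  have hgr : ∀ x, g x = ((g x).re : ℂ) ∧ 0 ≤ (g x).re := fun x => by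
    obtain ⟨h1, h2⟩ := Complex.le_def.1 (hg x)
    exact ⟨Complex.ext (by simp) (by simpa using h2.symm), by simpa using h1⟩
  have hgc : Continuous fun x => (g x).re := Complex.continuous_re.comp g.continuous
  have hfc : Continuous fun x => (f x).re := Complex.continuous_re.comp f.continuous
  constructor
  · rintro ⟨ε, hε, h⟩
    have hcl : IsClosed {x : X | ε ≤ (g x).re} := isClosed_le continuous_const hgc
    have hsub : {x : X | f x ≠ 0} ⊆ {x : X | ε ≤ (g x).re} := by
      intro x hx
      by_contra hlt
      simp only [Set.mem_setOf_eq, not_le] at hlt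
      obtain ⟨r, hr⟩ := h ‖f x‖ (norm_pos_iff.2 hx)
      have h1 := ContinuousMap.norm_coe_le_norm (r * cutDownC g ε * star r - f) x
      have h2 : cutDownC g ε x = 0 := by
        have : max ((g x).re - ε) 0 = 0 := max_eq_right (by linarith)
        simp [cutDownC, this]
      have h3 : (r * cutDownC g ε * star r - f) x = - f x := by
        simp [h2]
      rw [h3, norm_neg] at h1
      linarith
    intro x hx hx0
    have h4 : ε ≤ (g x).re := closure_minimal hsub hcl hx
    rw [hx0] at h4
    simp at h4
    linarith
  · intro h
    obtain ⟨m, hm, hmin⟩ := (isClosed_closure (s := {x : X | f x ≠ 0})).isCompact.exists_forall_le'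
      hgc.continuousOn (a := 0) (fun x hx => lt_of_le_of_ne (hgr x).2 (fun h0 => h hx (by
        rw [(hgr x).1, ← h0]; simp)))
    refine ⟨m / 2, by linarith, fun δ hδ => ?_⟩
    have hpos : ∀ x, 0 < max ((g x).re - m / 2) (m / 2) := fun x => lt_max_of_lt_right (by linarith)
    let r : C(X, ℂ) := ⟨fun x => ((Real.sqrt ((f x).re / max ((g x).re - m / 2) (m / 2)) : ℝ) : ℂ),
      Complex.continuous_ofReal.comp (Real.continuous_sqrt.comp
        (hfc.div ((hgc.sub continuous_const).max continuous_const) (fun x => (hpos x).ne')))⟩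
    refine ⟨r, ?_⟩
    have : r * cutDownC g (m / 2) * star r = f := by
      ext x
      have e : (r * cutDownC g (m / 2) * star r) x =
          ((Real.sqrt ((f x).re / max ((g x).re - m / 2) (m / 2)) * max ((g x).re - m / 2) 0 *
            Real.sqrt ((f x).re / max ((g x).re - m / 2) (m / 2)) : ℝ) : ℂ) := by
        simp [r, cutDownC]
      rw [e, (hfr x).1, mul_right_comm, Complex.ofReal_re,
        Real.mul_self_sqrt (div_nonneg (hfr x).2 (hpos x).le)]
      congr 1
      by_cases hx : f x = 0
      · simp [hx]
      · have h5 := hmin x (subset_closure hx)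
        rw [max_eq_left (by linarith : m / 2 ≤ (g x).re - m / 2),
          max_eq_left (by linarith : 0 ≤ (g x).re - m / 2)]
        exact div_mul_cancel₀ _ (by linarith : 0 < (g x).re - m / 2).ne'
    rw [this, sub_self, norm_zero]
    exact hδ
end

section
/- Let A be a C*-algebra of stable rank one, i.e., the invertible elements of Unitization ℂ A are dense, and let a ∈ A be positive such that a ≾ (a − ε)₊ for some ε > 0 (i.e., the class [a] is compact in the Cuntz semigroup). Then there exists a projection p ∈ A (p = star p, p * p = p) with p ∼ a. -/
/-- The ramp function: `0` up to `ε / 2`, `1` from `ε` on. -/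
noncomputable def rampFn (ε t : ℝ) : ℝ := min 1 (max 0 ((t - ε / 2) / (ε / 2)))

theorem rampFn_cont (ε : ℝ) : Continuous (rampFn ε) := by
  unfold rampFn; fun_prop

theorem rampFn_of_le {ε t : ℝ} (hε : 0 < ε) (ht : t ≤ ε / 2) : rampFn ε t = 0 := by
  unfold rampFn
  rw [max_eq_left]
  · simp
  · exact div_nonpos_of_nonpos_of_nonneg (by linarith) (by linarith)

theorem rampFn_of_ge {ε t : ℝ} (hε : 0 < ε) (ht : ε ≤ t) : rampFn ε t = 1 := by
  unfold rampFn
  have : 1 ≤ (t - ε / 2) / (ε / 2) := by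
    rw [le_div_iff₀ (by linarith)]; linarith
  rw [max_eq_right (by linarith), min_eq_left this]

theorem isUnit_of_leftInv {B : Type*} [CStarAlgebra B] (hB : Dense {u : B | IsUnit u})
    (w z : B) (h : w * z = 1) : IsUnit z := by
  obtain ⟨v, hv, hvz⟩ := Metric.dense_iff.1 hB z (1 / (‖w‖ + 1)) (by positivity)
  rw [Metric.mem_ball, dist_eq_norm] at hv
  have hvz : IsUnit v := hvz
  have h1 : IsUnit (w * v) := by
    have : w * v = 1 - w * (z - v) := by rw [mul_sub, h]; abel
    rw [this]
    apply isUnit_one_sub_of_norm_lt_one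
    rw [norm_sub_rev] at hv
    rw [lt_div_iff₀ (by positivity)] at hv
    calc ‖w * (z - v)‖ ≤ ‖w‖ * ‖z - v‖ := norm_mul_le _ _
      _ ≤ ‖z - v‖ * (‖w‖ + 1) := by nlinarith [norm_nonneg w, norm_nonneg (z - v)]
      _ < 1 := hv
  have hw : IsUnit w := by
    obtain ⟨v, rfl⟩ := hvz
    exact (Units.isUnit_mul_units w v).1 h1
  obtain ⟨w, rfl⟩ := hw
  have : z = ↑w⁻¹ := by rw [← Units.inv_mul_cancel_left w z, h, mul_one]
  rw [this]; exact Units.isUnit _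

theorem ramp_idem {B : Type*} [CStarAlgebra B] (hB : Dense {u : B | IsUnit u})
    (α : B) (hα : IsSelfAdjoint α) (hsp : ∀ t ∈ spectrum ℝ α, 0 ≤ t) (ε : ℝ) (hε : 0 < ε)
    (H : ∀ δ > 0, ∃ R : B, ‖R * cfc (fun t : ℝ => max (t - ε) 0) α * star R - α‖ < δ) :
    cfc (fun t : ℝ => rampFn ε t - rampFn ε t * rampFn ε t) α = 0 := by
  have hr : Continuous (rampFn ε) := rampFn_cont ε
  set e : ℝ → ℝ := fun t => min 1 (2 * t / ε) with he
  have hec : Continuous e := by rw [he]; fun_prop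
  set g : ℝ → ℝ := fun t => √(max (t - ε) 0) with hg
  have hgc : Continuous g := by rw [hg]; fun_prop
  set f : ℝ → ℝ := fun t => rampFn ε t - rampFn ε t * rampFn ε t with hf
  have hfc : Continuous f := by rw [hf]; fun_prop
  set q : ℝ → ℝ := fun t => e t * t * e t + (1 - e t) * (1 - e t) with hq
  have hqc : Continuous q := by rw [hq]; fun_prop
  have hqpos : ∀ t ∈ spectrum ℝ α, q t ≠ 0 := by
    intro t ht
    have h0 := hsp t ht
    rcases h0.eq_or_lt with h0 | h0
    · simp [hq, he, ← h0]
    · have : 0 < e t := lt_min one_pos (by positivity)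
      have : 0 < e t * t * e t := by positivity
      have := mul_self_nonneg (1 - e t)
      simp only [hq]; linarith
  have hg0 : ∀ t ≤ ε, g t = 0 := by
    intro t ht
    simp only [hg]; rw [max_eq_right (by linarith)]; simp
  have he1 : ∀ t, ε / 2 ≤ t → e t = 1 := by
    intro t ht
    simp only [he]; apply min_eq_left; rw [le_div_iff₀ hε]; linarith
  set E := cfc e α with hE
  set G := cfc g α with hG
  set F := cfc f α with hF
  have hEs : star E = E := (cfc_predicate e α : IsSelfAdjoint _)
  have hGs : star G = G := (cfc_predicate g α : IsSelfAdjoint _)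
  have hEG : E * G = G := by
    rw [hE, hG, ← cfc_mul e g α hec.continuousOn hgc.continuousOn]
    congr 1; ext t
    rcases le_total t ε with h | h
    · simp [hg0 t h]
    · simp [he1 t (by linarith)]
  have hFG : F * G = 0 := by
    rw [hF, hG, ← cfc_mul f g α hfc.continuousOn hgc.continuousOn, ← cfc_zero (R := ℝ) α]
    congr 1; ext t
    rcases le_total t ε with h | h
    · simp [hg0 t h]
    · simp [hf, rampFn_of_ge hε h]
  have hFE : F * E = F := by
    rw [hF, hE, ← cfc_mul f e α hfc.continuousOn hec.continuousOn]
    congr 1; ext t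
    rcases le_total t (ε / 2) with h | h
    · simp [hf, rampFn_of_le hε h]
    · simp [he1 t h]
  have hGG : G * G = cfc (fun t : ℝ => max (t - ε) 0) α := by
    rw [hG, ← cfc_mul g g α hgc.continuousOn hgc.continuousOn]
    congr 1; ext t
    exact Real.mul_self_sqrt (le_max_right _ _)
  have hQ : cfc q α = E * α * E + (1 - E) * (1 - E) := by
    have h1 : cfc (fun t => 1 - e t) α = 1 - E := by
      rw [cfc_sub (fun _ => 1) e α continuousOn_const hec.continuousOn, cfc_const_one ℝ α]
    have h2 : cfc (fun t => e t * t * e t) α = E * α * E := by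
      rw [cfc_mul (fun t => e t * t) e α (by fun_prop) (by fun_prop),
        cfc_mul e (fun t => t) α (by fun_prop) (by fun_prop), cfc_id' ℝ α]
    rw [hq, cfc_add (a := α) (fun t => e t * t * e t) (fun t => (1 - e t) * (1 - e t))
      (by fun_prop) (by fun_prop), h2,
      cfc_mul (fun t => 1 - e t) (fun t => 1 - e t) α (by fun_prop) (by fun_prop), h1]
  have hqi : ContinuousOn (fun t => (q t)⁻¹) (spectrum ℝ α) :=
    hqc.continuousOn.inv₀ hqpos
  set W := cfc (fun t => (q t)⁻¹) α with hW
  have hWQ : W * cfc q α = 1 := by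
    rw [hW, ← cfc_mul _ q α hqi hqc.continuousOn, ← cfc_const_one ℝ α]
    apply cfc_congr
    intro t ht
    exact inv_mul_cancel₀ (hqpos t ht)
  obtain ⟨R, hR⟩ := H (1 / (‖W‖ * (‖E‖ * ‖E‖) + 1)) (by positivity)
  rw [← hGG, lt_div_iff₀ (by positivity)] at hR
  set D := R * (G * G) * star R - α with hD
  set Y := G * star R * E with hY
  have hYs : star Y = E * R * G := by simp [hY, hEs, hGs, mul_assoc]
  have hEY : (1 - E) * Y = 0 := by
    rw [hY, sub_mul, one_mul, ← mul_assoc, ← mul_assoc, hEG, sub_self]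
  have hYE : star Y * (1 - E) = 0 := by
    have := congrArg star hEY
    simpa [hEs] using this
  set z := Y + (1 - E) with hz
  have hzz : star z * z = cfc q α + E * D * E := by
    have h1 : star z * z = star Y * Y + star Y * (1 - E) + (1 - E) * Y + (1 - E) * (1 - E) := by
      simp only [hz, star_add, star_sub, star_one, hEs]; noncomm_ring
    rw [h1, hEY, hYE, hQ, hYs, hY, hD]; noncomm_ring
  have hu : IsUnit (W * (star z * z)) := by
    have : W * (star z * z) = 1 - (-(W * (E * D * E))) := by
      rw [hzz, mul_add, hWQ]; abel
    rw [this]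
    apply isUnit_one_sub_of_norm_lt_one
    rw [norm_neg]
    calc ‖W * (E * D * E)‖ ≤ ‖W‖ * (‖E‖ * ‖D‖ * ‖E‖) := by
          refine (norm_mul_le _ _).trans ?_
          gcongr
          refine (norm_mul_le _ _).trans ?_
          gcongr
          exact norm_mul_le _ _
      _ ≤ ‖D‖ * (‖W‖ * (‖E‖ * ‖E‖) + 1) := by nlinarith [norm_nonneg D]
      _ < 1 := hR
  obtain ⟨u, hu⟩ := hu
  have hzu : IsUnit z := by
    apply isUnit_of_leftInv hB (↑u⁻¹ * W * star z)
    rw [mul_assoc, mul_assoc, ← hu, Units.inv_mul]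
  have hFz : F * z = 0 := by
    rw [hz, mul_add, mul_sub, hFE, mul_one, sub_self, hY, ← mul_assoc, ← mul_assoc, hFG]
    simp
  exact (hzu.mul_left_eq_zero).1 hFz

/-- In a C*-algebra of stable rank one, every positive element whose Cuntz class is compact
(`a ≾ (a - ε)₊` for some `ε > 0`) is Cuntz equivalent to a projection. -/
theorem exists_projection_cuntzEquiv_of_compact {A : Type*} [NonUnitalCStarAlgebra A]
    [PartialOrder A] [StarOrderedRing A] (hA : Dense {u : Unitization ℂ A | IsUnit u})
    (a : A) (ha : 0 ≤ a) (hcpt : ∃ ε > 0, CuntzLE a (cutDown a ε)) :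
    ∃ p : A, star p = p ∧ p * p = p ∧ CuntzEquiv p a := by
  obtain ⟨ε, hε, hc⟩ := hcpt
  have hsa : IsSelfAdjoint a := IsSelfAdjoint.of_nonneg ha
  have hb0 : max ((0 : ℝ) - ε) 0 = 0 := max_eq_right (by linarith)
  have hr : Continuous (rampFn ε) := rampFn_cont ε
  have hr0 : rampFn ε 0 = 0 := rampFn_of_le hε (by linarith)
  have key : cfcₙ (fun t : ℝ => rampFn ε t - rampFn ε t * rampFn ε t) a = 0 := by
    apply Unitization.inr_injective (R := ℂ)
    rw [Unitization.real_cfcₙ_eq_cfc_inr a _ (by simp [hr0]), Unitization.inr_zero]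
    apply ramp_idem hA _ (Unitization.isSelfAdjoint_inr.2 hsa) _ ε hε
    · intro δ hδ
      obtain ⟨r, hr⟩ := hc δ hδ
      refine ⟨(r : Unitization ℂ A), ?_⟩
      rw [← Unitization.real_cfcₙ_eq_cfc_inr a (fun t : ℝ => max (t - ε) 0) hb0, ← Unitization.inr_star,
        ← Unitization.inr_mul, ← Unitization.inr_mul, ← Unitization.inr_sub, Unitization.norm_inr]
      exact hr
    · intro t ht
      rw [← Unitization.quasispectrum_eq_spectrum_inr' ℝ ℂ] at ht
      exact quasispectrum_nonneg_of_nonneg a ha t ht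
  set p := cfcₙ (rampFn ε) a with hp
  have hps : star p = p := (cfcₙ_predicate (rampFn ε) a : IsSelfAdjoint _)
  have hpp : p * p = p := by
    rw [cfcₙ_sub (rampFn ε) (fun t => rampFn ε t * rampFn ε t) a hr.continuousOn hr0
      (by fun_prop) (by simp [hr0]),
      cfcₙ_mul (rampFn ε) (rampFn ε) a hr.continuousOn hr0 hr.continuousOn hr0] at key
    exact (sub_eq_zero.1 key).symm
  refine ⟨p, hps, hpp, ?_, ?_⟩
  · intro δ hδ
    set k : ℝ → ℝ := fun t => rampFn ε t / √(max t (ε / 2)) with hk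
    have hm : ∀ t, 0 < max t (ε / 2) := fun t => lt_max_of_lt_right (by linarith)
    have hkc : Continuous k := by
      rw [hk]
      exact hr.div (by fun_prop) (fun t => (Real.sqrt_pos.2 (hm t)).ne')
    have hk0 : k 0 = 0 := by simp [hk, hr0]
    have hks : star (cfcₙ k a) = cfcₙ k a := (cfcₙ_predicate k a : IsSelfAdjoint _)
    refine ⟨cfcₙ k a, ?_⟩
    have : cfcₙ k a * a * star (cfcₙ k a) = p := by
      rw [hks]
      conv_lhs => rw [← cfcₙ_id' ℝ a]
      rw [cfcₙ_id' ℝ a]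
      nth_rewrite 2 [← cfcₙ_id' ℝ a]
      rw [← cfcₙ_mul k (fun t => t) a hkc.continuousOn hk0 (by fun_prop) rfl,
        ← cfcₙ_mul (fun t => k t * t) k a (by fun_prop) (by simp) hkc.continuousOn hk0,
        ← hpp, hp, ← cfcₙ_mul (rampFn ε) (rampFn ε) a hr.continuousOn hr0 hr.continuousOn hr0]
      congr 1; ext t
      rcases le_total t (ε / 2) with h | h
      · simp [hk, rampFn_of_le hε h]
      · have h1 : √(max t (ε / 2)) * √(max t (ε / 2)) = t := by
          rw [Real.mul_self_sqrt (hm t).le, max_eq_left h]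
        have h2 := (Real.sqrt_pos.2 (hm t)).ne'
        simp only [hk]
        field_simp
        rw [pow_two (√_), h1]
    rw [this, sub_self, norm_zero]
    exact hδ
  · intro δ hδ
    obtain ⟨r, hrr⟩ := hc δ hδ
    set g : ℝ → ℝ := fun t => √(max (t - ε) 0) with hg
    have hgc : Continuous g := by rw [hg]; fun_prop
    have hg0 : g 0 = 0 := by simp only [hg]; rw [hb0]; simp
    have hgs : star (cfcₙ g a) = cfcₙ g a := (cfcₙ_predicate g a : IsSelfAdjoint _)
    refine ⟨r * cfcₙ g a, ?_⟩
    have : cfcₙ g a * p * cfcₙ g a = cutDown a ε := by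
      rw [hp, ← cfcₙ_mul g (rampFn ε) a hgc.continuousOn hg0 hr.continuousOn hr0,
        ← cfcₙ_mul (fun t => g t * rampFn ε t) g a (by fun_prop) (by simp [hg0])
          hgc.continuousOn hg0, cutDown]
      congr 1; ext t
      rcases le_total t ε with h | h
      · simp only [hg]; rw [max_eq_right (by linarith)]; simp
      · rw [rampFn_of_ge hε h, mul_one]
        exact Real.mul_self_sqrt (le_max_right _ _)
    rw [star_mul, hgs]
    have h2 : r * cfcₙ g a * p * (cfcₙ g a * star r) = r * (cfcₙ g a * p * cfcₙ g a) * star r := by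
      simp only [mul_assoc]
    rw [h2, this]
    exact hrr
end

section
/- Let A be a C*-algebra and let J ⊆ A be a closed two-sided ideal. Then: (a) for positive elements x, y ∈ J, if x ≾ y in A, then x ≾ y in J (i.e., the witnesses r can be chosen in J: for every ε > 0 there exists r ∈ J with ‖r * y * (star r) − x‖ < ε); (b) for positive elements a ∈ A and b ∈ J, if a ≾ b in A, then a ∈ J. In other words, the natural map Cuntz-comparison-wise from J to A is an order-embedding with hereditary (downward closed) image. -/
/-- For a closed two-sided ideal `J ⊆ A`: (a) Cuntz comparison of positive elements of `J`
can be witnessed inside `J`; (b) if `a ≾ b` with `b ∈ J`, then `a ∈ J`. Hence the natural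
map `Cu(J) → Cu(A)` is an order-embedding with hereditary image. -/
theorem cuntz_ideal_orderEmbedding {A : Type*} [NonUnitalCStarAlgebra A] [PartialOrder A]
    [StarOrderedRing A] (J : TwoSidedIdeal A) (hJ : IsClosed (J : Set A)) :
    (∀ x y : A, x ∈ J → y ∈ J → 0 ≤ x → 0 ≤ y → CuntzLE x y →
      ∀ ε > 0, ∃ r ∈ J, ‖r * y * star r - x‖ < ε) ∧
    (∀ a b : A, 0 ≤ a → 0 ≤ b → b ∈ J → CuntzLE a b → a ∈ J) := by
  refine ⟨?_, ?_⟩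
  · intro x y hx hy hx0 hy0 hxy ε hε
    obtain ⟨s, hs⟩ := hxy (ε / 2) (by positivity)
    have hsa : IsSelfAdjoint x := IsSelfAdjoint.of_nonneg hx0
    obtain ⟨d, hd, hdε⟩ : ∃ d : ℝ, 0 < d ∧ d = ε / 2 := ⟨ε / 2, by positivity, rfl⟩
    have hpos : ∀ t : ℝ, 0 < t ^ 2 + d ^ 2 := fun t => by positivity
    have hg : Continuous (fun t : ℝ => t / (t ^ 2 + d ^ 2)) :=
      continuous_id.div (by fun_prop) (fun t => (hpos t).ne')
    have hf : Continuous (fun t : ℝ => t * (t / (t ^ 2 + d ^ 2))) := continuous_id.mul hg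
    obtain ⟨e, he⟩ : ∃ e : A, e = cfcₙ (fun t : ℝ => t * (t / (t ^ 2 + d ^ 2))) x := ⟨_, rfl⟩
    have heJ : e ∈ J := by
      rw [he, cfcₙ_mul (fun t : ℝ => t) _ x (by fun_prop) (by simp) hg.continuousOn (by simp),
        cfcₙ_id' ℝ x]
      exact J.mul_mem_right _ _ hx
    have hes : star e = e := by
      rw [he]; exact (cfcₙ_predicate _ x : IsSelfAdjoint _).star_eq
    have hen : ‖e‖ ≤ 1 := by
      rw [he]
      refine norm_cfcₙ_le fun t _ => ?_
      rw [Real.norm_eq_abs, abs_of_nonneg (by rw [← mul_div_assoc]; have := hpos t; have := mul_self_nonneg t; positivity), ← mul_div_assoc, div_le_one (hpos t)]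
      nlinarith [sq_nonneg d]
    have hexe : ‖e * x * e - x‖ ≤ d := by
      have h1 : e * x * e - x = cfcₙ (fun t : ℝ =>
          (t * (t / (t ^ 2 + d ^ 2))) * t * (t * (t / (t ^ 2 + d ^ 2))) - t) x := by
        rw [cfcₙ_sub (fun t : ℝ =>
          (t * (t / (t ^ 2 + d ^ 2))) * t * (t * (t / (t ^ 2 + d ^ 2)))) (fun t : ℝ => t) x
            ((hf.mul continuous_id).mul hf).continuousOn (by simp) (by fun_prop) (by simp),
          cfcₙ_mul (fun t : ℝ => (t * (t / (t ^ 2 + d ^ 2))) * t) _ x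
            (hf.mul continuous_id).continuousOn (by simp) hf.continuousOn (by simp),
          cfcₙ_mul (fun t : ℝ => (t * (t / (t ^ 2 + d ^ 2)))) (fun t => t) x
            hf.continuousOn (by simp) (by fun_prop) (by simp), cfcₙ_id' ℝ x, ← he]
      rw [h1]
      refine norm_cfcₙ_le fun t _ => ?_
      have hp := hpos t
      have h2 : (t * (t / (t ^ 2 + d ^ 2))) * t * (t * (t / (t ^ 2 + d ^ 2))) - t
          = - (t * d ^ 2 * (2 * t ^ 2 + d ^ 2)) / (t ^ 2 + d ^ 2) ^ 2 := by
        field_simp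
        ring
      rw [h2, Real.norm_eq_abs, abs_div, abs_neg, abs_mul, abs_mul,
        abs_of_pos (pow_pos hp 2), abs_of_nonneg (sq_nonneg d),
        abs_of_nonneg (by positivity : 0 ≤ 2 * t ^ 2 + d ^ 2), div_le_iff₀ (pow_pos hp 2),
        ← sq_abs t]
      generalize |t| = u
      have h3 : 2 * (u * d) ≤ u ^ 2 + d ^ 2 := by nlinarith [sq_nonneg (u - d)]
      have h4 : 2 * u ^ 2 + d ^ 2 ≤ 2 * (u ^ 2 + d ^ 2) := by nlinarith [sq_nonneg d]
      calc u * d ^ 2 * (2 * u ^ 2 + d ^ 2) = d * ((u * d) * (2 * u ^ 2 + d ^ 2)) := by ring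
        _ ≤ d * (((u ^ 2 + d ^ 2) / 2) * (2 * (u ^ 2 + d ^ 2))) := by
            gcongr
            linarith
        _ = d * (u ^ 2 + d ^ 2) ^ 2 := by ring
    refine ⟨e * s, J.mul_mem_right _ _ heJ, ?_⟩
    have h5 : e * s * y * star (e * s) - x = e * (s * y * star s - x) * e + (e * x * e - x) := by
      rw [star_mul, hes]
      simp only [mul_sub, sub_mul, mul_assoc]
      abel
    have h6 : ‖e * (s * y * star s - x) * e‖ ≤ ‖s * y * star s - x‖ := by
      calc _ ≤ ‖e‖ * ‖s * y * star s - x‖ * ‖e‖ := norm_mul₃_le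
        _ ≤ 1 * ‖s * y * star s - x‖ * 1 := by gcongr
        _ = _ := by ring
    rw [h5]
    have h7 := norm_add_le (e * (s * y * star s - x) * e) (e * x * e - x)
    linarith
  · intro a b _ _ hb hab
    have : a ∈ closure (J : Set A) := by
      rw [Metric.mem_closure_iff]
      intro ε hε
      obtain ⟨r, hr⟩ := hab ε hε
      refine ⟨r * b * star r, J.mul_mem_right _ _ (J.mul_mem_left _ _ hb), ?_⟩
      rwa [dist_comm, dist_eq_norm]
    rwa [hJ.closure_eq] at this
end

section
/- (Finiteness direction of Cuntz's theorem, tracial case) Let A be a simple unital C*-algebra, meaning every closed two-sided ideal of A equals {0} or A, and suppose A admits a tracial state: a linear functional τ : A → ℂ with τ(1) = 1, τ(a) ≥ 0 (real and nonnegative) for every positive a ∈ A, and τ((star x) * x) = τ(x * (star x)) for all x ∈ A. Then A is finite: every isometry is a unitary, i.e., for every v ∈ A with (star v) * v = 1 one has v * (star v) = 1. -/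
open ComplexOrder

/-- **A simple unital C*-algebra with a tracial state is finite.** If every closed two-sided
ideal of `A` is trivial and `A` admits a tracial state `τ`, then every isometry in `A` is a
unitary. -/
theorem isometry_is_unitary_of_simple_of_tracialState {A : Type*} [CStarAlgebra A]
    [PartialOrder A] [StarOrderedRing A]
    (hsimple : ∀ J : TwoSidedIdeal A, IsClosed (J : Set A) → J = ⊥ ∨ J = ⊤)
    (τ : A →ₗ[ℂ] ℂ) (hτ1 : τ 1 = 1) (hτpos : ∀ a : A, 0 ≤ a → 0 ≤ τ a)
    (hτtr : ∀ x : A, τ (star x * x) = τ (x * star x)) :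
    ∀ v : A, star v * v = 1 → v * star v = 1 := by
  intro v hv
  have hmono : ∀ a b : A, a ≤ b → τ a ≤ τ b := fun a b hab => by
    have := hτpos (b - a) (sub_nonneg.2 hab)
    rwa [map_sub, sub_nonneg] at this
  have hcont : Continuous τ := map_continuous (PositiveLinearMap.mk₀ τ hτpos)
  have hstar : ∀ x : A, τ (star x * x) = 0 → τ (star (star x) * star x) = 0 := fun x hx => by
    rw [star_star, ← hτtr, hx]
  have hleft : ∀ x y : A, τ (star y * y) = 0 → τ (star (x * y) * (x * y)) = 0 := by
    intro x y hy
    have h1 : star (x * y) * (x * y) ≤ ‖star x * x‖ • (star y * y) := by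
      have := CStarAlgebra.star_left_conjugate_le_norm_smul (a := y) (b := star x * x)
        (IsSelfAdjoint.star_mul_self x)
      simpa [mul_assoc] using this
    have h2 := hmono _ _ h1
    rw [← Complex.coe_smul, map_smul, hy, smul_zero] at h2
    exact le_antisymm h2 (hτpos _ (star_mul_self_nonneg _))
  let J : TwoSidedIdeal A := TwoSidedIdeal.mk' {x : A | τ (star x * x) = 0}
    (by simp)
    (by
      intro x y hx hy
      simp only [Set.mem_setOf_eq] at hx hy ⊢
      have h1 : star (x + y) * (x + y) ≤
          (star x * x + star x * x) + (star y * y + star y * y) := by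
        rw [← sub_nonneg]
        have := star_mul_self_nonneg (x - y)
        convert this using 1
        simp only [star_add, star_sub]
        noncomm_ring
      have h2 := hmono _ _ h1
      simp only [map_add τ, hx, hy, add_zero] at h2
      exact le_antisymm h2 (hτpos _ (star_mul_self_nonneg _)))
    (by intro x hx; simpa using hx)
    (by intro x y hy; exact hleft x y hy)
    (by
      intro x y hx
      have := hstar _ (hleft (star y) (star x) (hstar x hx))
      simpa using this)
  have hmem : ∀ x, x ∈ J ↔ τ (star x * x) = 0 := fun x => TwoSidedIdeal.mem_mk' _ _ _ _ _ _ x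
  have hclosed : IsClosed (J : Set A) := by
    have : (J : Set A) = {x : A | τ (star x * x) = 0} := Set.ext hmem
    rw [this]
    exact isClosed_eq (hcont.comp (by fun_prop)) continuous_const
  have hp : 1 - v * star v ∈ J := by
    rw [hmem]
    have : star (1 - v * star v) * (1 - v * star v) = 1 - v * star v := by
      have h3 : v * star v * (v * star v) = v * star v := by
        rw [mul_assoc, ← mul_assoc (star v), hv, one_mul]
      simp only [star_sub, star_one, star_mul, star_star, mul_sub, sub_mul, mul_one, one_mul, h3]
      abel
    rw [this, map_sub, ← hτtr, hv, sub_self]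
  rcases hsimple J hclosed with h | h
  · rw [h, TwoSidedIdeal.mem_bot, sub_eq_zero] at hp
    exact hp.symm
  · have h1 : (1 : A) ∈ J := by rw [h]; trivial
    rw [hmem] at h1
    simp [hτ1] at h1
end
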